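/- Let G=(X,Y;E) be a bipartite graph and C a longest cycle of G. Suppose that |X| = n, |Y| = m, and |V(C)| = 2t, where n ≥ m ≥ t. If m ≥ 2t, then e(G−C) + e(G−C, C) ≤ t(m+n+1−3t), i.e. the number of edges of G having at least one endpoint outside V(C) is at most t(m+n+1−3t). -/

import Mathlib

namespace BipCyc
open Finset
open scoped Classical

variable {V : Type*} {G : SimpleGraph V}

/-- `l` lists the vertices of a path from `a` to `b`. -/
def Pth (G : SimpleGraph V) (l : List V) (a b : V) : Prop :=
  l.IsChain G.Adj ∧ l.Nodup ∧ l.head? = some a ∧ l.getLast? = some b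

lemma Pth.singleton (a : V) : Pth G [a] a a := by simp [Pth]

lemma Pth.ne_nil {l : List V} {a b : V} (h : Pth G l a b) : l ≠ [] := by
  rintro rfl; simp [Pth] at h

lemma Pth.length_pos {l : List V} {a b : V} (h : Pth G l a b) : 1 ≤ l.length :=
  List.length_pos_iff.2 h.ne_nil

lemma Pth.head_mem {l : List V} {a b : V} (h : Pth G l a b) : a ∈ l :=
  List.mem_of_mem_head? h.2.2.1

lemma Pth.last_mem {l : List V} {a b : V} (h : Pth G l a b) : b ∈ l :=
  List.mem_of_mem_getLast? h.2.2.2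

lemma Pth.reverse {l : List V} {a b : V} (h : Pth G l a b) : Pth G l.reverse b a := by
  refine ⟨?_, by simpa using h.2.1, by simp [h.2.2.2], by simp [h.2.2.1]⟩
  rw [List.isChain_reverse]
  exact h.1.imp fun _ _ e => e.symm

lemma Pth.append {l₁ l₂ : List V} {a b d e : V} (h₁ : Pth G l₁ a b) (h₂ : Pth G l₂ d e)
    (hbd : G.Adj b d) (hd : ∀ v ∈ l₁, v ∉ l₂) : Pth G (l₁ ++ l₂) a e := by
  refine ⟨?_, ?_, by simp [h₁.2.2.1], by simp [h₂.2.2.2]⟩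
  · rw [List.isChain_append]
    refine ⟨h₁.1, h₂.1, ?_⟩
    intro x hx y hy
    rw [h₁.2.2.2] at hx; rw [h₂.2.2.1] at hy
    simp at hx hy; subst hx hy; exact hbd
  · rw [List.nodup_append]
    refine ⟨h₁.2.1, h₂.2.1, ?_⟩
    rintro x hx y hy rfl
    exact hd x hx hy

lemma Pth.cons {l : List V} {a b v : V} (h : Pth G l a b) (hva : G.Adj v a) (hv : v ∉ l) :
    Pth G (v :: l) v b :=
  (Pth.singleton v).append h hva (by simpa using hv)

/-- Splitting a path at an internal point. -/
lemma Pth.split {l₁ l₂ : List V} {a b v : V} (h : Pth G (l₁ ++ v :: l₂) a b) :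
    Pth G (l₁ ++ [v]) a v ∧ Pth G (v :: l₂) v b := by
  obtain ⟨h1, h2, h3, h4⟩ := h
  refine ⟨⟨?_, ?_, ?_, ?_⟩, ⟨?_, ?_, ?_, ?_⟩⟩
  · rw [List.isChain_split] at h1; exact h1.1
  · have : (l₁ ++ [v]).Sublist (l₁ ++ v :: l₂) := by simp
    exact this.nodup h2
  · cases l₁ <;> simpa using h3
  · simp
  · rw [List.isChain_split] at h1; exact h1.2
  · exact (List.sublist_append_right _ _).nodup h2
  · simp
  · simpa [List.getLast?_append] using h4

/-- A bipartite graph, properly coloured by `col`, with a longest cycle of length `2t`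
parametrized periodically by `c`. -/
structure BipCycle (G : SimpleGraph V) (col : V → Bool) (c : ℤ → V) (t : ℕ) : Prop where
  two_le : 2 ≤ t
  proper : ∀ {u v}, G.Adj u v → col u ≠ col v
  adj : ∀ i, G.Adj (c i) (c (i + 1))
  inj : ∀ {i j}, c i = c j ↔ (2 * t : ℤ) ∣ j - i
  even : ∀ {i}, col (c i) = true ↔ Even i
  long : ∀ {l a b}, Pth G l a b → 3 ≤ l.length → G.Adj b a → l.length ≤ 2 * t

variable {col : V → Bool} {c : ℤ → V} {t : ℕ}

lemma BipCycle.swap (h : BipCycle G col c t) :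
    BipCycle G (fun v => !col v) (fun i => c (i + 1)) t where
  two_le := h.two_le
  proper := by intro u v huv; have := h.proper huv; simpa using this
  adj := fun i => h.adj _
  inj := by intro i j; rw [h.inj]; simp
  even := by
    intro i
    have := h.even (i := i + 1)
    simp only [Bool.not_eq_true', ← Bool.not_eq_true, this]
    simp
  long := h.long

lemma BipCycle.periodic (h : BipCycle G col c t) (i : ℤ) : c (i + 2 * t) = c i := by
  rw [h.inj]; simp

lemma BipCycle.inj_of_lt (h : BipCycle G col c t) {i j : ℤ} (hij : c i = c j)
    (h1 : i - 2 * t < j) (h2 : j < i + 2 * t) : i = j := by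
  rw [h.inj] at hij
  have := Int.eq_zero_of_abs_lt_dvd hij (by rw [abs_lt]; constructor <;> linarith)
  linarith

lemma BipCycle.parity (h : BipCycle G col c t) {v : V} {i : ℤ} (hv : G.Adj v (c i)) :
    (col v = true ↔ ¬ Even i) := by
  have := h.proper hv
  rw [← h.even]
  cases h1 : col v <;> cases h2 : col (c i) <;> simp_all

/-- The arc of the cycle with `n` vertices starting at position `i`. -/
def arc (c : ℤ → V) (i : ℤ) (n : ℕ) : List V := (List.range n).map fun k : ℕ => c (i + k)

lemma mem_arc {i : ℤ} {n : ℕ} {v : V} : v ∈ arc c i n ↔ ∃ k : ℕ, k < n ∧ c (i + k) = v := by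
  simp [arc]

@[simp] lemma length_arc {i : ℤ} {n : ℕ} : (arc c i n).length = n := by simp [arc]

lemma BipCycle.arc_pth (h : BipCycle G col c t) {i j : ℤ} (hij : i ≤ j) (hj : j < i + 2 * t) :
    Pth G (arc c i (j - i + 1).toNat) (c i) (c j) := by
  obtain ⟨n, rfl⟩ : ∃ n : ℕ, j = i + n := ⟨(j - i).toNat, by omega⟩
  have e : (i + n - i + 1 : ℤ).toNat = n + 1 := by omega
  rw [e]
  refine ⟨?_, ?_, ?_, ?_⟩
  · rw [arc, List.isChain_map, List.isChain_range]
    intro m hm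
    have := h.adj (i + m)
    push_cast; rwa [← add_assoc]
  · rw [arc, List.nodup_map_iff_inj_on List.nodup_range]
    intro a ha b hb hab
    simp at ha hb
    have := h.inj_of_lt hab (by omega) (by omega)
    omega
  · simp [arc, List.range_succ_eq_map]
  · simp [arc, List.range_succ]

/-- Vertices outside the cycle. -/
def Out (c : ℤ → V) (l : List V) : Prop := ∀ v ∈ l, ∀ i, v ≠ c i

lemma BipCycle.ear (h : BipCycle G col c t) {E : List V} {a b : V} (hE : Pth G E a b)
    (ho : Out c E) {i j : ℤ} (hi : G.Adj a (c i)) (hj : G.Adj b (c j)) (hij : i < j)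
    (hji : j < i + 2 * t) : (E.length : ℤ) + 1 ≤ j - i := by
  have p := h.arc_pth (i := j) (j := i + 2 * t) (by omega) (by omega)
  have q := hE.append p hj (by
    intro v hv hv'
    obtain ⟨k, _, hk⟩ := mem_arc.1 hv'
    exact ho v hv _ hk.symm)
  have := h.long q (by simp; have := hE.length_pos; omega) (by rw [h.periodic]; exact hi.symm)
  simp at this
  omega

lemma BipCycle.double (h : BipCycle G col c t) {E F : List V} {a b d e : V} (hE : Pth G E a b)
    (hF : Pth G F d e) (ho : Out c E) (ho' : Out c F) (hEF : ∀ v ∈ E, v ∉ F) {u w v z : ℤ}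
    (hau : G.Adj a (c u)) (hbv : G.Adj b (c v)) (hdw : G.Adj d (c w)) (hez : G.Adj e (c z))
    (huw : u < w) (hwv : w ≤ v) (hvz : v < z) (hzu : z ≤ u + 2 * t) :
    (E.length : ℤ) + F.length + 2 ≤ (w - u) + (z - v) := by
  have p := (h.arc_pth hwv (by omega)).reverse
  have q := h.arc_pth (i := z) (j := u + 2 * t) (by omega) (by omega)
  have hout : ∀ {L : List V} {i : ℤ} {n : ℕ}, Out c L → ∀ v ∈ L, v ∉ arc c i n := by
    intro L i n hL v hv hv'
    obtain ⟨k, _, hk⟩ := mem_arc.1 hv'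
    exact hL v hv _ hk.symm
  have r1 := hE.append p hbv (by
    intro x hx hx'
    rw [List.mem_reverse] at hx'
    exact hout ho x hx hx')
  have r2 := hF.append q hez (hout ho')
  have r3 := r1.append r2 hdw.symm (by
    intro x hx hx'
    rw [List.mem_append, List.mem_reverse] at hx
    rw [List.mem_append] at hx'
    rcases hx with hx | hx <;> rcases hx' with hx' | hx'
    · exact hEF x hx hx'
    · exact hout ho x hx hx'
    · exact hout ho' x hx' hx
    · obtain ⟨k, hk, rfl⟩ := mem_arc.1 hx
      obtain ⟨k', hk', e'⟩ := mem_arc.1 hx'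
      have := h.inj_of_lt e' (by omega) (by omega)
      omega)
  have := h.long r3 (by
    simp; have := hE.length_pos; have := hF.length_pos; omega) (by
    rw [h.periodic]; exact hau.symm)
  simp at this
  omega

end BipCyc

namespace BipCyc
open Finset
open scoped Classical

/-- The number of elements of a `T`-periodic set of integers in one period. -/
noncomputable def pc (T : ℕ) (P : ℤ → Prop) : ℕ := #{i ∈ Finset.Ico (0 : ℤ) T | P i}

/-- `P` is `T`-periodic. -/
def Per (T : ℕ) (P : ℤ → Prop) : Prop := ∀ i, P (i + T) ↔ P i

variable {T : ℕ} {P Q : ℤ → Prop}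

lemma Per.add_mul (h : Per T P) (k i : ℤ) : P (i + k * T) ↔ P i := by
  induction k using Int.induction_on with
  | zero => simp
  | succ n ih => rw [← ih, ← h (i + n * T)]; ring_nf
  | pred n ih => rw [← ih, ← h (i + (-n - 1) * T)]; ring_nf

lemma Per.shift (h : Per T P) (k : ℤ) : Per T (fun i => P (i + k)) := by
  intro i
  have := h (i + k)
  rwa [show i + k + T = i + T + k by ring] at this

/-- A translate by a multiple of the period lands in any given window. -/
lemma Per.exists_window (h : Per T P) (hT : 1 ≤ T) {i : ℤ} (hi : P i) (a : ℤ) :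
    ∃ j, a ≤ j ∧ j < a + T ∧ P j ∧ (T : ℤ) ∣ j - i := by
  refine ⟨a + (i - a) % T, ?_, ?_, ?_, ?_⟩
  · have := Int.emod_nonneg (i - a) (b := T) (by omega); omega
  · have := Int.emod_lt_of_pos (i - a) (b := T) (by omega); omega
  · rw [← h.add_mul ((i - a) / T)]
    have := Int.emod_add_mul_ediv (i - a) T
    rw [show a + (i - a) % T + (i - a) / T * T = i by linarith]
    exact hi
  · have := Int.emod_add_mul_ediv (i - a) T
    exact ⟨-((i - a) / T), by linarith⟩

lemma pc_window (h : Per T P) (hT : 1 ≤ T) (a : ℤ) : #{i ∈ Finset.Ico a (a + T) | P i} = pc T P := by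
  have key : ∀ x y : ℤ, P (y + (x - y) % T) ↔ P x := by
    intro x y
    rw [← h.add_mul ((x - y) / T)]
    have := Int.emod_add_mul_ediv (x - y) T
    rw [show y + (x - y) % T + (x - y) / T * T = x by linarith]
  have main : ∀ x y z : ℤ, y ≤ x → x < y + T → y + (z + (x - z) % T - y) % T = x := by
    intro x y z h1 h2
    have e : (z + (x - z) % T - y) % T = (x - y) % T := by
      apply Int.ModEq.eq
      have := (Int.mod_modEq (x - z) T)
      calc z + (x - z) % T - y ≡ z + (x - z) - y [ZMOD T] := (this.add_left z).sub_right y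
        _ = x - y := by ring
    rw [e, Int.emod_eq_of_lt (by omega) (by omega)]; ring
  have rng : ∀ x y : ℤ, y ≤ y + (x - y) % T ∧ y + (x - y) % T < y + T := by
    intro x y
    have := Int.emod_nonneg (x - y) (b := T) (by omega)
    have := Int.emod_lt_of_pos (x - y) (b := T) (by omega)
    omega
  unfold pc
  apply Finset.card_nbij' (fun x : ℤ => 0 + (x - 0) % T) (fun x : ℤ => a + (x - a) % T)
  · intro x hx
    simp only [Finset.coe_filter, Set.mem_ofPred_eq, Finset.mem_Ico] at hx ⊢
    refine ⟨by have := rng x 0; omega, (key _ _).2 hx.2⟩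
  · intro x hx
    simp only [Finset.coe_filter, Set.mem_ofPred_eq, Finset.mem_Ico] at hx ⊢
    exact ⟨rng x a, (key _ _).2 hx.2⟩
  · intro x hx
    simp only [Finset.coe_filter, Set.mem_ofPred_eq, Finset.mem_Ico] at hx
    exact main x a 0 hx.1.1 hx.1.2
  · intro x hx
    simp only [Finset.coe_filter, Set.mem_ofPred_eq, Finset.mem_Ico] at hx
    exact main x 0 a hx.1.1 (by omega)

lemma pc_shift (h : Per T P) (hT : 1 ≤ T) (k : ℤ) : pc T (fun i => P (i + k)) = pc T P := by
  rw [← pc_window h hT k, pc]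
  apply Finset.card_nbij' (fun x => x + k) (fun x => x - k)
  · intro x hx
    simp only [Finset.coe_filter, Set.mem_ofPred_eq, Finset.mem_Ico] at hx ⊢
    exact ⟨by omega, hx.2⟩
  · intro x hx
    simp only [Finset.coe_filter, Set.mem_ofPred_eq, Finset.mem_Ico] at hx ⊢
    refine ⟨by omega, ?_⟩
    simpa using hx.2
  · intro x _; simp
  · intro x _; simp

lemma pc_or (T : ℕ) (P Q : ℤ → Prop) :
    pc T (fun i => P i ∨ Q i) + pc T (fun i => P i ∧ Q i) = pc T P + pc T Q := by
  unfold pc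
  simp only
  rw [Finset.filter_or, Finset.filter_and, Finset.card_union_add_card_inter]

lemma pc_le (T : ℕ) (P : ℤ → Prop) : pc T P ≤ T := by
  unfold pc
  exact (Finset.card_filter_le _ _).trans (by simp)

lemma pc_eq_zero (h : ∀ i, ¬ P i) : pc T P = 0 := by
  unfold pc; simp [h]

lemma pc_mono (h : ∀ i, P i → Q i) : pc T P ≤ pc T Q := by
  unfold pc
  exact Finset.card_le_card fun i hi => by
    simp only [Finset.mem_filter] at hi ⊢; exact ⟨hi.1, h i hi.2⟩

lemma pc_add_of_disjoint (h : ∀ i, P i → ¬ Q i) :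
    pc T P + pc T Q = pc T (fun i => P i ∨ Q i) := by
  rw [← pc_or, pc_eq_zero (P := fun i => P i ∧ Q i) (fun i hi => h i hi.1 hi.2)]; simp

lemma pc_pos (h : Per T P) (hT : 1 ≤ T) {i : ℤ} (hi : P i) : 1 ≤ pc T P := by
  obtain ⟨j, h1, h2, h3, _⟩ := h.exists_window hT hi 0
  unfold pc
  exact Finset.card_pos.2 ⟨j, by simp; exact ⟨⟨h1, by omega⟩, h3⟩⟩

lemma exists_of_pc_pos (h : 1 ≤ pc T P) : ∃ i, P i := by
  by_contra! hc
  rw [pc_eq_zero hc] at h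
  omega

/-- Two disjoint blocks of integers inside one period, all in `P`. -/
lemma two_blocks_le_pc (h : Per T P) (hT : 1 ≤ T) {a b d e z : ℤ} (hz : z ≤ a) (hbd : b ≤ d)
    (he : e ≤ z + T) (hab : a ≤ b) (hde : d ≤ e)
    (h1 : ∀ k, a ≤ k → k < b → P k) (h2 : ∀ k, d ≤ k → k < e → P k) :
    (b - a) + (e - d) ≤ (pc T P : ℤ) := by
  rw [← pc_window h hT z]
  have : Finset.Ico a b ∪ Finset.Ico d e ⊆ {i ∈ Finset.Ico z (z + T) | P i} := by
    intro k hk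
    simp only [Finset.mem_union, Finset.mem_Ico, Finset.mem_filter] at hk ⊢
    rcases hk with hk | hk
    · exact ⟨⟨by omega, by omega⟩, h1 k hk.1 hk.2⟩
    · exact ⟨⟨by omega, by omega⟩, h2 k hk.1 hk.2⟩
  have := Finset.card_le_card this
  rw [Finset.card_union_of_disjoint (by
    rw [Finset.disjoint_left]; intro k; simp only [Finset.mem_Ico]; omega)] at this
  simp only [Int.card_Ico] at this
  omega

lemma block_le_pc (h : Per T P) (hT : 1 ≤ T) {a b z : ℤ} (hz : z ≤ a)
    (he : b ≤ z + T) (hab : a ≤ b) (h1 : ∀ k, a ≤ k → k < b → P k) :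
    (b - a) ≤ (pc T P : ℤ) := by
  have := two_blocks_le_pc h hT hz le_rfl he hab le_rfl h1 (fun k h1 h2 => by omega)
  omega

lemma exists_last {u v : ℤ} (h : P u) (huv : u < v) :
    ∃ i, u ≤ i ∧ i < v ∧ P i ∧ ∀ k, i < k → k < v → ¬ P k := by
  obtain ⟨i, ⟨h1, h2⟩, h3⟩ := Int.exists_greatest_of_bdd (P := fun i => P i ∧ i < v)
    ⟨v, fun z hz => hz.2.le⟩ ⟨u, h, huv⟩
  exact ⟨i, h3 u ⟨h, huv⟩, h2, h1, fun k hk hk' hP => by have := h3 k ⟨hP, hk'⟩; omega⟩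

lemma exists_first {u v : ℤ} (h : P v) (huv : u ≤ v) :
    ∃ i, u ≤ i ∧ i ≤ v ∧ P i ∧ ∀ k, u ≤ k → k < i → ¬ P k := by
  obtain ⟨i, ⟨h1, h2⟩, h3⟩ := Int.exists_least_of_bdd (P := fun i => P i ∧ u ≤ i)
    ⟨u, fun z hz => hz.2⟩ ⟨v, h, huv⟩
  exact ⟨i, h2, h3 v ⟨h, huv⟩, h1, fun k hk hk' hP => by have := h3 k ⟨hP, hk⟩; omega⟩

/-- Between an element of `P` and a later element of `Q` there are consecutive ones. -/
lemma exists_gap {u v : ℤ} (hu : P u) (hv : Q v) (huv : u < v) :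
    ∃ i j, u ≤ i ∧ i < j ∧ j ≤ v ∧ P i ∧ Q j ∧ (∀ k, i < k → k < j → ¬ P k) ∧
      ∀ k, i < k → k < j → ¬ Q k := by
  obtain ⟨i, h1, h2, h3, h4⟩ := exists_last hu huv
  obtain ⟨j, h5, h6, h7, h8⟩ := exists_first (u := i + 1) hv (by omega)
  exact ⟨i, j, h1, by omega, h6, h3, h7, fun k a b => h4 k a (by omega),
    fun k a b => h8 k (by omega) b⟩

lemma two_card_le {S : Finset ℤ} {α β : ℤ} (h1 : ∀ x ∈ S, α ≤ x) (h2 : ∀ x ∈ S, x ≤ β)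
    (hp : ∀ x ∈ S, ∀ y ∈ S, Even (x - y)) (hab : α ≤ β + 2) : 2 * (#S : ℤ) ≤ β - α + 2 := by
  have hd : Disjoint S (S.image (· + 1)) := by
    rw [Finset.disjoint_left]
    intro x hx hx'
    obtain ⟨y, hy, rfl⟩ := Finset.mem_image.1 hx'
    have := hp _ hx _ hy
    simp at this
  have hs : S ∪ S.image (· + 1) ⊆ Finset.Ico α (β + 2) := by
    intro x hx
    simp only [Finset.mem_union, Finset.mem_image, Finset.mem_Ico] at hx ⊢
    rcases hx with hx | ⟨y, hy, rfl⟩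
    · have := h1 x hx; have := h2 x hx; omega
    · have := h1 y hy; have := h2 y hy; omega
  have := Finset.card_le_card hs
  rw [Finset.card_union_of_disjoint hd, Finset.card_image_of_injective _ (add_left_injective 1),
    Int.card_Ico] at this
  omega

/-- Consider a set with one parity and period `2t`, whose elements other than `τ` stay at distance
at least `n` from `τ`. -/
lemma pc_far {t n : ℕ} (h : Per (2 * t) P) (hpar : ∀ i j, P i → P j → Even (i - j)) {τ : ℤ}
    {i : ℤ} (hi : P i) (hiτ : ¬ (2 * t : ℤ) ∣ i - τ) (ht : 1 ≤ t)
    (h1 : ∀ j, τ < j → j < τ + 2 * t → P j → (n : ℤ) ≤ j - τ ∧ n ≤ τ + 2 * t - j) :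
    pc (2 * t) P + n ≤ t + 2 := by
  rw [← pc_window h (by omega) τ]
  have hn : 2 * (n : ℤ) ≤ 2 * t := by
    obtain ⟨j, a, b, d, e⟩ := h.exists_window (by omega) hi τ
    push_cast at b e
    have : j ≠ τ := by
      rintro rfl
      rw [← dvd_neg] at e
      exact hiτ (by simpa using e)
    have := h1 j (by omega) b d
    omega
  have : #(({i ∈ Finset.Ico τ (τ + (2 * t : ℕ)) | P i}).erase τ) * 2 ≤ 2 * (t - n) + 2 := by
    have := two_card_le (S := ({i ∈ Finset.Ico τ (τ + (2 * t : ℕ)) | P i}).erase τ)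
      (α := τ + n) (β := τ + 2 * t - n) ?_ ?_ ?_ ?_
    · omega
    · intro x hx
      simp only [Finset.mem_erase, Finset.mem_filter, Finset.mem_Ico] at hx
      have := h1 x (by omega) (by push_cast at hx; omega) hx.2.2
      omega
    · intro x hx
      simp only [Finset.mem_erase, Finset.mem_filter, Finset.mem_Ico] at hx
      have := h1 x (by omega) (by push_cast at hx; omega) hx.2.2
      omega
    · intro x hx y hy
      simp only [Finset.mem_erase, Finset.mem_filter, Finset.mem_Ico] at hx hy
      exact hpar _ _ hx.2.2 hy.2.2
    · omega
  have := Finset.pred_card_le_card_erase (s := {i ∈ Finset.Ico τ (τ + (2 * t : ℕ)) | P i}) (a := τ)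
  omega

/-- Count the neighbours of an isolated vertex in presence of an ear with ends `u`, `v`. -/
lemma pc_ear {t n : ℕ} (h : Per (2 * t) P) (hpar : ∀ i j, P i → P j → Even (i - j)) (ht : 1 ≤ t)
    {u v : ℤ} (h1 : n ≤ v - u) (h2 : n ≤ u + 2 * t - v) (huv : u < v) (hvu : v < u + 2 * t)
    (h3 : ∀ w z, P w → P z → u < w → w ≤ v → v < z → z ≤ u + 2 * t →
      (n : ℤ) + 2 ≤ (w - u) + (z - v)) :
    2 * pc (2 * t) P + n ≤ 2 * t + 2 := by
  rw [← pc_window h (by omega) (u + 1)]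
  set S := {i ∈ Finset.Ico (u + 1) (u + 1 + (2 * t : ℕ)) | P i}
  have hS : ∀ x, x ∈ S ↔ u < x ∧ x ≤ u + 2 * t ∧ P x := by
    intro x; simp only [S, Finset.mem_filter, Finset.mem_Ico]; push_cast
    constructor
    · rintro ⟨⟨a, b⟩, d⟩; exact ⟨by omega, by omega, d⟩
    · rintro ⟨a, b, d⟩; exact ⟨⟨by omega, by omega⟩, d⟩
  have hpS : ∀ x ∈ S, ∀ y ∈ S, Even (x - y) := fun x hx y hy =>
    hpar x y ((hS x).1 hx).2.2 ((hS y).1 hy).2.2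
  by_cases hI : ∃ w, P w ∧ u < w ∧ w ≤ v
  · by_cases hJ : ∃ z, P z ∧ v < z ∧ z ≤ u + 2 * t
    · obtain ⟨w0, a1, a2, a3⟩ := hI
      obtain ⟨z0, b1, b2, b3⟩ := hJ
      obtain ⟨w, a4, a5, a6, a7⟩ := exists_first (u := u + 1) a1 (by omega)
      obtain ⟨z, b4, b5, b6, b7⟩ := exists_first (u := v + 1) b1 (by omega)
      have k1 := two_card_le (S := S.filter (· ≤ v)) (α := w) (β := v)
        (by
          intro x hx
          simp only [Finset.mem_filter, hS] at hx
          by_contra hc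
          exact a7 x (by omega) (by omega) hx.1.2.2)
        (by intro x hx; simp only [Finset.mem_filter] at hx; exact hx.2)
        (fun x hx y hy => hpS x (Finset.mem_of_mem_filter _ hx) y (Finset.mem_of_mem_filter _ hy))
        (by omega)
      have k2 := two_card_le (S := S.filter (¬ · ≤ v)) (α := z) (β := u + 2 * t)
        (by
          intro x hx
          simp only [Finset.mem_filter, hS] at hx
          by_contra hc
          exact b7 x (by omega) (by omega) hx.1.2.2)
        (by intro x hx; simp only [Finset.mem_filter, hS] at hx; exact hx.1.2.1)
        (fun x hx y hy => hpS x (Finset.mem_of_mem_filter _ hx) y (Finset.mem_of_mem_filter _ hy))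
        (by omega)
      have k3 := Finset.card_filter_add_card_filter_not (s := S) (fun x => x ≤ v)
      have := h3 w z a6 b6 (by omega) (by omega) (by omega) (by omega)
      omega
    · have k1 := two_card_le (S := S) (α := u + 1) (β := v)
        (by intro x hx; rw [hS] at hx; omega)
        (by
          intro x hx
          rw [hS] at hx
          by_contra hc
          exact hJ ⟨x, hx.2.2, by omega, hx.2.1⟩)
        hpS (by omega)
      omega
  · have k1 := two_card_le (S := S) (α := v + 1) (β := u + 2 * t)
      (by
        intro x hx
        rw [hS] at hx
        by_contra hc
        exact hI ⟨x, hx.2.2, hx.1, by omega⟩)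
      (by intro x hx; rw [hS] at hx; omega)
      hpS (by omega)
    omega

/-- Slots after an element of `S` that meet neither `S + 1` nor `S'`. -/
def PV (S S' : ℤ → Prop) (e : ℤ) : Prop :=
  ∃ i, i + 2 ≤ e ∧ S i ∧ (∀ k, i < k → k < e → ¬ S k) ∧ ∀ k, i < k → k ≤ e → ¬ S' k

/-- Slots after an element of `S'` that meet neither `S + 1` nor `S'`. -/
def QV (S S' : ℤ → Prop) (e : ℤ) : Prop :=
  ∃ m, m < e ∧ S' m ∧ (∀ k, m ≤ k → k < e → ¬ S k) ∧ ∀ k, m < k → k ≤ e → ¬ S' k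

section voids
variable {t : ℕ} {S S' : ℤ → Prop}

lemma per_PV (h : Per t S) (h' : Per t S') : Per t (PV S S') := by
  intro e
  constructor
  · rintro ⟨i, h1, h2, h3, h4⟩
    refine ⟨i - t, by omega, ?_, fun k a b => ?_, fun k a b => ?_⟩
    · rw [← h]; simpa using h2
    · rw [← h]; exact h3 _ (by omega) (by omega)
    · rw [← h']; exact h4 _ (by omega) (by omega)
  · rintro ⟨i, h1, h2, h3, h4⟩
    refine ⟨i + t, by omega, ?_, fun k a b => ?_, fun k a b => ?_⟩
    · rwa [h]
    · rw [show k = (k - t) + t by ring, h]; exact h3 _ (by omega) (by omega)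
    · rw [show k = (k - t) + t by ring, h']; exact h4 _ (by omega) (by omega)

lemma per_QV (h : Per t S) (h' : Per t S') : Per t (QV S S') := by
  intro e
  constructor
  · rintro ⟨i, h1, h2, h3, h4⟩
    refine ⟨i - t, by omega, ?_, fun k a b => ?_, fun k a b => ?_⟩
    · rw [← h']; simpa using h2
    · rw [← h]; exact h3 _ (by omega) (by omega)
    · rw [← h']; exact h4 _ (by omega) (by omega)
  · rintro ⟨i, h1, h2, h3, h4⟩
    refine ⟨i + t, by omega, ?_, fun k a b => ?_, fun k a b => ?_⟩
    · rwa [h']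
    · rw [show k = (k - t) + t by ring, h]; exact h3 _ (by omega) (by omega)
    · rw [show k = (k - t) + t by ring, h']; exact h4 _ (by omega) (by omega)

lemma voids_le (h : Per t S) (ht : 1 ≤ t) :
    pc t S + pc t S' + pc t (PV S S') + pc t (QV S S') ≤
      t + pc t (fun e => S (e - 1) ∧ S' e) := by
  have e1 : pc t (fun e => S (e - 1)) = pc t S := by
    simpa [sub_eq_add_neg] using pc_shift h ht (-1)
  have e2 := pc_or t (fun e => S (e - 1)) S'
  have e3 := pc_add_of_disjoint (T := t) (P := PV S S') (Q := QV S S') (by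
    rintro e ⟨i, h1, h2, h3, h4⟩ ⟨m, k1, k2, k3, k4⟩
    rcases lt_or_ge i m with hm | hm
    · exact h4 m hm (by omega) k2
    · exact k3 i hm (by omega) h2)
  have e4 := pc_add_of_disjoint (T := t) (P := fun e => S (e - 1) ∨ S' e)
    (Q := fun e => PV S S' e ∨ QV S S' e) (by
    rintro e (he | he) (⟨i, h1, h2, h3, h4⟩ | ⟨m, k1, k2, k3, k4⟩)
    · exact h3 _ (by omega) (by omega) he
    · exact k3 _ (by omega) (by omega) he
    · exact h4 _ (by omega) le_rfl he
    · exact k4 _ (by omega) le_rfl he)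
  have := pc_le t (fun i => (S (i - 1) ∨ S' i) ∨ PV S S' i ∨ QV S S' i)
  omega

/-- Counting for a path with an even number `2q` of vertices. -/
lemma pc_even_path {q : ℕ} (h : Per t S) (h' : Per t S') (ht : 1 ≤ t) (hq : 1 ≤ q)
    (hS : ∃ i, S i) (hS' : ∃ i, S' i)
    (h1 : ∀ k m, S k → S' m → k < m → m ≤ k + t → (q : ℤ) + 1 ≤ m - k)
    (h2 : ∀ k m, S k → S' m → m ≤ k → k < m + t → (q : ℤ) ≤ k - m) :
    pc t S + pc t S' + 2 * q ≤ t + 1 := by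
  obtain ⟨k0, hk0⟩ := hS
  obtain ⟨m0, hm0⟩ := hS'
  have v := voids_le (S' := S') h ht
  rw [pc_eq_zero (P := fun e => S (e - 1) ∧ S' e) (by
    rintro e ⟨a, b⟩; have := h1 _ _ a b (by omega) (by omega); omega)] at v
  have vP : (q : ℤ) - 1 ≤ pc t (PV S S') := by
    obtain ⟨m1, a1, a2, a3, -⟩ := h'.exists_window ht hm0 (k0 + 1)
    obtain ⟨i, m, b1, b2, b3, b4, b5, b6, b7⟩ := exists_gap hk0 a3 (by omega)
    have := h1 i m b4 b5 b2 (by omega)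
    have := block_le_pc (per_PV h h') ht (a := i + 2) (b := m) (z := k0 + 1) (by omega) (by omega)
      (by omega) (fun e e1 e2 => ⟨i, e1, b4, fun k _ _ => b6 k (by omega) (by omega),
        fun k _ _ => b7 k (by omega) (by omega)⟩)
    omega
  have vQ : (q : ℤ) ≤ pc t (QV S S') := by
    obtain ⟨k1, a1, a2, a3, -⟩ := h.exists_window ht hk0 m0
    obtain ⟨m, b1, b2, b3, b4⟩ := exists_last (v := k1 + 1) hm0 (by omega)
    obtain ⟨k, c1, c2, c3, c4⟩ := exists_first (u := m) a3 (by omega)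
    have := h2 k m c3 b3 c1 (by omega)
    have := block_le_pc (per_QV h h') ht (a := m + 1) (b := k + 1) (z := m0 + 1) (by omega)
      (by omega) (by omega) (fun e e1 e2 => ⟨m, by omega, b3, fun j _ _ => c4 j (by omega)
        (by omega), fun j _ _ => b4 j (by omega) (by omega)⟩)
    omega
  omega

/-- Counting for a path with an odd number `2p+1` of vertices. -/
lemma pc_odd_path {p : ℕ} (h : Per t S) (h' : Per t S') (ht : 1 ≤ t) (hp : 1 ≤ p) {u v : ℤ}
    (hu : S u) (hv : S' v) (huv : ¬ (t : ℤ) ∣ v - u)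
    (h1 : ∀ i j, S i → S' j → i < j → j < i + t → (p : ℤ) + 1 ≤ j - i)
    (h2 : ∀ i j, S' i → S j → i < j → j < i + t → (p : ℤ) + 1 ≤ j - i) :
    pc t S + pc t S' + 2 * p ≤ t + 2 := by
  obtain ⟨v, b1, b2, hv, b3⟩ := h'.exists_window ht hv u
  have hne : u ≠ v := by
    rintro rfl
    have := dvd_neg.2 b3
    simp at this
    rw [dvd_sub_comm] at this
    exact huv (by rw [dvd_sub_comm]; simpa using this)
  have ht1 : 1 < t := by omega
  set F : ℤ → Prop := fun e => ¬ S e ∧ ¬ S' (e - 1)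
  have pF : Per t F := by
    intro e
    have := h e
    have := h'.shift (-1) e
    simp only [F]
    simp only [← sub_eq_add_neg] at this
    tauto
  have e1 : pc t (fun e => S' (e - 1)) = pc t S' := by
    simpa [sub_eq_add_neg] using pc_shift h' ht (-1)
  have e2 := pc_add_of_disjoint (T := t) (P := fun e => S' (e - 1)) (Q := S) (by
    intro e a b
    have := h2 _ _ a b (by omega) (by omega)
    omega)
  have e3 := pc_add_of_disjoint (T := t) (P := fun e => S' (e - 1) ∨ S e) (Q := F) (by
    simp only [F]; tauto)
  have e4 := pc_le t (fun e => (S' (e - 1) ∨ S e) ∨ F e)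
  obtain ⟨i, j, a1, a2, a3, a4, a5, a6, a7⟩ := exists_gap hu hv (by omega)
  obtain ⟨i', j', d1, d2, d3, d4, d5, d6, d7⟩ := exists_gap hv ((h u).2 hu) (by omega)
  have g1 := h1 i j a4 a5 a2 (by omega)
  have g2 := h2 i' j' d4 d5 d2 (by omega)
  have := two_blocks_le_pc pF ht (a := i + 2) (b := j) (d := i' + 2) (e := j') (z := u)
    (by omega) (by omega) (by omega) (by omega) (by omega)
    (fun k k1 k2 => ⟨a6 k (by omega) k2, a7 (k - 1) (by omega) (by omega)⟩)
    (fun k k1 k2 => ⟨d7 k (by omega) k2, d6 (k - 1) (by omega) (by omega)⟩)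
  omega

end voids
end BipCyc

namespace BipCyc
open Finset
open scoped Classical

section
variable {t : ℕ} {A₀ A B₀ B : ℤ → Prop}

lemma Per.or {P Q : ℤ → Prop} (h : Per t P) (h' : Per t Q) : Per t (fun i => P i ∨ Q i) := by
  intro i; have := h i; have := h' i; tauto

/-- A pair of consecutive mixed gaps. -/
lemma exists_two_gaps (hA₀ : Per t A₀) (hA : Per t A) (ht : 1 ≤ t) {u v : ℤ}
    (hu : A₀ u) (hv : A v) (huv : ¬ (t : ℤ) ∣ v - u) :
    ∃ i j i' j' : ℤ, i < j ∧ j ≤ i' ∧ i' < j' ∧ j' ≤ i + t ∧ A₀ i ∧ A j ∧ A i' ∧ A₀ j' ∧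
      (∀ k : ℤ, i < k → k < j → ¬ A₀ k ∧ ¬ A k) ∧ ∀ k : ℤ, i' < k → k < j' → ¬ A₀ k ∧ ¬ A k := by
  obtain ⟨v, b1, b2, hv, b3⟩ := hA.exists_window ht hv u
  have hne : u ≠ v := by
    rintro rfl
    rw [dvd_sub_comm] at b3
    exact huv b3
  obtain ⟨i, j, a1, a2, a3, a4, a5, a6, a7⟩ := exists_gap hu hv (by omega)
  have hi : A₀ (i + t) := (hA₀ i).2 a4
  have key : ∃ i' j', v ≤ i' ∧ i' < j' ∧ j' ≤ i + t ∧ A i' ∧ A₀ j' ∧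
      ∀ k : ℤ, i' < k → k < j' → ¬ A₀ k ∧ ¬ A k := by
    obtain ⟨i', j', d1, d2, d3, d4, d5, d6, d7⟩ := exists_gap hv hi (by omega)
    exact ⟨i', j', d1, d2, d3, d4, d5, fun k k1 k2 => ⟨d7 k k1 k2, d6 k k1 k2⟩⟩
  obtain ⟨i', j', d1, d2, d3, d4, d5, d6⟩ := key
  exact ⟨i, j, i', j', a2, by omega, d2, d3, a4, a5, d4, d5,
    fun k k1 k2 => ⟨a6 k k1 k2, a7 k k1 k2⟩, d6⟩

lemma pc_le_one {P : ℤ → Prop} (h : ∀ i j, P i → P j → i < j → j < i + t → False) :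
    pc t P ≤ 1 := by
  unfold pc
  rw [Finset.card_le_one]
  intro a ha b hb
  simp only [Finset.mem_filter, Finset.mem_Ico] at ha hb
  rcases lt_trichotomy a b with hab | hab | hab
  · exact (h a b ha.2 hb.2 hab (by omega)).elim
  · exact hab
  · exact (h b a hb.2 ha.2 hab (by omega)).elim

lemma pc_QV_of_gaps {p' : ℕ} (hA₀ : Per t A₀) (hA : Per t A) (hB₀ : Per t B₀) (hB : Per t B)
    (ht : 1 ≤ t) {u v : ℤ}
    (hu : B₀ u) (hv : B v) (huv : ¬ (t : ℤ) ∣ v - u)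
    (hQ : ∀ i j : ℤ, i < j → j < i + t → (B₀ i ∧ B j ∨ B i ∧ B₀ j) → (p' : ℤ) + 1 ≤ j - i)
    (hx : ∀ b d e f : ℤ, b ≤ d → d < e → e ≤ f → f < b + t → (A₀ d ∨ A d) → (A₀ f ∨ A f) →
      (B₀ b ∧ B e ∨ B b ∧ B₀ e) → (p' : ℤ) + 1 ≤ (d - b) + (f - e)) :
    p' ≤ pc t (QV (fun i => A₀ i ∨ A i) (fun i => B₀ i ∨ B i)) := by
  obtain ⟨m, n, m', n', a1, a2, a3, a4, a5, a6, a7, a8, a9, a10⟩ :=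
    exists_two_gaps hB₀ hB ht hu hv huv
  have pq := per_QV (hA₀.or hA) (hB₀.or hB)
  by_cases e1 : ∃ k : ℤ, m ≤ k ∧ k < n ∧ (A₀ k ∨ A k)
  · by_cases e2 : ∃ k : ℤ, m' ≤ k ∧ k < n' ∧ (A₀ k ∨ A k)
    · obtain ⟨d, d1, d2, d3⟩ := e1
      obtain ⟨f, f1, f2, f3⟩ := e2
      obtain ⟨d, x1, x2, x3, x4⟩ := exists_first (P := fun k => A₀ k ∨ A k) d3 d1
      obtain ⟨f, y1, y2, y3, y4⟩ := exists_first (P := fun k => A₀ k ∨ A k) f3 f1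
      have g := hx m d m' f x1 (by omega) y1 (by omega) x3 y3 (Or.inl ⟨a5, a7⟩)
      have := two_blocks_le_pc pq ht (a := m + 1) (b := d + 1) (d := m' + 1) (e := f + 1)
        (z := m + 1)
        (by omega) (by omega) (by omega) (by omega) (by omega)
        (fun k k1 k2 => ⟨m, by omega, Or.inl a5, fun j j1 j2 => x4 j j1 (by omega),
          fun j j1 j2 => not_or.2 (a9 j j1 (by omega))⟩)
        (fun k k1 k2 => ⟨m', by omega, Or.inr a7, fun j j1 j2 => y4 j j1 (by omega),
          fun j j1 j2 => not_or.2 (a10 j j1 (by omega))⟩)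
      omega
    · push Not at e2
      have g := hQ m' n' a3 (by omega) (Or.inr ⟨a7, a8⟩)
      have := block_le_pc pq ht (a := m' + 1) (b := n') (z := m' + 1)
        (by omega) (by omega) (by omega)
        (fun k k1 k2 => ⟨m', by omega, Or.inr a7,
          fun j j1 j2 => not_or.2 (e2 j j1 (by omega)),
          fun j j1 j2 => not_or.2 (a10 j j1 (by omega))⟩)
      omega
  · push Not at e1
    have g := hQ m n a1 (by omega) (Or.inl ⟨a5, a6⟩)
    have := block_le_pc pq ht (a := m + 1) (b := n) (z := m + 1)
      (by omega) (by omega) (by omega)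
      (fun k k1 k2 => ⟨m, by omega, Or.inl a5,
        fun j j1 j2 => not_or.2 (e1 j j1 (by omega)),
        fun j j1 j2 => not_or.2 (a9 j j1 (by omega))⟩)
    omega

set_option maxHeartbeats 1000000 in
lemma pc_PV_of_gaps {p : ℕ} (hA₀ : Per t A₀) (hA : Per t A) (hB₀ : Per t B₀) (hB : Per t B)
    (ht : 1 ≤ t) {u v : ℤ}
    (hu : A₀ u) (hv : A v) (huv : ¬ (t : ℤ) ∣ v - u)
    (hP : ∀ i j : ℤ, i < j → j < i + t → (A₀ i ∧ A j ∨ A i ∧ A₀ j) → (p : ℤ) + 1 ≤ j - i)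
    (hx : ∀ a b d e : ℤ, a < b → b ≤ d → d < e → e ≤ a + t → (B₀ b ∨ B b) → (B₀ e ∨ B e) →
      (A₀ a ∧ A d ∨ A a ∧ A₀ d) → (p : ℤ) + 3 ≤ (b - a) + (e - d)) :
    p + pc t (fun e => (A₀ (e - 1) ∨ A (e - 1)) ∧ (B₀ e ∨ B e)) ≤
      pc t (PV (fun i => A₀ i ∨ A i) (fun i => B₀ i ∨ B i)) + 1 ∨
      2 ≤ pc t (fun e => (A₀ (e - 1) ∨ A (e - 1)) ∧ (B₀ e ∨ B e)) := by
  by_cases ho2 : 2 ≤ pc t (fun e => (A₀ (e - 1) ∨ A (e - 1)) ∧ (B₀ e ∨ B e))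
  · exact Or.inr ho2
  left
  obtain ⟨i, j, i', j', a1, a2, a3, a4, a5, a6, a7, a8, a9, a10⟩ :=
    exists_two_gaps hA₀ hA ht hu hv huv
  have pp := per_PV (hA₀.or hA) (hB₀.or hB)
  by_cases e1 : ∃ k : ℤ, i < k ∧ k ≤ j ∧ (B₀ k ∨ B k)
  · by_cases e2 : ∃ k : ℤ, i' < k ∧ k ≤ j' ∧ (B₀ k ∨ B k)
    · obtain ⟨w, d1, d2, d3⟩ := e1
      obtain ⟨z, f1, f2, f3⟩ := e2
      obtain ⟨w, x1, x2, x3, x4⟩ := exists_first (P := fun k => B₀ k ∨ B k) (u := i + 1) d3 d1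
      obtain ⟨z, y1, y2, y3, y4⟩ := exists_first (P := fun k => B₀ k ∨ B k) (u := i' + 1) f3 f1
      have g := hx i w i' z x1 (by omega) y1 (by omega) x3 y3 (Or.inl ⟨a5, a7⟩)
      have v1 : ∀ k : ℤ, i + 2 ≤ k → k < w →
          PV (fun i => A₀ i ∨ A i) (fun i => B₀ i ∨ B i) k :=
        fun k k1 k2 => ⟨i, by omega, Or.inl a5,
          fun q q1 q2 => not_or.2 (a9 q q1 (by omega)),
          fun q q1 q2 => x4 q q1 (by omega)⟩
      have v2 : ∀ k : ℤ, i' + 2 ≤ k → k < z →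
          PV (fun i => A₀ i ∨ A i) (fun i => B₀ i ∨ B i) k :=
        fun k k1 k2 => ⟨i', by omega, Or.inr a7,
          fun q q1 q2 => not_or.2 (a10 q q1 (by omega)),
          fun q q1 q2 => y4 q q1 (by omega)⟩
      rcases eq_or_lt_of_le x1 with hw | hw
      · have := block_le_pc pp ht (a := i' + 2) (b := z) (z := i' + 2)
          (by omega) (by omega) (by omega) v2
        omega
      rcases eq_or_lt_of_le y1 with hz | hz
      · have := block_le_pc pp ht (a := i + 2) (b := w) (z := i + 2)
          (by omega) (by omega) (by omega) v1
        omega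
      have b1 := two_blocks_le_pc pp ht (a := i + 2) (b := w) (d := i' + 2) (e := z) (z := i + 2)
        (by omega) (by omega) (by omega) (by omega) (by omega) v1 v2
      rcases Nat.eq_zero_or_pos (pc t (fun e => (A₀ (e - 1) ∨ A (e - 1)) ∧ (B₀ e ∨ B e)))
        with ho | ho
      · omega
      obtain ⟨l, hl, hl'⟩ := exists_of_pc_pos ho
      have perO : Per t (fun l => (A₀ l ∨ A l) ∧ (B₀ (l + 1) ∨ B (l + 1))) :=
        fun q => and_congr (or_congr (hA₀ q) (hA q)) (or_congr (hB₀.shift 1 q) (hB.shift 1 q))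
      have hl : (fun l => (A₀ l ∨ A l) ∧ (B₀ (l + 1) ∨ B (l + 1))) (l - 1) :=
        ⟨hl, by simpa using hl'⟩
      obtain ⟨l, l1, l2, ⟨l3, l4⟩, -⟩ := perO.exists_window ht hl i
      have hli : l ≠ i := by
        rintro rfl
        exact x4 _ le_rfl hw l4
      have hli' : l ≠ i' := by
        rintro rfl
        exact y4 _ le_rfl hz l4
      have hlj : j ≤ l := by
        by_contra hc
        exact not_or.2 (a9 l (by omega) (by omega)) l3
      rcases l3 with hlA | hlA
      · have : ∃ l : ℤ, j' ≤ l ∧ l < i' + t ∧ A₀ l ∧ (B₀ (l + 1) ∨ B (l + 1)) := by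
          by_cases hl2 : i' < l
          · refine ⟨l, ?_, by omega, hlA, l4⟩
            by_contra hc
            exact (a10 l (by omega) (by omega)).1 hlA
          · have := (perO l).2 ⟨Or.inl hlA, l4⟩
            exact ⟨l + t, by omega, by omega, (hA₀ l).2 hlA, this.2⟩
        obtain ⟨l, q1, q2, q3, q4⟩ := this
        have := hx i' z l (l + 1) y1 (by omega) (by omega) (by omega) y3 q4 (Or.inr ⟨a7, q3⟩)
        have := block_le_pc pp ht (a := i' + 2) (b := z) (z := i' + 2)
          (by omega) (by omega) (by omega) v2
        omega
      · have := hx i w l (l + 1) x1 (by omega) (by omega) (by omega) x3 l4 (Or.inl ⟨a5, hlA⟩)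
        have := block_le_pc pp ht (a := i + 2) (b := w) (z := i + 2)
          (by omega) (by omega) (by omega) v1
        omega
    · push Not at e2
      have g := hP i' j' a3 (by omega) (Or.inr ⟨a7, a8⟩)
      have := block_le_pc pp ht (a := i' + 2) (b := j' + 1) (z := i' + 2)
        (by omega) (by omega) (by omega)
        (fun k k1 k2 => ⟨i', by omega, Or.inr a7,
          fun q q1 q2 => not_or.2 (a10 q q1 (by omega)),
          fun q q1 q2 => not_or.2 (e2 q q1 (by omega))⟩)
      omega
  · push Not at e1
    have g := hP i j a1 (by omega) (Or.inl ⟨a5, a6⟩)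
    have := block_le_pc pp ht (a := i + 2) (b := j + 1) (z := i + 2)
      (by omega) (by omega) (by omega)
      (fun k k1 k2 => ⟨i, by omega, Or.inl a5,
        fun q q1 q2 => not_or.2 (a9 q q1 (by omega)),
        fun q q1 q2 => not_or.2 (e1 q q1 (by omega))⟩)
    omega

/-- Counting for two disjoint paths with odd numbers `2p+1`, `2p'+1` of vertices whose ends have
different colours. -/
lemma pc_two_odd_paths {p p' : ℕ} (hA₀ : Per t A₀) (hA : Per t A) (hB₀ : Per t B₀)
    (hB : Per t B) (ht : 1 ≤ t) {u v u' v' : ℤ}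
    (hu : A₀ u) (hv : A v) (huv : ¬ (t : ℤ) ∣ v - u)
    (hu' : B₀ u') (hv' : B v') (huv' : ¬ (t : ℤ) ∣ v' - u')
    (hP : ∀ i j : ℤ, i < j → j < i + t → (A₀ i ∧ A j ∨ A i ∧ A₀ j) → (p : ℤ) + 1 ≤ j - i)
    (hQ : ∀ i j : ℤ, i < j → j < i + t → (B₀ i ∧ B j ∨ B i ∧ B₀ j) → (p' : ℤ) + 1 ≤ j - i)
    (h1 : ∀ a b d e : ℤ, a < b → b ≤ d → d < e → e ≤ a + t → (B₀ b ∨ B b) → (B₀ e ∨ B e) →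
      (A₀ a ∨ A a) → (A₀ d ∨ A d) → (3 : ℤ) ≤ (b - a) + (e - d))
    (h2 : ∀ a b d e : ℤ, a < b → b ≤ d → d < e → e ≤ a + t → (B₀ b ∨ B b) → (B₀ e ∨ B e) →
      (A₀ a ∧ A d ∨ A a ∧ A₀ d) → (p : ℤ) + 3 ≤ (b - a) + (e - d))
    (h3 : ∀ b d e f : ℤ, b ≤ d → d < e → e ≤ f → f < b + t → (A₀ d ∨ A d) → (A₀ f ∨ A f) →
      (B₀ b ∧ B e ∨ B b ∧ B₀ e) → (p' : ℤ) + 1 ≤ (d - b) + (f - e)) :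
    pc t (fun i => A₀ i ∨ A i) + pc t (fun i => B₀ i ∨ B i) + p + p' ≤ t + 1 := by
  have a1 := pc_QV_of_gaps hA₀ hA hB₀ hB ht hu' hv' huv' hQ h3
  have a2 := pc_PV_of_gaps hA₀ hA hB₀ hB ht hu hv huv hP h2
  have a3 := voids_le (S := fun i => A₀ i ∨ A i) (S' := fun i => B₀ i ∨ B i) (hA₀.or hA) ht
  have a4 : pc t (fun e => (A₀ (e - 1) ∨ A (e - 1)) ∧ (B₀ e ∨ B e)) ≤ 1 := by
    apply pc_le_one
    rintro i j ⟨x1, x2⟩ ⟨y1, y2⟩ hij hji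
    have := h1 (i - 1) i (j - 1) j (by omega) (by omega) (by omega) (by omega) x2 y2 x1 y1
    omega
  omega

end
end BipCyc

namespace BipCyc
open Finset
open scoped Classical

variable {V : Type*} {G : SimpleGraph V} {col : V → Bool} {c : ℤ → V} {t : ℕ}

/-- The number of neighbours of `v` on the cycle. -/
noncomputable def nC (G : SimpleGraph V) (c : ℤ → V) (t : ℕ) (v : V) : ℕ :=
  pc (2 * t) (fun i => G.Adj v (c i))

/-- The number of neighbours of `v` in `H`. -/
noncomputable def dH (G : SimpleGraph V) (H : Finset V) (v : V) : ℕ := #{w ∈ H | G.Adj v w}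

lemma BipCycle.per (h : BipCycle G col c t) (v : V) : Per (2 * t) (fun i => G.Adj v (c i)) := by
  intro i
  have := h.periodic i
  push_cast
  rw [this]

lemma BipCycle.even_sub (h : BipCycle G col c t) {v : V} {i j : ℤ} (hi : G.Adj v (c i))
    (hj : G.Adj v (c j)) : Even (i - j) := by
  have h1 := h.parity hi
  have h2 := h.parity hj
  rw [Int.even_sub]
  tauto

lemma BipCycle.nC_swap (h : BipCycle G col c t) (v : V) : nC G (fun i => c (i + 1)) t v = nC G c t v :=
  pc_shift (h.per v) (by have := h.two_le; omega) 1

lemma nC_eq_zero_iff (h : BipCycle G col c t) {v : V} : nC G c t v = 0 ↔ ∀ i, ¬ G.Adj v (c i) := by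
  constructor
  · intro h0 i hi
    have := pc_pos (h.per v) (by have := h.two_le; omega) hi
    unfold nC at h0
    omega
  · exact fun h => pc_eq_zero h

lemma nC_ne_zero (h : BipCycle G col c t) {v : V} : nC G c t v ≠ 0 ↔ ∃ i, G.Adj v (c i) := by
  rw [Ne, nC_eq_zero_iff h]; simp

lemma BipCycle.nC_le (h : BipCycle G col c t) (v : V) : nC G c t v ≤ t := by
  have := two_card_le (S := {i ∈ Finset.Ico (0 : ℤ) (2 * t : ℕ) | G.Adj v (c i)})
    (α := 0) (β := 2 * t - 1) (by simp +contextual) (by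
      intro x hx
      simp only [Finset.mem_filter, Finset.mem_Ico] at hx
      push_cast at hx
      omega) (by
      intro x hx y hy
      simp only [Finset.mem_filter] at hx hy
      exact h.even_sub hx.2 hy.2) (by omega)
  have e : nC G c t v = #{i ∈ Finset.Ico (0 : ℤ) (2 * t : ℕ) | G.Adj v (c i)} := rfl
  omega

lemma BipCycle.nC_le_one (_h : BipCycle G col c t) {v : V} {τ : ℤ}
    (hτ : ∀ i, G.Adj v (c i) → (2 * t : ℤ) ∣ i - τ) : nC G c t v ≤ 1 := by
  apply pc_le_one
  intro i j hi hj hij hji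
  have := dvd_sub (hτ j hj) (hτ i hi)
  have := Int.eq_zero_of_abs_lt_dvd this (by rw [abs_lt]; push_cast at hji; constructor <;> linarith)
  omega

/-- Bounding the cycle degree of the first vertex of a path whose last vertex sees `c τ`. -/
lemma BipCycle.nC_add_length_le (h : BipCycle G col c t) {E : List V} {y v : V}
    (hE : Pth G E y v) (ho : Out c E) {τ i : ℤ} (hv : G.Adj v (c τ)) (hy : G.Adj y (c i))
    (hne : ¬ (2 * t : ℤ) ∣ i - τ) : nC G c t y + E.length ≤ t + 1 := by
  have := pc_far (n := E.length + 1) (h.per y) (fun i j => h.even_sub) hy hne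
    (by have := h.two_le; omega) (by
      intro j h1 h2 hj
      constructor
      · have := h.ear (i := τ) (j := j) hE.reverse (by intro w hw; exact ho w (by simpa using hw))
          hv hj h1 h2
        simpa using this
      · have := h.ear (i := j) (j := τ + 2 * t) hE ho hj (by rwa [h.periodic]) (by omega) (by omega)
        simpa using this)
  unfold nC
  omega

lemma BipCycle.length_le_of_loop (h : BipCycle G col c t) {E : List V} {y v : V}
    (hE : Pth G E y v) (ho : Out c E) {τ : ℤ} (hv : G.Adj v (c τ)) (hy : G.Adj y (c τ))
    (hl : 2 ≤ E.length) : E.length + 1 ≤ 2 * t := by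
  have := h.long (hE.cons hy.symm (fun hc => ho _ hc τ rfl)) (by simp; omega) hv
  simpa using this

lemma BipCycle.col_getElem (h : BipCycle G col c t) {l : List V} (hl : l.IsChain G.Adj) {k : ℕ}
    (hk : k < l.length) : (col l[k] = col (l[0]'(by omega)) ↔ Even k) := by
  induction k with
  | zero => simp
  | succ k ih =>
    have h1 := ih (by omega)
    have h2 := h.proper (List.isChain_iff_getElem.1 hl k hk)
    rw [Nat.even_add_one, ← h1]
    generalize col l[k] = a at *
    generalize col l[k+1] = b at *
    generalize col (l[0]'(by omega)) = d at *
    cases a <;> cases b <;> cases d <;> simp_all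

/-- The farthest neighbour of the first vertex of a path that contains all its neighbours. -/
lemma BipCycle.exists_farthest (h : BipCycle G col c t) {H : Finset V} {E : List V} {x v : V}
    (hE : Pth G E x v) (hx : ∀ w ∈ H, G.Adj x w → w ∈ E) (h0 : dH G H x ≠ 0) :
    ∃ l₁ w l₂, E = l₁ ++ w :: l₂ ∧ G.Adj x w ∧ 2 * dH G H x ≤ l₁.length + 1 ∧ w ∈ H ∧
      (∀ w' ∈ H, G.Adj x w' → w' ∈ l₁ ++ [w]) := by
  have hne : ({w ∈ H | G.Adj x w}).Nonempty := Finset.card_ne_zero.1 h0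
  obtain ⟨w, hw, hmax⟩ := Finset.exists_max_image _ (fun w => E.idxOf w) hne
  rw [Finset.mem_filter] at hw
  have hwE := hx w hw.1 hw.2
  have hlt := List.idxOf_lt_length_of_mem hwE
  have e0 : E[0]'(by omega) = x := by
    have := hE.2.2.1
    rw [List.head?_eq_getElem?, List.getElem?_eq_getElem (by omega)] at this
    simpa using this
  have hodd : ∀ w' ∈ H, G.Adj x w' → ¬ Even (E.idxOf w') := by
    intro w' hw' ha
    have hl := List.idxOf_lt_length_of_mem (hx w' hw' ha)
    have := h.col_getElem hE.1 hl
    rw [List.getElem_idxOf, e0] at this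
    rw [← this]
    exact (h.proper ha).symm
  refine ⟨E.take (E.idxOf w), w, E.drop (E.idxOf w + 1), ?_, hw.2, ?_, hw.1, ?_⟩
  · conv_lhs => rw [← List.take_append_drop (E.idxOf w) E]
    rw [List.drop_eq_getElem_cons hlt, List.getElem_idxOf]
  · have := two_card_le (S := ({w ∈ H | G.Adj x w}).image (fun w => (E.idxOf w : ℤ)))
      (α := 1) (β := E.idxOf w) ?_ ?_ ?_ (by omega)
    · rw [Finset.card_image_of_injOn] at this
      · unfold dH
        simp
        omega
      · intro a ha b hb hab
        simp at ha hb hab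
        exact (List.idxOf_inj (hx a ha.1 ha.2)).1 hab
    · intro z hz
      simp only [Finset.mem_image, Finset.mem_filter] at hz
      obtain ⟨a, ha, rfl⟩ := hz
      have := hodd a ha.1 ha.2
      by_contra hc
      have : E.idxOf a = 0 := by omega
      simp_all
    · intro z hz
      simp only [Finset.mem_image] at hz
      obtain ⟨a, ha, rfl⟩ := hz
      have := hmax a ha
      omega
    · intro y hy z hz
      simp only [Finset.mem_image, Finset.mem_filter] at hy hz
      obtain ⟨a, ha, rfl⟩ := hy
      obtain ⟨b, hb, rfl⟩ := hz
      have h1 := hodd a ha.1 ha.2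
      have h2 := hodd b hb.1 hb.2
      rw [Int.even_sub, Int.even_coe_nat, Int.even_coe_nat]
      tauto
  · intro w' hw' ha
    have hE' := hx w' hw' ha
    have h1 := hmax w' (by simp [hw', ha])
    have hl := List.idxOf_lt_length_of_mem hE'
    rcases h1.eq_or_lt with h2 | h2
    · have := (List.idxOf_inj hE').1 h2
      simp [this]
    · rw [List.mem_append]
      left
      rw [List.mem_take_iff_getElem]
      exact ⟨E.idxOf w', by omega, List.getElem_idxOf hl⟩

lemma BipCycle.two_dH_le (h : BipCycle G col c t) {H : Finset V} {E : List V} {x v : V}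
    (hE : Pth G E x v) (hx : ∀ w ∈ H, G.Adj x w → w ∈ E) : 2 * dH G H x ≤ E.length := by
  by_cases h0 : dH G H x = 0
  · omega
  obtain ⟨l₁, w, l₂, rfl, -, h2, -⟩ := h.exists_farthest hE hx h0
  simp; omega

lemma BipCycle.dH_le (h : BipCycle G col c t) {H : Finset V} {E : List V} {x v : V}
    (hE : Pth G E x v) (hx : ∀ w ∈ H, G.Adj x w → w ∈ E) : dH G H x ≤ t := by
  by_cases h0 : dH G H x = 0
  · omega
  have ht := h.two_le
  obtain ⟨l₁, w, l₂, rfl, h1, h2, -⟩ := h.exists_farthest hE hx h0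
  by_cases h3 : l₁.length ≤ 1
  · omega
  have := h.long hE.split.1 (by simp; omega) h1.symm
  simp at this
  omega

/-- A path with a closed end both of whose ends see the cycle. -/
lemma BipCycle.degree_le (h : BipCycle G col c t) {H : Finset V} {E : List V} {x v : V}
    (hE : Pth G E x v) (ho : Out c E) (hx : ∀ w ∈ H, G.Adj x w → w ∈ E)
    (hx0 : nC G c t x ≠ 0) (hv0 : nC G c t v ≠ 0) : dH G H x + nC G c t x ≤ t := by
  have ht := h.two_le
  have hb := h.two_dH_le hE hx
  have hn := h.nC_le x
  rw [nC_ne_zero h] at hv0 hx0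
  obtain ⟨τ, hτ⟩ := hv0
  by_cases hd : dH G H x = 0
  · omega
  by_cases hc : ∃ i, G.Adj x (c i) ∧ ¬ (2 * t : ℤ) ∣ i - τ
  · obtain ⟨i, hi, hiτ⟩ := hc
    have := h.nC_add_length_le hE ho hτ hi hiτ
    omega
  · push Not at hc
    have h1 := h.nC_le_one hc
    obtain ⟨i, hi⟩ := hx0
    have e : c i = c τ := by
      rw [h.inj, dvd_sub_comm]; exact hc i hi
    have := h.length_le_of_loop hE ho hτ (by rwa [← e]) (by omega)
    omega

end BipCyc

namespace BipCyc
open Finset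
open scoped Classical

variable {V : Type*} {G : SimpleGraph V} {col : V → Bool} {c : ℤ → V} {t : ℕ}

lemma pc_two_mul {P : ℤ → Prop} (hP : ∀ i, P i → Even i) :
    pc (2 * t) P = pc t (fun k => P (2 * k)) := by
  unfold pc
  symm
  apply Finset.card_nbij (fun k => 2 * k)
  · intro k hk
    simp only [Finset.mem_coe, Finset.mem_filter, Finset.mem_Ico] at hk ⊢
    push_cast
    exact ⟨by omega, hk.2⟩
  · intro a _ b _ hab
    simpa using hab
  · intro i hi
    simp only [Finset.mem_coe, Finset.mem_filter, Finset.mem_Ico] at hi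
    obtain ⟨k, rfl⟩ := hP i hi.2
    refine ⟨k, ?_, by simp; ring⟩
    simp only [Finset.mem_coe, Finset.mem_filter, Finset.mem_Ico]
    push_cast at hi
    exact ⟨by omega, by rw [two_mul]; exact hi.2⟩

lemma BipCycle.nC_eq_index (h : BipCycle G col c t) {v : V} {ε : ℤ}
    (hε : ∀ i, G.Adj v (c i) → Even (i - ε)) :
    nC G c t v = pc t (fun k => G.Adj v (c (2 * k + ε))) := by
  have := pc_shift (h.per v) (by have := h.two_le; omega) ε
  rw [nC, ← this, pc_two_mul]
  intro i hi
  simpa using hε _ hi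

lemma BipCycle.per_index (h : BipCycle G col c t) (v : V) (ε : ℤ) :
    Per t (fun k => G.Adj v (c (2 * k + ε))) := by
  intro k
  have := h.periodic (2 * k + ε)
  simp only
  rw [show 2 * (k + (t : ℤ)) + ε = 2 * k + ε + 2 * t by ring, this]

lemma BipCycle.odd_of_true (h : BipCycle G col c t) {v : V} (hv : col v = true) {i : ℤ}
    (hi : G.Adj v (c i)) : Even (i - 1) := by
  have := (h.parity hi).1 hv
  rw [Int.even_sub]; simp [this]

lemma BipCycle.even_of_false (h : BipCycle G col c t) {v : V} (hv : col v = false) {i : ℤ}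
    (hi : G.Adj v (c i)) : Even (i - 0) := by
  have := (h.parity hi)
  simp [hv] at this
  simpa using this

lemma exists_index {v : V} {ε : ℤ} (hε : ∀ i, G.Adj v (c i) → Even (i - ε)) {i : ℤ}
    (hi : G.Adj v (c i)) : ∃ k, i = 2 * k + ε ∧ G.Adj v (c (2 * k + ε)) := by
  obtain ⟨k, hk⟩ := hε i hi
  have : i = 2 * k + ε := by omega
  exact ⟨k, this, this ▸ hi⟩

lemma Out.reverse {E : List V} (h : Out c E) : Out c E.reverse :=
  fun v hv => h v (by simpa using hv)

lemma Out.mono {E F : List V} (h : Out c E) (hFE : ∀ v ∈ F, v ∈ E) : Out c F :=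
  fun v hv => h v (hFE v hv)

lemma BipCycle.even_path_le (h : BipCycle G col c t) {E : List V} {x y : V} (hE : Pth G E x y)
    (ho : Out c E) (hx : col x = true) (hy : col y = false) {q : ℕ} (hq : 1 ≤ q)
    (hl : E.length = 2 * q) (hx0 : nC G c t x ≠ 0) (hy0 : nC G c t y ≠ 0) :
    nC G c t x + nC G c t y + 2 * q ≤ t + 1 := by
  rw [nC_ne_zero h] at hx0 hy0
  obtain ⟨i, hi⟩ := hx0
  obtain ⟨j, hj⟩ := hy0
  obtain ⟨i, -, hi⟩ := exists_index (fun i => h.odd_of_true hx) hi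
  obtain ⟨j, -, hj⟩ := exists_index (fun i => h.even_of_false hy) hj
  rw [h.nC_eq_index (fun i => h.odd_of_true hx), h.nC_eq_index (fun i => h.even_of_false hy)]
  apply pc_even_path (h.per_index x 1) (h.per_index y 0) (by have := h.two_le; omega) hq
    ⟨i, hi⟩ ⟨j, hj⟩
  · intro k m hk hm h1 h2
    have := h.ear hE ho hk hm (by omega) (by omega)
    omega
  · intro k m hk hm h1 h2
    have := h.ear hE.reverse ho.reverse hm hk (by omega) (by omega)
    simp at this
    omega

lemma BipCycle.odd_path_le (h : BipCycle G col c t) {E : List V} {x x' : V} (hE : Pth G E x x')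
    (ho : Out c E) {p : ℕ} (hp : 1 ≤ p) (hl : E.length = 2 * p + 1) (hc : col x = col x') {u v : ℤ}
    (hu : G.Adj x (c u)) (hv : G.Adj x' (c v)) (huv : ¬ (2 * t : ℤ) ∣ v - u) :
    nC G c t x + nC G c t x' + 2 * p ≤ t + 2 := by
  obtain ⟨ε, h1, h2⟩ : ∃ ε : ℤ, (∀ i, G.Adj x (c i) → Even (i - ε)) ∧
      ∀ i, G.Adj x' (c i) → Even (i - ε) := by
    cases hx : col x
    · exact ⟨0, fun i => h.even_of_false hx, fun i => h.even_of_false (by rw [← hc, hx])⟩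
    · exact ⟨1, fun i => h.odd_of_true hx, fun i => h.odd_of_true (by rw [← hc, hx])⟩
  obtain ⟨u, rfl, hu⟩ := exists_index h1 hu
  obtain ⟨v, rfl, hv⟩ := exists_index h2 hv
  rw [h.nC_eq_index h1, h.nC_eq_index h2]
  apply pc_odd_path (h.per_index x ε) (h.per_index x' ε) (by have := h.two_le; omega) hp hu hv
  · rintro ⟨k, hk⟩
    exact huv ⟨k, by linarith⟩
  · intro i j hi hj hij hji
    have := h.ear hE ho hi hj (by omega) (by omega)
    omega
  · intro i j hi hj hij hji
    have := h.ear hE.reverse ho.reverse hi hj (by omega) (by omega)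
    simp at this
    omega

lemma exists_ear {L : List V} {x x' : V} (hL : Pth G L x x') {i j : ℤ}
    (hi : G.Adj x (c i) ∨ G.Adj x' (c i)) (hj : G.Adj x (c j) ∨ G.Adj x' (c j)) :
    ∃ E a b, Pth G E a b ∧ (∀ v ∈ E, v ∈ L) ∧ G.Adj a (c i) ∧ G.Adj b (c j) := by
  rcases hi with hi | hi <;> rcases hj with hj | hj
  · exact ⟨[x], x, x, .singleton x, by simp [hL.head_mem], hi, hj⟩
  · exact ⟨L, x, x', hL, fun _ h => h, hi, hj⟩
  · exact ⟨L.reverse, x', x, hL.reverse, by simp, hi, hj⟩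
  · exact ⟨[x'], x', x', .singleton x', by simp [hL.last_mem], hi, hj⟩

lemma exists_long_ear {L : List V} {x x' : V} (hL : Pth G L x x') {i j : ℤ}
    (hij : G.Adj x (c i) ∧ G.Adj x' (c j) ∨ G.Adj x' (c i) ∧ G.Adj x (c j)) :
    ∃ E a b, Pth G E a b ∧ (∀ v ∈ E, v ∈ L) ∧ G.Adj a (c i) ∧ G.Adj b (c j) ∧
      E.length = L.length := by
  rcases hij with ⟨hi, hj⟩ | ⟨hi, hj⟩
  · exact ⟨L, x, x', hL, fun _ h => h, hi, hj, rfl⟩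
  · exact ⟨L.reverse, x', x, hL.reverse, by simp, hi, hj, by simp⟩

lemma BipCycle.two_odd_paths_le (h : BipCycle G col c t) {P Q : List V} {x x' y y' : V}
    (hP : Pth G P x x') (hQ : Pth G Q y y') (hoP : Out c P) (hoQ : Out c Q)
    (hPQ : ∀ v ∈ P, v ∉ Q) {p p' : ℕ} (hp : P.length = 2 * p + 1) (hp' : Q.length = 2 * p' + 1)
    (hx : col x = true) (hx' : col x' = true) (hy : col y = false) (hy' : col y' = false)
    {u v u' v' : ℤ}
    (hu : G.Adj x (c u)) (hv : G.Adj x' (c v)) (huv : ¬ (2 * t : ℤ) ∣ v - u)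
    (hu' : G.Adj y (c u')) (hv' : G.Adj y' (c v')) (huv' : ¬ (2 * t : ℤ) ∣ v' - u') :
    nC G c t x + nC G c t y + p + p' ≤ t + 1 := by
  obtain ⟨u, rfl, hu⟩ := exists_index (fun i => h.odd_of_true hx) hu
  obtain ⟨v, rfl, hv⟩ := exists_index (fun i => h.odd_of_true hx') hv
  obtain ⟨u', rfl, hu'⟩ := exists_index (fun i => h.even_of_false hy) hu'
  obtain ⟨v', rfl, hv'⟩ := exists_index (fun i => h.even_of_false hy') hv'
  have key := pc_two_odd_paths (p := p) (p' := p') (h.per_index x 1) (h.per_index x' 1)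
    (h.per_index y 0) (h.per_index y' 0) (by have := h.two_le; omega) hu hv
    (by rintro ⟨k, hk⟩; exact huv ⟨k, by linarith⟩) hu' hv'
    (by rintro ⟨k, hk⟩; exact huv' ⟨k, by linarith⟩) ?_ ?_ ?_ ?_ ?_
  · rw [h.nC_eq_index (fun i => h.odd_of_true hx), h.nC_eq_index (fun i => h.even_of_false hy)]
    have := pc_mono (T := t) (P := fun k => G.Adj x (c (2 * k + 1)))
      (Q := fun k => G.Adj x (c (2 * k + 1)) ∨ G.Adj x' (c (2 * k + 1))) (fun _ => Or.inl)
    have := pc_mono (T := t) (P := fun k => G.Adj y (c (2 * k + 0)))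
      (Q := fun k => G.Adj y (c (2 * k + 0)) ∨ G.Adj y' (c (2 * k + 0))) (fun _ => Or.inl)
    omega
  · intro i j hij hji hm
    obtain ⟨E, a, b, e1, e2, e3, e4, e5⟩ := exists_long_ear hP hm
    have := h.ear e1 (hoP.mono e2) e3 e4 (by omega) (by omega)
    omega
  · intro i j hij hji hm
    obtain ⟨E, a, b, e1, e2, e3, e4, e5⟩ := exists_long_ear hQ hm
    have := h.ear e1 (hoQ.mono e2) e3 e4 (by omega) (by omega)
    omega
  · intro a b d e h1 h2 h3 h4 hb he ha hd
    obtain ⟨E, a1, b1, e1, e2, e3, e4⟩ := exists_ear hP ha hd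
    obtain ⟨F, a2, b2, f1, f2, f3, f4⟩ := exists_ear hQ hb he
    have := h.double e1 f1 (hoP.mono e2) (hoQ.mono f2)
      (fun v hv hv' => hPQ v (e2 v hv) (f2 v hv')) e3 e4 f3 f4 (by omega) (by omega) (by omega)
      (by omega)
    have := e1.length_pos
    have := f1.length_pos
    omega
  · intro a b d e h1 h2 h3 h4 hb he had
    obtain ⟨E, a1, b1, e1, e2, e3, e4, e5⟩ := exists_long_ear hP had
    obtain ⟨F, a2, b2, f1, f2, f3, f4⟩ := exists_ear hQ hb he
    have := h.double e1 f1 (hoP.mono e2) (hoQ.mono f2)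
      (fun v hv hv' => hPQ v (e2 v hv) (f2 v hv')) e3 e4 f3 f4 (by omega) (by omega) (by omega)
      (by omega)
    have := f1.length_pos
    omega
  · intro b d e f h1 h2 h3 h4 hd hf hbe
    obtain ⟨E, a1, b1, e1, e2, e3, e4⟩ := exists_ear hP hd hf
    obtain ⟨F, a2, b2, f1, f2, f3, f4, f5⟩ := exists_long_ear hQ hbe
    have := h.double f1 e1 (hoQ.mono f2) (hoP.mono e2)
      (fun v hv hv' => hPQ v (e2 v hv') (f2 v hv)) f3 f4 e3 e4 (by omega) (by omega) (by omega)
      (by omega)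
    have := e1.length_pos
    omega

/-- An ear and a vertex off the ear. -/
lemma BipCycle.ear_vertex_le (h : BipCycle G col c t) {E : List V} {a b z : V} (hE : Pth G E a b)
    (ho : Out c E) (hz : z ∉ E) (hzo : ∀ i, z ≠ c i) {u v : ℤ}
    (hu : G.Adj a (c u)) (hv : G.Adj b (c v)) (huv : ¬ (2 * t : ℤ) ∣ v - u) :
    2 * nC G c t z + E.length ≤ 2 * t + 1 := by
  obtain ⟨v, b1, b2, hv, b3⟩ := (h.per b).exists_window (by have := h.two_le; omega) hv u
  have hne : u ≠ v := by
    rintro rfl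
    push_cast at b3
    exact huv (by rwa [dvd_sub_comm])
  push_cast at b2
  have h1 := h.ear hE ho hu hv (by omega) (by omega)
  have h2 := h.ear hE.reverse ho.reverse hv (j := u + 2 * t) (by rwa [h.periodic]) (by omega)
    (by omega)
  simp at h2
  have := pc_ear (n := E.length + 1) (h.per z) (fun i j => h.even_sub) (by have := h.two_le; omega)
    (u := u) (v := v) (by omega) (by omega) (by omega) (by omega) (by
      intro w x hw hx h3 h4 h5 h6
      have := h.double hE (Pth.singleton z) ho (by intro v hv; simp at hv; subst hv; exact hzo)
        (by intro v hv hv'; simp at hv'; subst hv'; exact hz hv) hu hv hw hx h3 h4 h5 h6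
      simp at this
      omega)
  unfold nC
  omega

end BipCyc

namespace BipCyc
open Finset
open scoped Classical

variable {V : Type*} [Fintype V] {G : SimpleGraph V} {col : V → Bool} {c : ℤ → V} {t : ℕ}
  {H W : Finset V}

/-- The edges, listed as ordered pairs, inside `H ∪ C` with at least one end in `H`. -/
noncomputable def Ep (G : SimpleGraph V) (col : V → Bool) (c : ℤ → V) (H : Finset V) :
    Finset (V × V) :=
  {p | col p.1 = true ∧ G.Adj p.1 p.2 ∧ (p.1 ∈ H ∨ ∃ i, p.1 = c i) ∧ (p.2 ∈ H ∨ ∃ i, p.2 = c i) ∧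
    (p.1 ∈ H ∨ p.2 ∈ H)}

lemma mem_Ep {p : V × V} : p ∈ Ep G col c H ↔ col p.1 = true ∧ G.Adj p.1 p.2 ∧
    (p.1 ∈ H ∨ ∃ i, p.1 = c i) ∧ (p.2 ∈ H ∨ ∃ i, p.2 = c i) ∧ (p.1 ∈ H ∨ p.2 ∈ H) := by
  simp [Ep]

/-- Those edges that meet `W`. -/
noncomputable def Touch (G : SimpleGraph V) (col : V → Bool) (c : ℤ → V) (H W : Finset V) :
    Finset (V × V) := {p ∈ Ep G col c H | p.1 ∈ W ∨ p.2 ∈ W}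

lemma card_Ep_le (H W : Finset V) :
    #(Ep G col c H) ≤ #(Ep G col c (H \ W)) + #(Touch G col c H W) := by
  rw [← Finset.card_filter_add_card_filter_not (s := Ep G col c H) (fun p => p.1 ∈ W ∨ p.2 ∈ W),
    add_comm]
  refine Nat.add_le_add_right (Finset.card_le_card ?_) _
  intro p hp
  rw [Finset.mem_filter, mem_Ep] at hp
  rw [mem_Ep]
  simp only [Finset.mem_sdiff]
  tauto

/-- Total degree of `v` into `H` and the cycle. -/
noncomputable def dg (G : SimpleGraph V) (c : ℤ → V) (t : ℕ) (H : Finset V) (v : V) : ℕ :=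
  dH G H v + nC G c t v

lemma card_nbr_cycle_le (h : BipCycle G col c t) (v : V) :
    #({w | G.Adj v w ∧ ∃ i, w = c i} : Finset V) ≤ nC G c t v := by
  refine (Finset.card_le_card (t := ({i ∈ Finset.Ico (0 : ℤ) (2 * t : ℕ) | G.Adj v (c i)}).image c)
    ?_).trans Finset.card_image_le
  intro w hw
  simp only [Finset.mem_filter, Finset.mem_univ, true_and] at hw
  obtain ⟨hw, i, rfl⟩ := hw
  obtain ⟨j, h1, h2, h3, h4⟩ := (h.per v).exists_window (by have := h.two_le; omega) hw 0
  refine Finset.mem_image.2 ⟨j, ?_, ?_⟩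
  · simp only [Finset.mem_filter, Finset.mem_Ico]
    exact ⟨by omega, h3⟩
  · rw [h.inj]
    push_cast at h4
    rwa [dvd_sub_comm]

lemma card_Touch_singleton_le (h : BipCycle G col c t) (v : V) :
    #(Touch G col c H {v}) ≤ dg G c t H v := by
  have h1 : #({w | G.Adj v w ∧ (w ∈ H ∨ ∃ i, w = c i)} : Finset V) ≤ dg G c t H v := by
    refine (Finset.card_le_card (t := {w ∈ H | G.Adj v w} ∪ ({w | G.Adj v w ∧ ∃ i, w = c i} : Finset V))
      ?_).trans ((Finset.card_union_le _ _).trans (Nat.add_le_add_left (card_nbr_cycle_le h v) _))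
    intro w hw
    simp only [Finset.mem_union, Finset.mem_filter, Finset.mem_univ, true_and] at hw ⊢
    tauto
  refine le_trans (Finset.card_le_card (t := Finset.image
    (fun w => if col v = true then (v, w) else (w, v))
    ({w | G.Adj v w ∧ (w ∈ H ∨ ∃ i, w = c i)} : Finset V)) ?_) (Finset.card_image_le.trans h1)
  rintro ⟨x, y⟩ hp
  rw [Touch, Finset.mem_filter, mem_Ep] at hp
  obtain ⟨⟨hx, h2, h3, h4, h5⟩, h6⟩ := hp
  simp only [Finset.mem_singleton] at hx h2 h3 h4 h6
  have hne := h.proper h2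
  simp only [Finset.mem_image, Finset.mem_filter, Finset.mem_univ, true_and]
  rcases h6 with rfl | rfl
  · exact ⟨y, ⟨h2, h4⟩, by simp [hx]⟩
  · refine ⟨x, ⟨h2.symm, h3⟩, ?_⟩
    rw [hx] at hne
    simp [hne.symm]

lemma card_Touch_pair_le (h : BipCycle G col c t) {x y : V} (hx : col x = true) (hxH : x ∈ H)
    (hyH : y ∈ H) :
    #(Touch G col c H {x, y}) + (if G.Adj x y then 1 else 0) ≤ dg G c t H x + dg G c t H y := by
  have h1 := card_Touch_singleton_le (H := H) h x
  have h2 := card_Touch_singleton_le (H := H) h y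
  have h3 := Finset.card_union_add_card_inter (Touch G col c H {x}) (Touch G col c H {y})
  have h4 : Touch G col c H {x, y} ⊆ Touch G col c H {x} ∪ Touch G col c H {y} := by
    intro p hp
    simp only [Touch, Finset.mem_filter, Finset.mem_union, Finset.mem_insert,
      Finset.mem_singleton] at hp ⊢
    tauto
  have h5 := Finset.card_le_card h4
  have h6 : (if G.Adj x y then 1 else 0) ≤ #(Touch G col c H {x} ∩ Touch G col c H {y}) := by
    split_ifs with ha
    · refine Finset.card_pos.2 ⟨(x, y), ?_⟩
      simp only [Touch, Finset.mem_filter, Finset.mem_inter, mem_Ep, Finset.mem_singleton]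
      tauto
    · simp
  omega

lemma card_Touch_weak_le (h : BipCycle G col c t) {w : V} (hW : ∀ z ∈ W, ∀ z', z' ∉ W → z' ≠ w →
      (z' ∈ H ∨ ∃ i, z' = c i) → ¬ G.Adj z z') :
    #(Touch G col c H W) ≤ (#{v ∈ W | col v = true} + 1) * #{v ∈ W | col v = false} ∨
    #(Touch G col c H W) ≤ #{v ∈ W | col v = true} * (#{v ∈ W | col v = false} + 1) := by
  have key : ∀ p ∈ Touch G col c H W, col p.1 = true ∧ col p.2 = false ∧
      (p.1 ∈ W ∨ p.2 ∈ W) ∧ (p.1 ∈ W ∨ p.1 = w) ∧ (p.2 ∈ W ∨ p.2 = w) := by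
    rintro ⟨x, y⟩ hp
    simp only [Touch, Finset.mem_filter, mem_Ep] at hp ⊢
    obtain ⟨⟨h1, h2, h3, h4, h5⟩, h6⟩ := hp
    have := h.proper h2
    rw [h1] at this
    refine ⟨h1, by simpa using this.symm, h6, ?_, ?_⟩
    · by_contra! hc
      exact hW y (h6.resolve_left hc.1) x hc.1 hc.2 h3 h2.symm
    · by_contra! hc
      exact hW x (h6.resolve_right hc.1) y hc.1 hc.2 h4 h2
  cases hw : col w
  · right
    refine (Finset.card_le_card (t := {v ∈ W | col v = true} ×ˢ
      insert w {v ∈ W | col v = false}) ?_).trans ?_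
    · intro p hp
      obtain ⟨h1, h2, h3, h4, h5⟩ := key p hp
      simp only [Finset.mem_product, Finset.mem_insert, Finset.mem_filter]
      refine ⟨⟨h4.resolve_right ?_, h1⟩, h5.symm.imp_right fun h => ⟨h, h2⟩⟩
      intro e; rw [e, hw] at h1; simp at h1
    · rw [Finset.card_product]
      exact Nat.mul_le_mul_left _ (Finset.card_insert_le _ _)
  · left
    refine (Finset.card_le_card (t := (insert w {v ∈ W | col v = true}) ×ˢ
      {v ∈ W | col v = false}) ?_).trans ?_
    · intro p hp
      obtain ⟨h1, h2, h3, h4, h5⟩ := key p hp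
      simp only [Finset.mem_product, Finset.mem_insert, Finset.mem_filter]
      refine ⟨h4.symm.imp_right fun h => ⟨h, h1⟩, h5.resolve_right ?_, h2⟩
      intro e; rw [e, hw] at h2; simp at h2
    · rw [Finset.card_product]
      exact Nat.mul_le_mul_right _ (Finset.card_insert_le _ _)

lemma card_Touch_closed_le (h : BipCycle G col c t)
    (hW : ∀ z ∈ W, ∀ z' ∈ H, G.Adj z z' → z' ∈ W) :
    #(Touch G col c H W) ≤ #{v ∈ W | col v = true} * #{v ∈ W | col v = false} +
      ∑ v ∈ W, nC G c t v := by
  have hsub : Touch G col c H W ⊆ ({v ∈ W | col v = true} ×ˢ {v ∈ W | col v = false}) ∪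
      W.biUnion (fun v => Finset.image (fun w => if col v = true then (v, w) else (w, v))
        ({w | G.Adj v w ∧ ∃ i, w = c i} : Finset V)) := by
    rintro ⟨x, y⟩ hp
    simp only [Touch, Finset.mem_filter, mem_Ep] at hp
    obtain ⟨⟨h1, h2, h3, h4, h5⟩, h6⟩ := hp
    have hc := h.proper h2
    rw [h1] at hc
    have hc : col y = false := by simpa using hc.symm
    simp only [Finset.mem_union, Finset.mem_product, Finset.mem_filter, Finset.mem_biUnion,
      Finset.mem_image, Finset.mem_univ, true_and]
    rcases h3 with h3 | h3
    · rcases h4 with h4 | h4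
      · left
        rcases h6 with h6 | h6
        · exact ⟨⟨h6, h1⟩, hW x h6 y h4 h2, hc⟩
        · exact ⟨⟨hW y h6 x h3 h2.symm, h1⟩, h6, hc⟩
      · by_cases hxW : x ∈ W
        · exact Or.inr ⟨x, hxW, y, ⟨h2, h4⟩, by simp [h1]⟩
        · have hy := h6.resolve_left hxW
          exact absurd (hW y hy x h3 h2.symm) hxW
    · by_cases hyW : y ∈ W
      · exact Or.inr ⟨y, hyW, x, ⟨h2.symm, h3⟩, by simp [hc]⟩
      · have hx := h6.resolve_right hyW
        rcases h4 with h4 | h4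
        · exact absurd (hW x hx y h4 h2) hyW
        · exact Or.inr ⟨x, hx, y, ⟨h2, h4⟩, by simp [h1]⟩
  refine (Finset.card_le_card hsub).trans ((Finset.card_union_le _ _).trans ?_)
  rw [Finset.card_product]
  refine Nat.add_le_add_left (Finset.card_biUnion_le.trans (Finset.sum_le_sum fun v _ => ?_)) _
  exact Finset.card_image_le.trans (card_nbr_cycle_le h v)

lemma card_Ep_swap (h : BipCycle G col c t) :
    #(Ep G (fun v => !col v) (fun i => c (i + 1)) H) = #(Ep G col c H) := by
  have hr : ∀ v, (∃ i, v = c (i + 1)) ↔ ∃ i, v = c i := fun v =>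
    ⟨fun ⟨i, hi⟩ => ⟨_, hi⟩, fun ⟨i, hi⟩ => ⟨i - 1, by simpa using hi⟩⟩
  apply Finset.card_nbij' Prod.swap Prod.swap
  · rintro ⟨x, y⟩ hp
    simp only [Finset.mem_coe, mem_Ep, Prod.swap, hr] at hp ⊢
    have := h.proper hp.2.1
    refine ⟨?_, hp.2.1.symm, hp.2.2.2.1, hp.2.2.1, hp.2.2.2.2.symm⟩
    have h1 := hp.1
    cases hx : col x <;> cases hy : col y <;> simp_all
  · rintro ⟨x, y⟩ hp
    simp only [Finset.mem_coe, mem_Ep, Prod.swap, hr] at hp ⊢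
    have := h.proper hp.2.1
    refine ⟨?_, hp.2.1.symm, hp.2.2.2.1, hp.2.2.1, hp.2.2.2.2.symm⟩
    have h1 := hp.1
    cases hx : col x <;> cases hy : col y <;> simp_all
  · simp [Set.LeftInvOn]
  · simp [Set.LeftInvOn]

/-- Properties of a minimal balanced counterexample. -/
structure Bad (G : SimpleGraph V) (col : V → Bool) (c : ℤ → V) (t : ℕ) (H : Finset V) : Prop where
  cyc : BipCycle G col c t
  out : ∀ v ∈ H, ∀ i, v ≠ c i
  ne : H.Nonempty
  bal : #{v ∈ H | col v = true} = #{v ∈ H | col v = false}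
  small : #{v ∈ H | col v = true} ≤ t
  escape : ∀ W ⊆ H, W.Nonempty → ∀ w, ∃ z ∈ W, ∃ z', z' ∉ W ∧ z' ≠ w ∧ (z' ∈ H ∨ ∃ i, z' = c i) ∧
    G.Adj z z'
  pair : ∀ x ∈ H, ∀ y ∈ H, col x = true → col y = false →
    t + 2 + (if G.Adj x y then 1 else 0) ≤ dg G c t H x + dg G c t H y
  chunk : ∀ W ⊆ H, W.Nonempty → #{v ∈ W | col v = true} = #{v ∈ W | col v = false} →
    (∀ z ∈ W, ∀ z' ∈ H, G.Adj z z' → z' ∈ W) →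
    #{v ∈ W | col v = true} * (t + 1) <
      #{v ∈ W | col v = true} * #{v ∈ W | col v = true} + ∑ v ∈ W, nC G c t v

omit [Fintype V] in
lemma Bad.swap (h : Bad G col c t H) : Bad G (fun v => !col v) (fun i => c (i + 1)) t H where
  cyc := h.cyc.swap
  out := fun v hv i => h.out v hv _
  ne := h.ne
  bal := by simpa using h.bal.symm
  small := by have := h.bal; have := h.small; simp; omega
  escape := by
    intro W hW hne w
    obtain ⟨z, hz, z', h1, h2, h3, h4⟩ := h.escape W hW hne w
    refine ⟨z, hz, z', h1, h2, h3.imp_right ?_, h4⟩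
    rintro ⟨i, hi⟩
    exact ⟨i - 1, by simpa using hi⟩
  pair := by
    intro x hx y hy hcx hcy
    have := h.pair y hy x hx (by simpa using hcy) (by simpa using hcx)
    simp only [dg, h.cyc.nC_swap, G.adj_comm x y] at this ⊢
    omega
  chunk := by
    intro W hW hne hb hcl
    have := h.chunk W hW hne (by simpa using hb.symm) hcl
    simp only [h.cyc.nC_swap]
    simp at hb ⊢
    rwa [hb]

/-- The bound of the balanced case follows by induction if there is no bad configuration. -/
lemma bad_of_lt (h : BipCycle G col c t) (out : ∀ v ∈ H, ∀ i, v ≠ c i) (ne : H.Nonempty)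
    (bal : #{v ∈ H | col v = true} = #{v ∈ H | col v = false})
    (small : #{v ∈ H | col v = true} ≤ t)
    (ih : ∀ W ⊆ H, W.Nonempty → #(Ep G col c (H \ W)) ≤
      t * max #{v ∈ H \ W | col v = true} #{v ∈ H \ W | col v = false} +
        min #{v ∈ H \ W | col v = true} #{v ∈ H \ W | col v = false})
    (hlt : t * #{v ∈ H | col v = true} + #{v ∈ H | col v = true} < #(Ep G col c H)) :
    Bad G col c t H := by
  have key : ∀ W ⊆ H, W.Nonempty → t * min #{v ∈ W | col v = true} #{v ∈ W | col v = false} +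
      max #{v ∈ W | col v = true} #{v ∈ W | col v = false} < #(Touch G col c H W) := by
    intro W hW hne
    have h1 := ih W hW hne
    have h2 := card_Ep_le (G := G) (col := col) (c := c) H W
    have e : ∀ b, #{v ∈ H \ W | col v = b} + #{v ∈ W | col v = b} = #{v ∈ H | col v = b} := by
      intro b
      rw [← Finset.card_union_of_disjoint (Finset.disjoint_filter_filter
        Finset.sdiff_disjoint), ← Finset.filter_union, Finset.sdiff_union_of_subset hW]
    have e1 := e true
    have e2 := e false
    generalize #{v ∈ H \ W | col v = true} = r at *
    generalize #{v ∈ H \ W | col v = false} = s at *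
    generalize #{v ∈ W | col v = true} = i at *
    generalize #{v ∈ W | col v = false} = j at *
    have e3 : max r s + min i j = #{v ∈ H | col v = true} := by omega
    have e4 : min r s + max i j = #{v ∈ H | col v = true} := by omega
    have e5 : t * max r s + t * min i j = t * #{v ∈ H | col v = true} := by rw [← e3]; ring
    omega
  refine ⟨h, out, ne, bal, small, ?_, ?_, ?_⟩
  · intro W hW hne w
    by_contra! hc
    have h1 := key W hW hne
    have h2 := card_Touch_weak_le (H := H) h (W := W) (w := w) hc
    have e1 : #{v ∈ W | col v = true} ≤ t :=
      (Finset.card_le_card (Finset.filter_subset_filter _ hW)).trans small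
    have e2 : #{v ∈ W | col v = false} ≤ t :=
      (Finset.card_le_card (Finset.filter_subset_filter _ hW)).trans (bal ▸ small)
    generalize #{v ∈ W | col v = true} = i at *
    generalize #{v ∈ W | col v = false} = j at *
    rcases le_total i j with hij | hij
    · rw [min_eq_left hij, max_eq_right hij] at h1
      rcases h2 with h2 | h2 <;> nlinarith
    · rw [min_eq_right hij, max_eq_left hij] at h1
      rcases h2 with h2 | h2 <;> nlinarith
  · intro x hx y hy hcx hcy
    have hxy : x ≠ y := by rintro rfl; simp [hcx] at hcy
    have h1 := key {x, y} (by intro v hv; simp at hv; rcases hv with rfl | rfl <;> assumption)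
      (by simp)
    have h2 := card_Touch_pair_le h hcx hx hy
    simp [Finset.filter_insert, Finset.filter_singleton, hcx, hcy] at h1
    omega
  · intro W hW hne hb hcl
    have h1 := key W hW hne
    have h2 := card_Touch_closed_le (H := H) h hcl
    rw [← hb] at h1 h2
    simp at h1
    nlinarith

end BipCyc

namespace BipCyc
open Finset
open scoped Classical

variable {V : Type*} {G : SimpleGraph V} {col : V → Bool} {c : ℤ → V} {t : ℕ} {H : Finset V}

/-- Neighbourhood of a set inside `H`. -/
noncomputable def nb (G : SimpleGraph V) (H S : Finset V) : Finset V := {w ∈ H | ∃ x ∈ S, G.Adj x w}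

lemma mem_nb {S : Finset V} {w : V} : w ∈ nb G H S ↔ w ∈ H ∧ ∃ x ∈ S, G.Adj x w := by simp [nb]

lemma nb_mono {S S' : Finset V} (h : S ⊆ S') : nb G H S ⊆ nb G H S' := by
  intro w hw
  rw [mem_nb] at hw ⊢
  obtain ⟨h1, x, hx, h2⟩ := hw
  exact ⟨h1, x, h hx, h2⟩

/-- A minimal set violating Hall's condition. -/
structure Crit (G : SimpleGraph V) (col : V → Bool) (H : Finset V) (b : Bool) (R : Finset V) :
    Prop where
  sub : R ⊆ H
  col_eq : ∀ x ∈ R, col x = b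
  card : #(nb G H R) + 1 = #R
  min : ∀ S ⊂ R, #S ≤ #(nb G H S)

lemma exists_matching {S : Finset V} (hS : ∀ S' ⊆ S, #S' ≤ #(nb G H S')) :
    ∃ f : V → V, Set.InjOn f S ∧ ∀ x ∈ S, f x ∈ H ∧ G.Adj x (f x) := by
  have := (Finset.all_card_le_biUnion_card_iff_exists_injective
    (fun x : S => ({w ∈ H | G.Adj x w} : Finset V))).1 (by
      intro T
      have h1 := hS (T.map (Function.Embedding.subtype _)) (by
        intro x hx
        simp only [Finset.mem_map, Function.Embedding.coe_subtype] at hx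
        obtain ⟨y, -, rfl⟩ := hx
        exact y.2)
      rw [Finset.card_map] at h1
      refine h1.trans (Finset.card_le_card ?_)
      intro w hw
      simp only [mem_nb, Finset.mem_map, Function.Embedding.coe_subtype, Finset.mem_biUnion,
        Finset.mem_filter] at hw ⊢
      obtain ⟨h2, x, ⟨y, hy, rfl⟩, h3⟩ := hw
      exact ⟨y, hy, h2, h3⟩)
  obtain ⟨f, hf, hf'⟩ := this
  refine ⟨fun x => if hx : x ∈ S then f ⟨x, hx⟩ else x, ?_, ?_⟩
  · intro x hx y hy hxy
    rw [Finset.mem_coe] at hx hy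
    simp only [hx, hy, dif_pos] at hxy
    simpa using hf hxy
  · intro x hx
    have := hf' ⟨x, hx⟩
    simp only [hx, dif_pos]
    simpa using this

lemma exists_matching_or_crit {S : Finset V} (b : Bool) (hS : S ⊆ H) (hc : ∀ x ∈ S, col x = b) :
    (∃ f : V → V, Set.InjOn f S ∧ ∀ x ∈ S, f x ∈ H ∧ G.Adj x (f x)) ∨
      ∃ R ⊆ S, Crit G col H b R := by
  by_cases hd : ∀ S' ⊆ S, #S' ≤ #(nb G H S')
  · exact Or.inl (exists_matching hd)
  right
  push Not at hd
  obtain ⟨S₀, h1, h2⟩ := hd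
  have hne : ({S' ∈ S.powerset | #(nb G H S') < #S'} : Finset (Finset V)).Nonempty :=
    ⟨S₀, by simp [h1, h2]⟩
  obtain ⟨R, hR, hmin⟩ := Finset.exists_min_image _ (fun S' => #S') hne
  simp only [Finset.mem_filter, Finset.mem_powerset] at hR hmin
  have hmin' : ∀ T ⊂ R, #T ≤ #(nb G H T) := by
    intro T hT
    by_contra! hcon
    have := hmin T ⟨hT.subset.trans hR.1, hcon⟩
    have := Finset.card_lt_card hT
    omega
  refine ⟨R, hR.1, hR.1.trans hS, fun x hx => hc x (hR.1 hx), ?_, hmin'⟩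
  obtain ⟨x, hx⟩ : R.Nonempty := Finset.card_pos.1 (by omega)
  have h3 := hmin' _ (Finset.erase_ssubset hx)
  have h4 := Finset.card_le_card (nb_mono (G := G) (H := H) (Finset.erase_subset x R))
  rw [Finset.card_erase_of_mem hx] at h3
  omega

lemma Crit.nonempty {b : Bool} {R : Finset V} (h : Crit G col H b R) : R.Nonempty :=
  Finset.card_pos.1 (by have := h.card; omega)

lemma Crit.root {b : Bool} {R : Finset V} (h : Crit G col H b R) {x₀ : V} (hx₀ : x₀ ∈ R) :
    ∃ g : V → V, Set.InjOn g (nb G H R) ∧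
      ∀ y ∈ nb G H R, g y ∈ R ∧ g y ≠ x₀ ∧ G.Adj y (g y) := by
  obtain ⟨f, hf, hf'⟩ := exists_matching (G := G) (H := H) (S := R.erase x₀) (by
    intro S hS
    exact h.min S (lt_of_le_of_lt hS (Finset.erase_ssubset hx₀)))
  have himg : (R.erase x₀).image f = nb G H R := by
    apply Finset.eq_of_subset_of_card_le
    · intro y hy
      obtain ⟨x, hx, rfl⟩ := Finset.mem_image.1 hy
      exact mem_nb.2 ⟨(hf' x hx).1, x, Finset.mem_of_mem_erase hx, (hf' x hx).2⟩
    · rw [Finset.card_image_of_injOn hf, Finset.card_erase_of_mem hx₀]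
      have := h.card
      omega
  have hex : ∀ y, ∃ x, y ∈ nb G H R → x ∈ R.erase x₀ ∧ f x = y := by
    intro y
    by_cases hy : y ∈ nb G H R
    · rw [← himg] at hy
      obtain ⟨x, hx, rfl⟩ := Finset.mem_image.1 hy
      exact ⟨x, fun _ => ⟨hx, rfl⟩⟩
    · exact ⟨y, fun h => absurd h hy⟩
  choose g hg using hex
  refine ⟨g, ?_, ?_⟩
  · intro y hy y' hy' e
    rw [← (hg y hy).2, ← (hg y' hy').2, e]
  · intro y hy
    obtain ⟨h1, h2⟩ := hg y hy
    refine ⟨Finset.mem_of_mem_erase h1, Finset.ne_of_mem_erase h1, ?_⟩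
    have := (hf' _ h1).2
    rw [h2] at this
    exact this.symm

/-- `g` matches the part of `nb G H R` off `L` into the part of `R` off `L`. -/
def Mat (G : SimpleGraph V) (H R : Finset V) (g : V → V) (L : List V) : Prop :=
  (∀ y ∈ nb G H R, ∀ y' ∈ nb G H R, y ∉ L → y' ∉ L → g y = g y' → y = y') ∧
    ∀ y ∈ nb G H R, y ∉ L → g y ∈ R ∧ g y ∉ L ∧ G.Adj y (g y)

lemma Mat.reverse {R : Finset V} {g : V → V} {L : List V} (h : Mat G H R g L) :
    Mat G H R g L.reverse := by simpa [Mat] using h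

lemma Crit.exists_mat {b : Bool} {R : Finset V} (h : Crit G col H b R) {x₀ : V} (hx₀ : x₀ ∈ R) :
    ∃ g, Mat G H R g [x₀] := by
  obtain ⟨g, h1, h2⟩ := h.root hx₀
  exact ⟨g, fun y hy y' hy' _ _ e => h1 hy hy' e, fun y hy _ => by
    obtain ⟨a, b, d⟩ := h2 y hy
    exact ⟨a, by simpa using b, d⟩⟩

lemma Crit.nb_col {b : Bool} {R : Finset V} (h : Crit G col H b R) (hG : BipCycle G col c t) {y : V}
    (hy : y ∈ nb G H R) : col y = !b := by
  obtain ⟨-, x, hx, hxy⟩ := mem_nb.1 hy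
  have := hG.proper hxy
  rw [h.col_eq x hx] at this
  cases b <;> simp_all

/-- Extend a path greedily along a matching until its first vertex is closed. -/
lemma Crit.extend {b : Bool} {R : Finset V} (h : Crit G col H b R) (hG : BipCycle G col c t)
    {g : V → V} {L : List V} {x v : V} (hL : Pth G L x v) (hx : x ∈ R) (hm : Mat G H R g L) :
    ∃ M x', Pth G (M ++ L) x' v ∧ x' ∈ R ∧ (∀ w ∈ H, G.Adj x' w → w ∈ M ++ L) ∧
      (∀ w ∈ M, w ∈ R ∨ w ∈ nb G H R) ∧ Mat G H R g (M ++ L) ∧ Even M.length := by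
  induction hn : #{y ∈ nb G H R | y ∉ L} using Nat.strong_induction_on generalizing L x with
  | _ n ih =>
    by_cases hcl : ∀ w ∈ H, G.Adj x w → w ∈ L
    · exact ⟨[], x, by simpa using hL, hx, by simpa using hcl, by simp, by simpa using hm, by simp⟩
    push Not at hcl
    obtain ⟨y, hyH, hxy, hyL⟩ := hcl
    have hy : y ∈ nb G H R := mem_nb.2 ⟨hyH, x, hx, hxy⟩
    obtain ⟨g1, g2, g3⟩ := hm.2 y hy hyL
    have hgy : g y ≠ y := g3.ne'
    have hL' : Pth G (g y :: y :: L) (g y) v :=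
      (hL.cons hxy.symm hyL).cons g3.symm (by simp [hgy, g2])
    have hm' : Mat G H R g (g y :: y :: L) := by
      refine ⟨fun a ha a' ha' h1 h2 e => hm.1 a ha a' ha' (by simp at h1; tauto)
        (by simp at h2; tauto) e, ?_⟩
      intro a ha h1
      simp only [List.mem_cons, not_or] at h1
      obtain ⟨k1, k2, k3⟩ := hm.2 a ha h1.2.2
      refine ⟨k1, ?_, k3⟩
      simp only [List.mem_cons, not_or]
      refine ⟨fun e => h1.2.1 (hm.1 a ha y hy h1.2.2 hyL e), ?_, k2⟩
      intro e
      have e1 := h.nb_col hG hy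
      have e2 := h.col_eq _ k1
      rw [e, e1] at e2
      simp at e2
    obtain ⟨M, x', m1, m2, m3, m4, m5, m6⟩ := ih _ (by
      rw [← hn]
      apply Finset.card_lt_card
      rw [Finset.ssubset_iff_of_subset]
      · exact ⟨y, by simp [hy, hyL], by simp⟩
      · intro z hz
        simp only [Finset.mem_filter, List.mem_cons, not_or] at hz ⊢
        tauto) hL' g1 hm' rfl
    have e : M ++ g y :: y :: L = (M ++ [g y, y]) ++ L := by simp
    rw [e] at m1 m3 m5
    refine ⟨M ++ [g y, y], x', m1, m2, m3, ?_, m5, by simp [Nat.even_add, m6]⟩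
    intro w hw
    simp only [List.mem_append, List.mem_cons, List.not_mem_nil, or_false] at hw
    rcases hw with hw | rfl | rfl
    · exact m4 w hw
    · exact Or.inl g1
    · exact Or.inr hy

lemma dH_le_card_col (h : BipCycle G col c t) {x : V} {b : Bool} (hx : col x = b) :
    dH G H x ≤ #{v ∈ H | col v = !b} := by
  apply Finset.card_le_card
  intro w hw
  simp only [Finset.mem_filter] at hw ⊢
  have := h.proper hw.2
  rw [hx] at this
  refine ⟨hw.1, ?_⟩
  cases b <;> simp_all

/-- In an unbalanced situation the larger side has a vertex of small degree. -/
lemma exists_dg_le_of_lt (h : BipCycle G col c t) (out : ∀ v ∈ H, ∀ i, v ≠ c i)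
    (hlt : #{v ∈ H | col v = false} < #{v ∈ H | col v = true})
    (hs : #{v ∈ H | col v = false} ≤ t) : ∃ x ∈ H, col x = true ∧ dg G c t H x ≤ t := by
  by_contra! hcon
  rcases exists_matching_or_crit (G := G) (S := {v ∈ H | col v = true}) (col := col) true
    (Finset.filter_subset _ _) (by simp) with ⟨f, hf, hf'⟩ | ⟨R, hR, hc⟩
  · have : #{v ∈ H | col v = true} ≤ #{v ∈ H | col v = false} := by
      apply Finset.card_le_card_of_injOn f _ hf
      intro x hx
      obtain ⟨h1, h2⟩ := hf' x hx
      have := h.proper h2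
      simp only [Finset.mem_coe, Finset.mem_filter] at hx ⊢
      rw [hx.2] at this
      exact ⟨h1, by simpa using this.symm⟩
    omega
  · have hnz : ∀ x ∈ R, nC G c t x ≠ 0 := by
      intro x hx h0
      have h1 := hc.col_eq x hx
      have h2 := hcon x (hc.sub hx) h1
      have h3 := dH_le_card_col (H := H) h h1
      simp only [dg, h0, Bool.not_true] at h2 h3
      omega
    obtain ⟨x₀, hx₀⟩ := hc.nonempty
    obtain ⟨g, hg⟩ := hc.exists_mat hx₀
    obtain ⟨M, x', m1, m2, m3, m4, m5, m6⟩ := hc.extend h (Pth.singleton x₀) hx₀ hg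
    have ho : Out c (M ++ [x₀]) := by
      intro v hv
      apply out
      rw [List.mem_append, List.mem_singleton] at hv
      rcases hv with hv | rfl
      · rcases m4 v hv with hv | hv
        · exact hc.sub hv
        · exact (mem_nb.1 hv).1
      · exact hc.sub hx₀
    have := h.degree_le m1 ho m3 (hnz _ m2) (hnz _ hx₀)
    have := hcon x' (hc.sub m2) (hc.col_eq _ m2)
    unfold dg at this
    omega

/-- Some vertex has small degree. -/
lemma exists_dg_le (h : BipCycle G col c t) (out : ∀ v ∈ H, ∀ i, v ≠ c i) (hne : H.Nonempty) :
    ∃ v ∈ H, dg G c t H v ≤ t := by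
  have key : ∃ L a b, Pth G L a b ∧ (∀ v ∈ L, v ∈ H) ∧
      ∀ L' a' b', Pth G L' a' b' → (∀ v ∈ L', v ∈ H) → L'.length ≤ L.length := by
    by_contra! hcon
    have : ∀ n, ∃ L a b, Pth G L a b ∧ (∀ v ∈ L, v ∈ H) ∧ n ≤ L.length := by
      intro n
      induction n with
      | zero =>
        obtain ⟨v, hv⟩ := hne
        exact ⟨[v], v, v, .singleton v, by simpa using hv, by simp⟩
      | succ n ih =>
        obtain ⟨L, a, b, h1, h2, h3⟩ := ih
        obtain ⟨L', a', b', k1, k2, k3⟩ := hcon L a b h1 h2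
        exact ⟨L', a', b', k1, k2, by omega⟩
    obtain ⟨L, a, b, h1, h2, h3⟩ := this (#H + 1)
    have : L.toFinset ⊆ H := by intro v hv; exact h2 v (by simpa using hv)
    have := Finset.card_le_card this
    rw [List.toFinset_card_of_nodup h1.2.1] at this
    omega
  obtain ⟨L, a, b, h1, h2, h3⟩ := key
  have cl : ∀ L' a' b', Pth G L' a' b' → (∀ v ∈ L', v ∈ H) → L'.length = L.length →
      ∀ w ∈ H, G.Adj a' w → w ∈ L' := by
    intro L' a' b' k1 k2 k3 w hw ha
    by_contra hc
    have := h3 (w :: L') w b' (k1.cons ha.symm hc) (by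
      intro v hv; rw [List.mem_cons] at hv; rcases hv with rfl | hv; exacts [hw, k2 v hv])
    simp at this
    omega
  have ca := cl L a b h1 h2 rfl
  have cb := cl L.reverse b a h1.reverse (by simpa using h2) (by simp)
  by_cases ha : nC G c t a = 0
  · refine ⟨a, h2 a h1.head_mem, ?_⟩
    have := h.dH_le h1 ca
    simp [dg, ha, this]
  by_cases hb : nC G c t b = 0
  · refine ⟨b, h2 b h1.last_mem, ?_⟩
    have := h.dH_le h1.reverse cb
    simp [dg, hb, this]
  exact ⟨a, h2 a h1.head_mem, h.degree_le h1 (fun v hv => out v (h2 v hv)) ca ha hb⟩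

end BipCyc

namespace BipCyc
open Finset
open scoped Classical

section Paths
variable {V : Type*} {G : SimpleGraph V}

/-- Glue two paths at a common end. -/
lemma Pth.glue {l₁ l₂ : List V} {a b d : V} (h₁ : Pth G l₁ a b) (h₂ : Pth G l₂ b d)
    (hd : ∀ v ∈ l₁, v ∈ l₂ → v = b) :
    ∃ l, Pth G l a d ∧ l.length + 1 = l₁.length + l₂.length ∧ ∀ v, v ∈ l ↔ v ∈ l₁ ∨ v ∈ l₂ := by
  obtain ⟨m, rfl⟩ : ∃ m, l₂ = b :: m := by
    have := h₂.2.2.1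
    cases l₂ with
    | nil => simp at this
    | cons x m => simp at this; exact ⟨m, by rw [this]⟩
  cases m with
  | nil =>
    have : b = d := by simpa [Pth] using h₂.2.2.2
    subst this
    refine ⟨l₁, h₁, by simp, ?_⟩
    intro v
    simp only [List.mem_singleton]
    constructor
    · exact Or.inl
    · rintro (h | rfl)
      · exact h
      · exact h₁.last_mem
  | cons e m =>
    have h3 : Pth G (e :: m) e d := (Pth.split (l₁ := [b]) (l₂ := m) (v := e) h₂).2
    have hbe : G.Adj b e := by
      have := h₂.1
      simp at this
      exact this.1
    have hnd := h₂.2.1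
    rw [List.nodup_cons] at hnd
    refine ⟨l₁ ++ (e :: m), h₁.append h3 hbe ?_, by simp; omega, ?_⟩
    · intro v hv hv'
      have := hd v hv (List.mem_cons_of_mem _ hv')
      subst this
      exact hnd.1 hv'
    · intro v
      have := h₁.last_mem
      simp only [List.mem_append, List.mem_cons]
      constructor
      · tauto
      · rintro (h | rfl | h) <;> tauto

/-- Trim a path so that only its ends lie in the prescribed sets. -/
lemma Pth.trim {R : List V} {r s : V} (hR : Pth G R r s) {S T : V → Prop} (hr : S r) (hs : T s) :
    ∃ R' r' s', Pth G R' r' s' ∧ S r' ∧ T s' ∧ (∀ v ∈ R', v ∈ R) ∧ (∀ v ∈ R', S v → v = r') ∧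
      ∀ v ∈ R', T v → v = s' := by
  induction hn : R.length using Nat.strong_induction_on generalizing R r s with
  | _ n ih =>
    by_cases h1 : ∃ v ∈ R, S v ∧ v ≠ r
    · obtain ⟨v, hv, hSv, hne⟩ := h1
      obtain ⟨l₁, l₂, rfl⟩ := List.append_of_mem hv
      have hl : l₁ ≠ [] := by
        rintro rfl
        have := hR.2.2.1
        simp at this
        exact hne this
      have := List.length_pos_iff.2 hl
      obtain ⟨R', r', s', k1, k2, k3, k4, k5⟩ := ih (v :: l₂).length (by simp at hn ⊢; omega)
        hR.split.2 hSv hs rfl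
      exact ⟨R', r', s', k1, k2, k3, fun w hw => List.mem_append_right _ (k4 w hw), k5⟩
    by_cases h2 : ∃ v ∈ R, T v ∧ v ≠ s
    · obtain ⟨v, hv, hTv, hne⟩ := h2
      obtain ⟨l₁, l₂, rfl⟩ := List.append_of_mem hv
      have hl : l₂ ≠ [] := by
        rintro rfl
        have := hR.2.2.2
        simp at this
        exact hne this
      have := List.length_pos_iff.2 hl
      obtain ⟨R', r', s', k1, k2, k3, k4, k5⟩ := ih (l₁ ++ [v]).length (by simp at hn ⊢; omega)
        hR.split.1 hr hTv rfl
      exact ⟨R', r', s', k1, k2, k3, fun w hw => by have := k4 w hw; simp at this ⊢; tauto, k5⟩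
    · push Not at h1 h2
      exact ⟨R, r, s, hR, hr, hs, fun _ h => h, h1, h2⟩

/-- The list `p a, …, p b`. -/
def seg (p : ℕ → V) (a b : ℕ) : List V := (List.range (b + 1 - a)).map fun k => p (a + k)

lemma mem_seg {p : ℕ → V} {a b : ℕ} {v : V} :
    v ∈ seg p a b ↔ ∃ j, a ≤ j ∧ j ≤ b ∧ p j = v := by
  simp only [seg, List.mem_map, List.mem_range]
  constructor
  · rintro ⟨k, h1, h2⟩; exact ⟨a + k, by omega, by omega, h2⟩
  · rintro ⟨j, h1, h2, h3⟩; exact ⟨j - a, by omega, by rwa [Nat.add_sub_cancel' h1]⟩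

@[simp] lemma length_seg {p : ℕ → V} {a b : ℕ} : (seg p a b).length = b + 1 - a := by simp [seg]

lemma seg_pth {p : ℕ → V} {l a b : ℕ} (hinj : ∀ i ≤ l, ∀ j ≤ l, p i = p j → i = j)
    (hadj : ∀ i < l, G.Adj (p i) (p (i + 1))) (hab : a ≤ b) (hb : b ≤ l) :
    Pth G (seg p a b) (p a) (p b) := by
  obtain ⟨n, rfl⟩ := Nat.exists_eq_add_of_le hab
  have e : a + n + 1 - a = n + 1 := by omega
  refine ⟨?_, ?_, ?_, ?_⟩
  · rw [seg, e, List.isChain_map, List.isChain_range]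
    intro m hm
    have := hadj (a + m) (by omega)
    rwa [add_assoc] at this
  · rw [seg, e, List.nodup_map_iff_inj_on List.nodup_range]
    intro i hi j hj hij
    simp at hi hj
    have := hinj _ (by omega) _ (by omega) hij
    omega
  · simp [seg, e, List.range_succ_eq_map]
  · simp [seg, e, List.range_succ]

/-- Reroute a path `R` ending on `A` along `A`. -/
lemma Pth.reroute {R A : List V} {r w a e : V} (hR : Pth G R r w) (hA : Pth G A a e)
    {Z ZZ : V → Prop} (he : Z e) (hw : w ∈ A ∨ Z w) (hRA : ∀ v ∈ R, v ∈ A → v = w)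
    (hRZ : ∀ v ∈ R, ZZ v → v = w) (hAZ : ∀ v ∈ A, ZZ v → v = e) :
    ∃ R' e', Pth G R' r e' ∧ Z e' ∧ (∀ v ∈ R', v ∈ R ∨ v ∈ A) ∧ (∀ v ∈ R', ZZ v → v = e') ∧
      (a ∉ R → a ∉ R') := by
  by_cases hwA : w ∈ A
  · obtain ⟨l₁, l₂, rfl⟩ := List.append_of_mem hwA
    obtain ⟨l, h1, h2, h3⟩ := hR.glue hA.split.2 (fun v hv hv' =>
      hRA v hv (List.mem_append_right _ hv'))
    refine ⟨l, e, h1, he, ?_, ?_, ?_⟩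
    · intro v hv
      rcases (h3 v).1 hv with h | h
      · exact Or.inl h
      · exact Or.inr (List.mem_append_right _ h)
    · intro v hv hz
      rcases (h3 v).1 hv with h | h
      · have := hRZ v h hz
        subst this
        exact hAZ v hwA hz
      · exact hAZ v (List.mem_append_right _ h) hz
    · intro haR haL
      have h5 := ((h3 a).1 haL).resolve_left haR
      have h4 := hA.2.2.1
      have h6 := hA.2.1
      cases l₁ with
      | nil =>
        simp at h4
        subst h4
        exact haR hR.last_mem
      | cons x l₁ =>
        simp at h4
        subst h4
        simp only [List.cons_append, List.nodup_cons] at h6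
        exact h6.1 (List.mem_append_right _ h5)
  · exact ⟨R, w, hR, hw.resolve_left hwA, fun v hv => Or.inl hv, hRZ, id⟩

/-- Two disjoint paths leaving the final part of the path `p`, one from `p i` to `Z₁`, the other
to `Z₂`. -/
def Conf (G : SimpleGraph V) (U : V → Prop) (p : ℕ → V) (l i : ℕ) (Z₁ Z₂ : V → Prop) : Prop :=
  ∃ A B m e₁ e₂, i < m ∧ m ≤ l ∧ Pth G A (p i) e₁ ∧ Pth G B (p m) e₂ ∧ Z₁ e₁ ∧ Z₂ e₂ ∧
    (∀ v ∈ A, v ∉ B) ∧ (∀ v ∈ A, Z₁ v ∨ Z₂ v → v = e₁) ∧ (∀ v ∈ B, Z₁ v ∨ Z₂ v → v = e₂) ∧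
    (∀ v ∈ A, U v) ∧ (∀ v ∈ B, U v) ∧
    (∀ j, i ≤ j → j ≤ l → p j ∈ A → j = i) ∧ (∀ j, i ≤ j → j ≤ l → p j ∈ B → j = m)

lemma Conf.step {U : V → Prop} {p : ℕ → V} {l i : ℕ} {Z₁ Z₂ : V → Prop}
    (hinj : ∀ i ≤ l, ∀ j ≤ l, p i = p j → i = j)
    (hadj : ∀ i < l, G.Adj (p i) (p (i + 1)))
    (hZ : ∀ j ≤ l, 1 ≤ j → ¬ Z₁ (p j) ∧ ¬ Z₂ (p j)) (hU : ∀ j ≤ l, U (p j)) (hi : i + 1 < l)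
    (hreach : ∃ R s, Pth G R (p (i + 2)) s ∧ p (i + 1) ∉ R ∧ (Z₁ s ∨ Z₂ s) ∧ ∀ v ∈ R, U v)
    (h : Conf G U p l i Z₁ Z₂) :
    Conf G U p l (i + 1) Z₁ Z₂ ∨ Conf G U p l (i + 1) Z₂ Z₁ := by
  obtain ⟨A, B, m, e₁, e₂, him, hml, hA, hB, he₁, he₂, hAB, hAZ, hBZ, hAU, hBU, hAp, hBp⟩ := h
  have hpA : p (i + 1) ∉ A := fun hc => by have := hAp _ (by omega) (by omega) hc; omega
  have hA' : Pth G (p (i + 1) :: A) (p (i + 1)) e₁ := hA.cons (hadj i (by omega)).symm hpA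
  have hA'Z : ∀ v ∈ p (i + 1) :: A, Z₁ v ∨ Z₂ v → v = e₁ := by
    intro v hv hz
    rcases List.mem_cons.1 hv with rfl | hv
    · have := hZ (i + 1) (by omega) (by omega); tauto
    · exact hAZ v hv hz
  have hA'U : ∀ v ∈ p (i + 1) :: A, U v := by
    intro v hv
    rcases List.mem_cons.1 hv with rfl | hv
    · exact hU _ (by omega)
    · exact hAU v hv
  have hA'p : ∀ j, i + 1 ≤ j → j ≤ l → p j ∈ p (i + 1) :: A → j = i + 1 := by
    intro j h1 h2 h3
    rcases List.mem_cons.1 h3 with h3 | h3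
    · exact hinj _ h2 _ (by omega) h3
    · have := hAp j (by omega) h2 h3; omega
  rcases Nat.lt_or_ge (i + 1) m with hm | hm
  · left
    refine ⟨p (i + 1) :: A, B, m, e₁, e₂, hm, hml, hA', hB, he₁, he₂, ?_, hA'Z, hBZ, hA'U, hBU, hA'p,
      fun j h1 => hBp j (by omega)⟩
    intro v hv hvB
    rcases List.mem_cons.1 hv with rfl | hv
    · have := hBp _ (by omega) (by omega) hvB; omega
    · exact hAB v hv hvB
  obtain rfl : m = i + 1 := by omega
  obtain ⟨R₀, s₀, hR₀, hR₀p, hs₀, hR₀U⟩ := hreach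
  obtain ⟨R, r, w, hR, ⟨k, hk1, hk2, rfl⟩, hw, hRR, hRs, hRt⟩ := hR₀.trim
    (S := fun v => ∃ k, i + 2 ≤ k ∧ k ≤ l ∧ p k = v)
    (T := fun v => v ∈ A ∨ v ∈ B ∨ Z₁ v ∨ Z₂ v) ⟨i + 2, le_rfl, by omega, rfl⟩ (by tauto)
  have hRp : p (i + 1) ∉ R := fun hc => hR₀p (hRR _ hc)
  have hRj : ∀ j, i + 1 ≤ j → j ≤ l → p j ∈ R → j = k := by
    intro j h1 h2 h3
    rcases Nat.eq_or_lt_of_le h1 with h4 | h4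
    · subst h4; exact absurd h3 hRp
    · exact hinj _ h2 _ hk2 (hRs _ h3 ⟨j, h4, h2, rfl⟩)
  have hwR := hR.last_mem
  by_cases hc : w ∈ A ∨ (Z₁ w ∧ w ∉ B)
  · right
    have hwB : w ∉ B := by
      rcases hc with hc | hc
      · exact hAB w hc
      · exact hc.2
    obtain ⟨R', e', k1, k2, k3, k4, k5⟩ := hR.reroute hA (Z := Z₁) (ZZ := fun v => Z₂ v ∨ Z₁ v) he₁
      (hc.imp_right And.left) (fun v hv hv' => hRt v hv (Or.inl hv'))
      (fun v hv hv' => hRt v hv (Or.inr (Or.inr hv'.symm))) (fun v hv hv' => hAZ v hv hv'.symm)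
    refine ⟨B, R', k, e₂, e', by omega, hk2, hB, k1, he₂, k2, ?_, fun v hv hz => hBZ v hv hz.symm,
      k4, hBU, ?_, fun j h1 => hBp j (by omega), ?_⟩
    · intro v hv hv'
      rcases k3 v hv' with h | h
      · have := hRt v h (Or.inr (Or.inl hv))
        subst this; exact hwB hv
      · exact hAB v h hv
    · intro v hv
      rcases k3 v hv with h | h
      · exact hR₀U v (hRR v h)
      · exact hAU v h
    · intro j h1 h2 h3
      rcases k3 _ h3 with h | h
      · exact hRj j h1 h2 h
      · have := hAp j (by omega) h2 h; omega
  · left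
    push Not at hc
    have hwB : w ∈ B ∨ Z₂ w := by
      rcases hw with h | h | h | h
      · exact absurd h hc.1
      · exact Or.inl h
      · exact Or.inl (hc.2 h)
      · exact Or.inr h
    obtain ⟨R', e', k1, k2, k3, k4, k5⟩ := hR.reroute hB (Z := Z₂) (ZZ := fun v => Z₁ v ∨ Z₂ v) he₂
      hwB (fun v hv hv' => hRt v hv (Or.inr (Or.inl hv')))
      (fun v hv hv' => hRt v hv (Or.inr (Or.inr hv'))) (fun v hv hv' => hBZ v hv hv')
    have k5 := k5 hRp
    refine ⟨p (i + 1) :: A, R', k, e₁, e', by omega, hk2, hA', k1, he₁, k2, ?_, hA'Z,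
      k4, hA'U, ?_, hA'p, ?_⟩
    · intro v hv hv'
      rcases List.mem_cons.1 hv with rfl | hv
      · exact k5 hv'
      · rcases k3 v hv' with h | h
        · have := hRt v h (Or.inl hv)
          subst this; exact hc.1 hv
        · exact hAB v hv h
    · intro v hv
      rcases k3 v hv with h | h
      · exact hR₀U v (hRR v h)
      · exact hBU v h
    · intro j h1 h2 h3
      rcases k3 _ h3 with h | h
      · exact hRj j h1 h2 h
      · have := hBp j (by omega) h2 h
        subst this
        exact absurd h3 k5

lemma exists_conf {U : V → Prop} {p : ℕ → V} {l : ℕ} {S₁ S₂ : V → Prop}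
    (hinj : ∀ i ≤ l, ∀ j ≤ l, p i = p j → i = j)
    (hadj : ∀ i < l, G.Adj (p i) (p (i + 1))) (h0 : ∀ v, S₁ v ↔ v = p 0)
    (hZ : ∀ j ≤ l, ¬ S₂ (p j)) (hU : ∀ j ≤ l, U (p j))
    (hreach : ∀ i < l, ∃ R s, Pth G R (p (i + 1)) s ∧ p i ∉ R ∧ (S₁ s ∨ S₂ s) ∧ ∀ v ∈ R, U v)
    {i : ℕ} (hi : i < l) : Conf G U p l i S₁ S₂ ∨ Conf G U p l i S₂ S₁ := by
  have hZ' : ∀ j ≤ l, 1 ≤ j → ¬ S₁ (p j) ∧ ¬ S₂ (p j) := by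
    intro j h1 h2
    refine ⟨fun hc => ?_, hZ j h1⟩
    have := hinj _ h1 _ (Nat.zero_le _) ((h0 _).1 hc)
    omega
  induction i with
  | zero =>
    left
    obtain ⟨R₀, s₀, hR₀, hR₀p, hs₀, hR₀U⟩ := hreach 0 hi
    have hs₀ : S₂ s₀ := by
      rcases hs₀ with h | h
      · rw [h0] at h; subst h; exact absurd hR₀.last_mem hR₀p
      · exact h
    obtain ⟨R, r, w, hR, ⟨k, hk1, hk2, rfl⟩, hw, hRR, hRs, hRt⟩ := hR₀.trim
      (S := fun v => ∃ k, 1 ≤ k ∧ k ≤ l ∧ p k = v) (T := S₂) ⟨1, le_rfl, by omega, rfl⟩ hs₀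
    have h0R : p 0 ∉ R := fun h => hR₀p (hRR _ h)
    refine ⟨[p 0], R, k, p 0, w, by omega, hk2, .singleton _, hR, (h0 _).2 rfl, hw, by simpa using h0R,
      by simp, ?_, by simpa using hU 0 (by omega), fun v hv => hR₀U v (hRR v hv), ?_, ?_⟩
    · rintro v hv (h | h)
      · rw [h0] at h; subst h; exact absurd hv h0R
      · exact hRt v hv h
    · intro j _ h2 h3
      exact hinj _ h2 _ (by omega) (by simpa using h3)
    · intro j _ h2 h3
      rcases Nat.eq_zero_or_pos j with rfl | h4
      · exact absurd h3 h0R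
      · exact hinj _ h2 _ hk2 (hRs _ h3 ⟨j, h4, h2, rfl⟩)
  | succ i ih =>
    rcases ih (by omega) with h | h
    · exact h.step hinj hadj hZ' hU hi (hreach (i + 1) hi)
    · refine (h.step hinj hadj (fun j h1 h2 => (hZ' j h1 h2).symm) hU hi ?_).symm
      obtain ⟨R, s, h1, h2, h3, h4⟩ := hreach (i + 1) hi
      exact ⟨R, s, h1, h2, h3.symm, h4⟩

lemma two_card_le_nat {S : Finset ℕ} {a b : ℕ} (h1 : ∀ x ∈ S, a ≤ x) (h2 : ∀ x ∈ S, x ≤ b)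
    (hp : ∀ x ∈ S, ∀ y ∈ S, x % 2 = y % 2) (hab : a ≤ b + 2) : 2 * #S ≤ b + 2 - a := by
  have := two_card_le (S := S.map Nat.castEmbedding) (α := a) (β := b) (by simpa using h1)
    (by simpa using h2) (by
      simp only [Finset.mem_map, Nat.castEmbedding_apply, forall_exists_index, and_imp]
      rintro _ x hx rfl _ y hy rfl
      have := hp x hx y hy
      rw [Int.even_iff]; omega) (by omega)
  rw [Finset.card_map] at this
  omega

/-- A long path inside the final part of `p`, using the neighbours of `p l`. -/
lemma exists_inner_path {p : ℕ → V} {l : ℕ} (hinj : ∀ i ≤ l, ∀ j ≤ l, p i = p j → i = j)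
    (hadj : ∀ i < l, G.Adj (p i) (p (i + 1))) (hpar : ∀ i < l, G.Adj (p l) (p i) → i % 2 ≠ l % 2)
    {k m : ℕ} (hkm : k < m) (hm : m ≤ l) (hk : G.Adj (p l) (p k))
    (hmin : ∀ i < l, G.Adj (p l) (p i) → k ≤ i) :
    ∃ Q, Pth G Q (p k) (p m) ∧ (∀ v ∈ Q, ∃ j, k ≤ j ∧ j ≤ l ∧ p j = v) ∧
      2 * #{i ∈ range l | G.Adj (p l) (p i)} ≤ Q.length + 1 := by
  have hpp : ∀ S ⊆ ({i ∈ range l | G.Adj (p l) (p i)} : Finset ℕ), ∀ x ∈ S, ∀ y ∈ S,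
      x % 2 = y % 2 := by
    intro S hS x hx y hy
    have h1 := hS hx
    have h2 := hS hy
    simp only [Finset.mem_filter, Finset.mem_range] at h1 h2
    have := hpar x h1.1 h1.2
    have := hpar y h2.1 h2.2
    omega
  rcases Nat.eq_or_lt_of_le hm with rfl | hm
  · refine ⟨seg p k m, seg_pth hinj hadj hkm.le le_rfl, fun v hv => mem_seg.1 hv, ?_⟩
    have := two_card_le_nat (S := {i ∈ range m | G.Adj (p m) (p i)}) (a := k) (b := m - 1)
      (by simpa using hmin) (by simp; omega) (hpp _ subset_rfl) (by omega)
    simp; omega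
  · obtain ⟨i, hi, hmax⟩ := Finset.exists_max_image ({i ∈ range m | G.Adj (p l) (p i)} : Finset ℕ) id
      ⟨k, by simp [hkm, hk]⟩
    simp only [Finset.mem_filter, Finset.mem_range, id] at hi hmax
    have hki := hmin i (by omega) hi.2
    refine ⟨seg p k i ++ (seg p m l).reverse, (seg_pth hinj hadj hki (by omega)).append
      (seg_pth hinj hadj hm.le le_rfl).reverse hi.2.symm ?_, ?_, ?_⟩
    · intro v hv hv'
      rw [List.mem_reverse] at hv'
      obtain ⟨a, h1, h2, rfl⟩ := mem_seg.1 hv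
      obtain ⟨b, h3, h4, h5⟩ := mem_seg.1 hv'
      have := hinj _ h4 _ (by omega) h5
      omega
    · intro v hv
      rcases List.mem_append.1 hv with hv | hv
      · obtain ⟨a, h1, h2, rfl⟩ := mem_seg.1 hv
        exact ⟨a, h1, by omega, rfl⟩
      · obtain ⟨a, h1, h2, rfl⟩ := mem_seg.1 (List.mem_reverse.1 hv)
        exact ⟨a, by omega, by omega, rfl⟩
    · have e := Finset.card_filter_add_card_filter_not
        (s := ({i ∈ range l | G.Adj (p l) (p i)} : Finset ℕ)) (fun i => i < m)
      have f1 := two_card_le_nat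
        (S := {i ∈ ({i ∈ range l | G.Adj (p l) (p i)} : Finset ℕ) | i < m}) (a := k) (b := i)
        (by simp only [Finset.mem_filter, Finset.mem_range]; rintro x ⟨⟨h1, h2⟩, -⟩; exact hmin x h1 h2)
        (by simp only [Finset.mem_filter, Finset.mem_range]; rintro x ⟨⟨h1, h2⟩, h3⟩; exact hmax x ⟨h3, h2⟩)
        (hpp _ (Finset.filter_subset _ _)) (by omega)
      have f2 := two_card_le_nat
        (S := {i ∈ ({i ∈ range l | G.Adj (p l) (p i)} : Finset ℕ) | ¬ i < m}) (a := m) (b := l - 1)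
        (by simp only [Finset.mem_filter, Finset.mem_range]; rintro x ⟨⟨h1, h2⟩, h3⟩; omega)
        (by simp only [Finset.mem_filter, Finset.mem_range]; rintro x ⟨⟨h1, h2⟩, h3⟩; omega)
        (hpp _ (Finset.filter_subset _ _)) (by omega)
      rw [List.length_append, List.length_reverse, length_seg, length_seg]
      omega

lemma Conf.join {U : V → Prop} {p : ℕ → V} {l k : ℕ} {Z₁ Z₂ : V → Prop}
    (hinj : ∀ i ≤ l, ∀ j ≤ l, p i = p j → i = j)
    (hadj : ∀ i < l, G.Adj (p i) (p (i + 1))) (hpar : ∀ i < l, G.Adj (p l) (p i) → i % 2 ≠ l % 2)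
    (hk : G.Adj (p l) (p k)) (hmin : ∀ i < l, G.Adj (p l) (p i) → k ≤ i)
    (hU : ∀ j ≤ l, U (p j)) (hZ : ∀ j ≤ l, 1 ≤ j → ¬ Z₁ (p j) ∧ ¬ Z₂ (p j))
    (h : Conf G U p l k Z₁ Z₂) :
    ∃ F s₁ s₂, Pth G F s₁ s₂ ∧ Z₁ s₁ ∧ Z₂ s₂ ∧ (∀ v ∈ F, U v) ∧
      (∀ v ∈ F, Z₁ v ∨ Z₂ v → v = s₁ ∨ v = s₂) ∧
      2 * #{i ∈ range l | G.Adj (p l) (p i)} ≤ F.length ∧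
      (1 ≤ k → 2 * #{i ∈ range l | G.Adj (p l) (p i)} + 1 ≤ F.length) := by
  obtain ⟨A, B, m, e₁, e₂, hkm, hml, hA, hB, he₁, he₂, hAB, hAZ, hBZ, hAU, hBU, hAp, hBp⟩ := h
  obtain ⟨Q, hQ, hQp, hQl⟩ := exists_inner_path hinj hadj hpar hkm hml hk hmin
  have two : ∀ {L : List V} {a b : V}, Pth G L a b → a ≠ b → 2 ≤ L.length := by
    intro L a b hL hab
    by_contra! hc
    have := hL.length_pos
    obtain ⟨v, rfl⟩ := List.length_eq_one_iff.1 (show L.length = 1 by omega)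
    have h1 := hL.2.2.1
    have h2 := hL.2.2.2
    simp at h1 h2
    exact hab (h1.symm.trans h2)
  obtain ⟨F₁, h1, h2, h3⟩ := hA.reverse.glue hQ (by
    intro v hv hv'
    obtain ⟨j, j1, j2, rfl⟩ := hQp v hv'
    rw [hAp j j1 j2 (List.mem_reverse.1 hv)])
  obtain ⟨F, g1, g2, g3⟩ := h1.glue hB (by
    intro v hv hv'
    rcases (h3 v).1 hv with hv | hv
    · exact absurd hv' (hAB v (List.mem_reverse.1 hv))
    · obtain ⟨j, j1, j2, rfl⟩ := hQp v hv
      rw [hBp j j1 j2 hv'])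
  have hmem : ∀ v ∈ F, v ∈ A ∨ v ∈ B ∨ ∃ j, k ≤ j ∧ j ≤ l ∧ p j = v := by
    intro v hv
    rcases (g3 v).1 hv with hv | hv
    · rcases (h3 v).1 hv with hv | hv
      · exact Or.inl (List.mem_reverse.1 hv)
      · exact Or.inr (Or.inr (hQp v hv))
    · exact Or.inr (Or.inl hv)
  rw [List.length_reverse] at h2
  have hB2 := two hB (by rintro rfl; exact (hZ m hml (by omega)).2 he₂)
  have hA1 := hA.length_pos
  refine ⟨F, e₁, e₂, g1, he₁, he₂, ?_, ?_, by omega, ?_⟩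
  · intro v hv
    rcases hmem v hv with h | h | ⟨j, _, h, rfl⟩
    · exact hAU v h
    · exact hBU v h
    · exact hU j h
  · intro v hv hz
    rcases hmem v hv with h | h | ⟨j, j1, h, rfl⟩
    · exact Or.inl (hAZ v h hz)
    · exact Or.inr (hBZ v h hz)
    · rcases Nat.eq_zero_or_pos j with rfl | h4
      · obtain rfl : k = 0 := by omega
        exact Or.inl (hAZ _ hA.head_mem hz)
      · have := hZ j h h4; tauto
  · intro hk1
    have hA2 := two hA (by rintro rfl; exact (hZ k (by omega) (by omega)).1 he₁)
    omega

end Paths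
end BipCyc

namespace BipCyc
open Finset
open scoped Classical

variable {V : Type*} {G : SimpleGraph V} {col : V → Bool} {c : ℤ → V} {t : ℕ}
  {H : Finset V}

lemma bool_eq_of_iff {a b d : Bool} (h : a = d ↔ b = d) : a = b := by
  revert h; revert a b d; decide

lemma Bad.reach (h : Bad G col c t H) {r q : V} (hr : r ∈ H) (hq : q ≠ r) :
    ∃ R i, Pth G R r (c i) ∧ q ∉ R ∧ ∀ v ∈ R, v ∈ H ∨ v = c i := by
  obtain ⟨z, hz, z', hz', hzq, hzH, hadj⟩ := h.escape
    {z ∈ H | ∃ R, Pth G R r z ∧ q ∉ R ∧ ∀ v ∈ R, v ∈ H} (Finset.filter_subset _ _)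
    ⟨r, by simp only [Finset.mem_filter]; exact ⟨hr, [r], .singleton r, by simpa using hq, by simpa using hr⟩⟩ q
  simp only [Finset.mem_filter] at hz hz'
  obtain ⟨hzH', R, hR, hqR, hRH⟩ := hz
  by_cases hzR : z' ∈ R
  · exfalso
    obtain ⟨l₁, l₂, rfl⟩ := List.append_of_mem hzR
    refine hz' ⟨hRH _ hzR, l₁ ++ [z'], hR.split.1, ?_, ?_⟩
    · intro hc; apply hqR; simp at hc ⊢; tauto
    · intro v hv; apply hRH; simp at hv ⊢; tauto
  have hR' := hR.append (.singleton z') hadj (by rintro v hv hv'; simp at hv'; subst hv'; exact hzR hv)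
  have hqR' : q ∉ R ++ [z'] := by simp [hqR, hzq.symm]
  rcases hzH with hzH | ⟨i, rfl⟩
  · exfalso
    refine hz' ⟨hzH, _, hR', hqR', ?_⟩
    intro v hv
    rcases List.mem_append.1 hv with hv | hv
    · exact hRH v hv
    · simp at hv; subst hv; exact hzH
  · refine ⟨_, i, hR', hqR', ?_⟩
    intro v hv
    rcases List.mem_append.1 hv with hv | hv
    · exact Or.inl (hRH v hv)
    · simp at hv; exact Or.inr hv

set_option maxHeartbeats 600000 in
/-- A path from `a` to the cycle that is long in terms of the degree of a closed vertex `x`. -/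
lemma Bad.exists_long_path (h : Bad G col c t H) {L : List V} {a x : V} (hL : Pth G L a x)
    (hax : a ≠ x) (hLH : ∀ v ∈ L, v ≠ a → v ∈ H) :
    ∃ F i, Pth G F a (c i) ∧ c i ≠ a ∧ (∀ v ∈ F, v ∈ H ∨ v = a ∨ v = c i) ∧
      2 * #{v ∈ L.toFinset | G.Adj x v} ≤ F.length ∧
      (¬ G.Adj x a → 2 * #{v ∈ L.toFinset | G.Adj x v} + 1 ≤ F.length) := by
  have hpos := hL.length_pos
  obtain ⟨l, hl⟩ : ∃ l, L.length = l + 1 := ⟨L.length - 1, by omega⟩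
  set p : ℕ → V := fun i => L.getD i x with hp
  have hpg : ∀ i (hi : i < L.length), p i = L[i] := by
    intro i hi; simp [hp, hi]
  have hp0 : p 0 = a := by
    have := hL.2.2.1
    rw [hpg 0 (by omega)]
    rw [List.head?_eq_getElem?, List.getElem?_eq_getElem (by omega)] at this
    exact Option.some.inj this
  have hpl : p l = x := by
    have := hL.2.2.2
    rw [hpg l (by omega)]
    rw [List.getLast?_eq_getElem?, List.getElem?_eq_getElem (by omega)] at this
    have := Option.some.inj this
    simpa [hl] using this
  have hinj : ∀ i ≤ l, ∀ j ≤ l, p i = p j → i = j := by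
    intro i hi j hj hij
    rw [hpg i (by omega), hpg j (by omega)] at hij
    exact (hL.2.1.getElem_inj_iff).1 hij
  have hadj : ∀ i < l, G.Adj (p i) (p (i + 1)) := by
    intro i hi
    rw [hpg i (by omega), hpg (i + 1) (by omega)]
    exact List.isChain_iff_getElem.1 hL.1 i (by omega)
  have hl1 : 1 ≤ l := by
    by_contra! hc
    obtain rfl : l = 0 := by omega
    exact hax (hp0.symm.trans hpl)
  have hpL : ∀ j ≤ l, p j ∈ L := fun j hj => by rw [hpg j (by omega)]; exact List.getElem_mem _
  have hpH : ∀ j ≤ l, 1 ≤ j → p j ∈ H := by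
    intro j hj h1
    refine hLH _ (hpL j hj) ?_
    rw [← hp0]
    intro hc
    have := hinj _ hj _ (by omega) hc
    omega
  have hpar : ∀ i < l, G.Adj (p l) (p i) → i % 2 ≠ l % 2 := by
    intro i hi hadj' he
    have := h.cyc.proper hadj'
    have h1 := h.cyc.col_getElem hL.1 (k := l) (by omega)
    have h2 := h.cyc.col_getElem hL.1 (k := i) (by omega)
    rw [← hpg _ (by omega)] at h1 h2
    have e : Even l ↔ Even i := by rw [Nat.even_iff, Nat.even_iff, he]
    exact this (bool_eq_of_iff (h1.trans (e.trans h2.symm)))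
  obtain ⟨k, hk, hmin⟩ := Finset.exists_min_image ({i ∈ range l | G.Adj (p l) (p i)} : Finset ℕ) id
    ⟨l - 1, by
      simp only [Finset.mem_filter, Finset.mem_range]
      have := hadj (l - 1) (by omega)
      rw [Nat.sub_add_cancel hl1] at this
      exact ⟨by omega, this.symm⟩⟩
  simp only [Finset.mem_filter, Finset.mem_range, id] at hk hmin
  have hmin : ∀ i < l, G.Adj (p l) (p i) → k ≤ i := fun i h1 h2 => hmin i ⟨h1, h2⟩
  have hcard : #{v ∈ L.toFinset | G.Adj x v} ≤ #{i ∈ range l | G.Adj (p l) (p i)} := by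
    refine le_trans (Finset.card_le_card (t := Finset.image p {i ∈ range l | G.Adj (p l) (p i)}) ?_)
      Finset.card_image_le
    intro w hw
    simp only [Finset.mem_filter, List.mem_toFinset] at hw
    obtain ⟨i, hi, hiw⟩ := List.getElem_of_mem hw.1
    rw [← hpg] at hiw
    subst hiw
    refine Finset.mem_image.2 ⟨i, ?_, rfl⟩
    simp only [Finset.mem_filter, Finset.mem_range]
    rw [hpl]
    refine ⟨?_, hw.2⟩
    by_contra! hc
    obtain rfl : i = l := by omega
    rw [hpl] at hw
    exact hw.2.ne rfl
  set U : V → Prop := fun v => v ∈ H ∨ v = a ∨ ∃ i, v = c i with hUdef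
  set S₁ : V → Prop := fun v => v = a
  set S₂ : V → Prop := fun v => v ≠ a ∧ ∃ i, v = c i
  have hU : ∀ j ≤ l, U (p j) := by
    intro j hj
    rcases Nat.eq_zero_or_pos j with rfl | h1
    · exact Or.inr (Or.inl hp0)
    · exact Or.inl (hpH j hj h1)
  have hS₂ : ∀ j ≤ l, ¬ S₂ (p j) := by
    intro j hj hc
    rcases Nat.eq_zero_or_pos j with rfl | h1
    · exact hc.1 hp0
    · obtain ⟨i, hi⟩ := hc.2
      exact h.out _ (hpH j hj h1) i hi
  have hZ : ∀ j ≤ l, 1 ≤ j → ¬ S₁ (p j) ∧ ¬ S₂ (p j) := by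
    intro j hj h1
    refine ⟨fun hc => ?_, hS₂ j hj⟩
    have := hinj j hj 0 (by omega) (hc.trans hp0.symm)
    omega
  have hreach : ∀ i < l, ∃ R s, Pth G R (p (i + 1)) s ∧ p i ∉ R ∧ (S₁ s ∨ S₂ s) ∧ ∀ v ∈ R, U v := by
    intro i hi
    obtain ⟨R, j, h1, h2, h3⟩ := h.reach (hpH (i + 1) hi (by omega)) (hadj i hi).ne
    refine ⟨R, c j, h1, h2, ?_, ?_⟩
    · by_cases hc : c j = a
      · exact Or.inl hc
      · exact Or.inr ⟨hc, j, rfl⟩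
    · intro v hv
      rcases h3 v hv with h | h
      · exact Or.inl h
      · exact Or.inr (Or.inr ⟨j, h⟩)
  have hkey : ∃ F s, Pth G F a s ∧ S₂ s ∧ (∀ v ∈ F, U v) ∧ (∀ v ∈ F, S₁ v ∨ S₂ v → v = a ∨ v = s) ∧
      2 * #{i ∈ range l | G.Adj (p l) (p i)} ≤ F.length ∧
      (1 ≤ k → 2 * #{i ∈ range l | G.Adj (p l) (p i)} + 1 ≤ F.length) := by
    rcases exists_conf hinj hadj (S₁ := S₁) (S₂ := S₂) (fun v => by rw [hp0]) hS₂ hU hreach hk.1 with hc | hc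
    · obtain ⟨F, s₁, s₂, k1, k2, k3, k4, k5, k6⟩ := hc.join hinj hadj hpar hk.2 hmin hU hZ
      rw [show s₁ = a from k2] at k1 k5
      exact ⟨F, s₂, k1, k3, k4, k5, k6⟩
    · obtain ⟨F, s₁, s₂, k1, k2, k3, k4, k5, k6⟩ := hc.join hinj hadj hpar hk.2 hmin hU
        (fun j h1 h2 => (hZ j h1 h2).symm)
      rw [show s₂ = a from k3] at k1 k5
      refine ⟨F.reverse, s₁, k1.reverse, k2, by simpa using k4, ?_, by simpa using k6⟩
      intro v hv hz
      exact (k5 v (List.mem_reverse.1 hv) hz.symm).symm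
  obtain ⟨F, s, k1, ⟨hsa, i, rfl⟩, k3, k4, k5, k6⟩ := hkey
  refine ⟨F, i, k1, hsa, ?_, by omega, ?_⟩
  · intro v hv
    rcases k3 v hv with hv' | hv' | hv'
    · exact Or.inl hv'
    · exact Or.inr (Or.inl hv')
    · by_cases hva : v = a
      · exact Or.inr (Or.inl hva)
      · exact Or.inr (k4 v hv (Or.inr ⟨hva, hv'⟩))
  · intro hxa
    have : 1 ≤ k := by
      by_contra! hc
      obtain rfl : k = 0 := by omega
      rw [hpl, hp0] at hk
      exact hxa hk.2
    have := k6 this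
    omega

lemma Pth.drop_last {F : List V} {a b : V} (hF : Pth G F a b) (hab : a ≠ b) :
    ∃ E b', F = E ++ [b] ∧ Pth G E a b' ∧ G.Adj b' b ∧ b ∉ E := by
  obtain ⟨E, rfl⟩ : ∃ E, F = E ++ [b] := List.getLast?_eq_some_iff.1 hF.2.2.2
  have hne : E ≠ [] := by
    rintro rfl
    have := hF.2.2.1
    simp at this
    exact hab this.symm
  have h1 := List.isChain_append.1 hF.1
  have h2 := List.nodup_append.1 hF.2.1
  have hl := List.getLast?_eq_some_getLast hne
  refine ⟨E, E.getLast hne, rfl, ⟨h1.1, h2.1, ?_, hl⟩,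
    h1.2.2 _ (by rw [hl]; rfl) _ (by simp), fun hb => h2.2.2 b hb b (by simp) rfl⟩
  have := hF.2.2.1
  cases E with
  | nil => exact absurd rfl hne
  | cons e E => simpa using this

/-- A path from `y` to the cycle, long in terms of the degree of a closed vertex `x`. -/
lemma Bad.exists_path_to_cycle (h : Bad G col c t H) {L : List V} {y x : V} (hL : Pth G L y x)
    (hyx : y ≠ x) (hLH : ∀ v ∈ L, v ∈ H) (hcl : ∀ w ∈ H, G.Adj x w → w ∈ L) (hxy : ¬ G.Adj x y) :
    ∃ E v i, Pth G E y v ∧ (∀ w ∈ E, w ∈ H) ∧ G.Adj v (c i) ∧ 2 * dH G H x ≤ E.length := by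
  obtain ⟨F, i, h1, h2, h3, -, h5⟩ := h.exists_long_path hL hyx (fun v hv _ => hLH v hv)
  have h5 := h5 hxy
  obtain ⟨E, v, rfl, k1, k2, k3⟩ := h1.drop_last h2.symm
  refine ⟨E, v, i, k1, ?_, k2, ?_⟩
  · intro w hw
    rcases h3 w (List.mem_append_left _ hw) with h | rfl | rfl
    · exact h
    · exact hLH _ hL.head_mem
    · exact absurd hw k3
  · have : dH G H x ≤ #{v ∈ L.toFinset | G.Adj x v} := by
      apply Finset.card_le_card
      intro w hw
      simp only [Finset.mem_filter, List.mem_toFinset] at hw ⊢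
      exact ⟨hcl w hw.1 hw.2, hw.2⟩
    simp at h5
    omega

lemma Bad.two_le_dg [Fintype V] (h : Bad G col c t H) {v : V} (hv : v ∈ H) :
    2 ≤ dg G c t H v := by
  have key : ∀ w, ∃ z', z' ≠ w ∧ (z' ∈ H ∨ ∃ i, z' = c i) ∧ G.Adj v z' := by
    intro w
    obtain ⟨z, hz, z', -, h2, h3, h4⟩ := h.escape {v} (by simpa using hv) (by simp) w
    obtain rfl := Finset.mem_singleton.1 hz
    exact ⟨z', h2, h3, h4⟩
  obtain ⟨z₁, -, h2, h3⟩ := key v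
  obtain ⟨z₂, k1, k2, k3⟩ := key z₁
  have h1 := card_nbr_cycle_le h.cyc v
  have h4 : #({z₁, z₂} : Finset V) ≤ #({w ∈ H | G.Adj v w} ∪
      ({w | G.Adj v w ∧ ∃ i, w = c i} : Finset V)) := by
    apply Finset.card_le_card
    intro w hw
    simp only [Finset.mem_insert, Finset.mem_singleton] at hw
    simp only [Finset.mem_union, Finset.mem_filter, Finset.mem_univ, true_and]
    rcases hw with rfl | rfl <;> tauto
  rw [Finset.card_pair k1.symm] at h4
  have := Finset.card_union_le {w ∈ H | G.Adj v w} ({w | G.Adj v w ∧ ∃ i, w = c i} : Finset V)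
  unfold dg dH
  omega

/-- An ear of the cycle, long in terms of the degree of a closed vertex `x`. -/
lemma Bad.exists_weak_ear [Fintype V] (h : Bad G col c t H) {L : List V} {v x : V}
    (hL : Pth G L v x) (hLH : ∀ w ∈ L, w ∈ H) {τ : ℤ} (hv : G.Adj v (c τ))
    (hcl : ∀ w ∈ H, G.Adj x w → w ∈ L) (hx : ∀ i, G.Adj x (c i) → (2 * t : ℤ) ∣ i - τ) :
    ∃ E a b i j, Pth G E a b ∧ (∀ w ∈ E, w ∈ H) ∧ G.Adj a (c i) ∧ G.Adj b (c j) ∧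
      ¬ (2 * t : ℤ) ∣ j - i ∧ 2 * dg G c t H x ≤ E.length + 2 ∧ 2 * dg G c t H x ≤ t + 1 := by
  have hxH := hLH _ hL.last_mem
  have hτL : c τ ∉ L := fun hc => h.out _ (hLH _ hc) τ rfl
  obtain ⟨F, j, h1, h2, h3, h4, -⟩ := h.exists_long_path (hL.cons hv.symm hτL)
    (fun hc => h.out _ hxH τ hc.symm) (fun w hw hne => hLH w ((List.mem_cons.1 hw).resolve_left hne))
  have hD : dg G c t H x ≤ #{w ∈ (c τ :: L).toFinset | G.Adj x w} := by
    have hsub : {w ∈ H | G.Adj x w} ⊆ {w ∈ (c τ :: L).toFinset | G.Adj x w} := by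
      intro w hw
      simp only [Finset.mem_filter, List.mem_toFinset, List.mem_cons] at hw ⊢
      exact ⟨Or.inr (hcl w hw.1 hw.2), hw.2⟩
    by_cases h0 : nC G c t x = 0
    · unfold dg dH
      rw [h0]
      exact Finset.card_le_card hsub
    · obtain ⟨i, hi⟩ := (nC_ne_zero h.cyc).1 h0
      have e : c i = c τ := by rw [h.cyc.inj, dvd_sub_comm]; exact hx i hi
      have := h.cyc.nC_le_one hx
      have h5 : insert (c τ) {w ∈ H | G.Adj x w} ⊆ {w ∈ (c τ :: L).toFinset | G.Adj x w} := by
        intro w hw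
        rcases Finset.mem_insert.1 hw with rfl | hw
        · simp [← e, hi]
        · exact hsub hw
      have h6 := Finset.card_le_card h5
      rw [Finset.card_insert_of_notMem (by
        simp only [Finset.mem_filter, not_and]
        intro hc; exact absurd rfl (h.out _ hc τ))] at h6
      unfold dg dH
      omega
  have h2dg := h.two_le_dg hxH
  obtain ⟨F', b, rfl, k1, k2, k3⟩ := h1.drop_last h2.symm
  have hbτ : b ≠ c τ := by
    rintro rfl
    have : F' = [c τ] := by
      obtain ⟨F'', rfl⟩ : ∃ E, F' = E ++ [c τ] := List.getLast?_eq_some_iff.1 k1.2.2.2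
      cases F'' with
      | nil => rfl
      | cons e F'' =>
        have h7 := k1.2.2.1
        have h8 := k1.2.1
        simp at h7 h8
        tauto
    subst this
    simp only [List.length_append, List.length_singleton] at h4
    omega
  obtain ⟨E', a, hE', g1, g2, g3⟩ := k1.reverse.drop_last hbτ
  obtain rfl : F' = c τ :: E'.reverse := by
    have := congrArg List.reverse hE'
    simpa using this
  have hEH : ∀ w ∈ E', w ∈ H := by
    intro w hw
    rcases h3 w (by simp [hw]) with h | rfl | rfl
    · exact h
    · exact absurd hw g3
    · simp only [List.mem_cons, List.mem_reverse, not_or] at k3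
      exact absurd hw k3.2
  have hne : ¬ (2 * t : ℤ) ∣ j - τ := by
    rw [← h.cyc.inj]; exact h2.symm
  simp only [List.length_append, List.length_nil, List.length_cons, List.length_reverse] at h4
  refine ⟨E', b, a, j, τ, g1, hEH, k2, g2, by rwa [dvd_sub_comm], by omega, ?_⟩
  have ho : Out c E' := fun w hw => h.out w (hEH w hw)
  have ht := h.cyc.two_le
  obtain ⟨j', e1, e2, e3, e4⟩ := (h.cyc.per b).exists_window (by omega) k2 τ
  push_cast at e2 e4
  have hjτ : τ ≠ j' := by
    rintro rfl
    exact hne (by rwa [dvd_sub_comm])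
  have f1 := h.cyc.ear g1.reverse ho.reverse g2 e3 (by omega) e2
  have f2 := h.cyc.ear g1 ho e3 (j := τ + 2 * t) (by rwa [h.cyc.periodic]) (by omega) (by omega)
  simp only [List.length_reverse] at f1
  omega

end BipCyc

namespace BipCyc
open Finset
open scoped Classical

section
variable {V : Type*}

lemma sum_pairs_le {φ : V → ℕ} {M : ℕ} (q : ℕ) {L : List V} (hl : L.length = 2 * q)
    (h : ∀ l₁ a b l₂, L = l₁ ++ a :: b :: l₂ → Even l₁.length → φ a + φ b ≤ M) :
    (L.map φ).sum ≤ q * M := by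
  induction q generalizing L with
  | zero =>
    obtain rfl : L = [] := List.length_eq_zero_iff.1 hl
    simp
  | succ q ih =>
    match L, hl with
    | a :: b :: l, hl =>
      have h1 := h [] a b l rfl (by simp)
      have h2 := ih (L := l) (by simp at hl; omega) (by
        intro l₁ a' b' l₂ he hev
        subst he
        refine h (a :: b :: l₁) a' b' l₂ rfl ?_
        simp only [List.length_cons]
        rw [Nat.even_iff] at hev ⊢
        omega)
      simp only [List.map_cons, List.sum_cons]
      rw [Nat.succ_mul]
      omega
    | [], hl => simp at hl
    | [a], hl => simp at hl; omega

end

variable {V : Type*} {G : SimpleGraph V} {col : V → Bool} {c : ℤ → V} {t : ℕ}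
  {H : Finset V}

/-- A path from `x` to `y` in `H` whose complement in `H` is perfectly matched. -/
structure Cfg (G : SimpleGraph V) (col : V → Bool) (H : Finset V) (L : List V) (x y : V) : Prop where
  pth : Pth G L x y
  sub : ∀ v ∈ L, v ∈ H
  hx : col x = true
  hy : col y = false
  mat : ∃ g : V → V, ∀ v ∈ H, v ∉ L → g v ∈ H ∧ g v ∉ L ∧ G.Adj v (g v) ∧ g (g v) = v

lemma Cfg.swap {L : List V} {x y : V} (h : Cfg G col H L x y) :
    Cfg G (fun v => !col v) H L.reverse y x :=
  ⟨h.pth.reverse, by simpa using h.sub, by simp [h.hy], by simp [h.hx], by simpa using h.mat⟩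

lemma Cfg.congr {L L' : List V} {x y x' y' : V} (h : Cfg G col H L x y) (hp : Pth G L' x' y')
    (hm : ∀ v, v ∈ L' ↔ v ∈ L) (hx' : col x' = true) (hy' : col y' = false) :
    Cfg G col H L' x' y' :=
  ⟨hp, fun v hv => h.sub v ((hm v).1 hv), hx', hy', by simpa [hm] using h.mat⟩

/-- `n` bounds the length of all configurations. -/
def Top (G : SimpleGraph V) (col : V → Bool) (H : Finset V) (n : ℕ) : Prop :=
  ∀ L x y, Cfg G col H L x y → L.length ≤ n

lemma Top.swap {n : ℕ} (h : Top G col H n) : Top G (fun v => !col v) H n := by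
  intro L x y hc
  have := h L.reverse y x (by simpa using hc.swap)
  simpa using this

lemma Cfg.closed_left {L : List V} {x y : V} (hG : BipCycle G col c t) (h : Cfg G col H L x y)
    (ht : Top G col H L.length) : ∀ w ∈ H, G.Adj x w → w ∈ L := by
  intro w hw hxw
  by_contra hwL
  obtain ⟨g, hg⟩ := h.mat
  obtain ⟨g1, g2, g3, g4⟩ := hg w hw hwL
  have hc1 := hG.proper hxw
  have hc2 := hG.proper g3
  rw [h.hx] at hc1
  have hP : Pth G (g w :: w :: L) (g w) y :=
    (h.pth.cons hxw.symm hwL).cons g3.symm (by simp [g3.ne', g2])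
  have := ht _ _ _ (⟨hP, by simp [g1, hw]; exact h.sub, by
      cases e1 : col w <;> cases e2 : col (g w) <;> simp_all, h.hy, g, by
      intro v hv hvL
      simp only [List.mem_cons, not_or] at hvL
      obtain ⟨k1, k2, k3, k4⟩ := hg v hv hvL.2.2
      refine ⟨k1, ?_, k3, k4⟩
      simp only [List.mem_cons, not_or]
      refine ⟨?_, ?_, k2⟩
      · intro e
        have := congrArg g e
        rw [k4, g4] at this
        exact hvL.2.1 this
      · intro e
        apply hvL.1
        rw [← e, k4]⟩ : Cfg G col H (g w :: w :: L) (g w) y)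
  simp at this

lemma Cfg.closed_right {L : List V} {x y : V} (hG : BipCycle G col c t) (h : Cfg G col H L x y)
    (ht : Top G col H L.length) : ∀ w ∈ H, G.Adj y w → w ∈ L := by
  intro w hw hyw
  simpa using h.swap.closed_left hG.swap (by simpa using ht.swap) w hw hyw

lemma Cfg.rotate {l₁ r : List V} {w b x y : V} (h : Cfg G col H (l₁ ++ w :: b :: r) x y)
    (hG : BipCycle G col c t) (hyw : G.Adj y w) :
    Cfg G col H (l₁ ++ w :: (b :: r).reverse) x b := by
  have h1 := h.pth.split
  have h2 : Pth G (b :: r) b y := (Pth.split (l₁ := [w]) h1.2).2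
  have hnd := h.pth.2.1
  have hp := h1.1.append h2.reverse hyw.symm (by
    intro v hv hv'
    rw [List.mem_reverse] at hv'
    have : (l₁ ++ [w] ++ (b :: r)).Nodup := by simpa using hnd
    exact (List.nodup_append.1 this).2.2 v hv v hv' rfl)
  refine h.congr (by simpa using hp) (by simp; tauto) h.hx ?_
  have e1 := hG.proper hyw
  have h3 := h1.2.1
  simp only [List.isChain_cons_cons] at h3
  have e2 := hG.proper h3.1
  rw [h.hy] at e1
  cases e3 : col w <;> cases e4 : col b <;> simp_all

lemma Cfg.even {L : List V} {x y : V} (hG : BipCycle G col c t) (h : Cfg G col H L x y) :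
    ∃ q, 1 ≤ q ∧ L.length = 2 * q := by
  have hpos := h.pth.length_pos
  have h1 := hG.col_getElem h.pth.1 (k := L.length - 1) (by omega)
  have h2 := h.pth.2.2.1
  have h3 := h.pth.2.2.2
  rw [List.head?_eq_getElem?, List.getElem?_eq_getElem (by omega)] at h2
  rw [List.getLast?_eq_getElem?, List.getElem?_eq_getElem (by omega)] at h3
  rw [Option.some.inj h2, Option.some.inj h3, h.hx, h.hy] at h1
  simp only [Bool.false_eq_true, false_iff, Nat.not_even_iff] at h1
  exact ⟨L.length / 2, by omega, by omega⟩

lemma Cfg.col_split {L l₁ l₂ : List V} {x y a : V} (hG : BipCycle G col c t)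
    (h : Cfg G col H L x y) (hL : L = l₁ ++ a :: l₂) : col a = true ↔ Even l₁.length := by
  subst hL
  have h1 := hG.col_getElem h.pth.1 (k := l₁.length) (by simp)
  have h2 := h.pth.2.2.1
  rw [List.head?_eq_getElem?, List.getElem?_eq_getElem (by simp)] at h2
  rw [Option.some.inj h2, h.hx] at h1
  rw [← h1]
  simp

lemma Cfg.not_nz_nz [Fintype V] {L : List V} {x y : V} (hB : Bad G col c t H) (h : Cfg G col H L x y)
    (ht : Top G col H L.length) (hx : nC G c t x ≠ 0) (hy : nC G c t y ≠ 0) : False := by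
  obtain ⟨q, hq, hl⟩ := h.even hB.cyc
  have h1 := hB.cyc.even_path_le h.pth (fun v hv => hB.out v (h.sub v hv)) h.hx h.hy hq hl hx hy
  have h2 := hB.cyc.two_dH_le h.pth (h.closed_left hB.cyc ht)
  have h3 := hB.cyc.two_dH_le h.pth.reverse (H := H)
    (by simpa using h.closed_right hB.cyc ht)
  have h4 := hB.pair x (h.sub _ h.pth.head_mem) y (h.sub _ h.pth.last_mem) h.hx h.hy
  rw [List.length_reverse] at h3
  unfold dg at h4
  omega

lemma Cfg.card_col {L : List V} {x y : V} (hG : BipCycle G col c t) (h : Cfg G col H L x y) {q : ℕ}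
    (hl : L.length = 2 * q) (b : Bool) : #{v ∈ L.toFinset | col v = b} = q := by
  have key : ∀ b, #{v ∈ L.toFinset | col v = b} ≤ q := by
    intro b
    rw [Finset.card_filter, List.sum_toFinset _ h.pth.2.1]
    refine (sum_pairs_le (M := 1) q hl ?_).trans (by omega)
    rintro l₁ u v l₂ rfl -
    have := h.pth.split.2.1
    simp only [List.isChain_cons_cons] at this
    have := hG.proper this.1
    cases b <;> cases e1 : col u <;> cases e2 : col v <;> simp_all
  have h1 := key b
  have h2 := key (!b)
  have h3 := Finset.card_filter_add_card_filter_not (s := L.toFinset) (fun v => col v = b)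
  rw [List.toFinset_card_of_nodup h.pth.2.1, hl] at h3
  have : ({v ∈ L.toFinset | ¬ col v = b} : Finset V) = {v ∈ L.toFinset | col v = !b} := by
    apply Finset.filter_congr
    intro v _
    cases b <;> simp
  rw [this] at h3
  omega

lemma Cfg.le_t {L : List V} {x y : V} (hB : Bad G col c t H) (h : Cfg G col H L x y) {q : ℕ}
    (hl : L.length = 2 * q) : q ≤ t := by
  rw [← h.card_col hB.cyc hl true]
  refine (Finset.card_le_card ?_).trans hB.small
  intro v hv
  simp only [Finset.mem_filter, List.mem_toFinset] at hv ⊢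
  exact ⟨h.sub v hv.1, hv.2⟩

lemma Cfg.cut {L l₁ l₂ : List V} {x y a b : V} (hG : BipCycle G col c t) (h : Cfg G col H L x y)
    (hyx : G.Adj y x) (hL : L = l₁ ++ a :: b :: l₂) :
    ∃ K, K.length = L.length ∧ (∀ v, v ∈ K ↔ v ∈ L) ∧ (Cfg G col H K a b ∨ Cfg G col H K b a) := by
  subst hL
  have h1 := h.pth.split
  have hab : G.Adj a b := by
    have := h1.2.1
    simp only [List.isChain_cons_cons] at this
    exact this.1
  have h2 : Pth G (b :: l₂) b y := (Pth.split (l₁ := [a]) h1.2).2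
  have hnd := h.pth.2.1
  have hp := h2.append h1.1 hyx (by
    intro v hv hv'
    have : (l₁ ++ [a] ++ (b :: l₂)).Nodup := by simpa using hnd
    exact (List.nodup_append.1 this).2.2 v hv' v hv rfl)
  have hm : ∀ v, v ∈ (b :: l₂) ++ (l₁ ++ [a]) ↔ v ∈ l₁ ++ a :: b :: l₂ := by
    intro v; simp; tauto
  have hc := hG.proper hab
  by_cases hb : col b = true
  · refine ⟨_, by simp; omega, hm, Or.inr (h.congr hp hm hb ?_)⟩
    rw [hb] at hc; simpa using hc
  · refine ⟨((b :: l₂) ++ (l₁ ++ [a])).reverse, by simp; omega, fun v => List.mem_reverse.trans (hm v),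
      Or.inl (h.congr hp.reverse (fun v => List.mem_reverse.trans (hm v)) ?_ (by simpa using hb))⟩
    rw [Bool.not_eq_true] at hb
    rw [hb] at hc; simpa using hc

lemma Cfg.ham_closed {L : List V} {x y : V} (hG : BipCycle G col c t) (h : Cfg G col H L x y)
    (ht : Top G col H L.length) (hyx : G.Adj y x) {v : V} (hv : v ∈ L) :
    ∀ w ∈ H, G.Adj v w → w ∈ L := by
  intro w hw hvw
  obtain ⟨l₁, l₂, hL⟩ := List.append_of_mem hv
  cases l₂ with
  | nil =>
    have h1 := h.pth.2.2.2
    rw [hL] at h1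
    simp at h1
    subst h1
    exact h.closed_right hG ht w hw hvw
  | cons b l₂ =>
    obtain ⟨K, k1, k2, k3⟩ := h.cut hG hyx hL
    rw [← k1] at ht
    rcases k3 with k3 | k3
    · exact (k2 w).1 (k3.closed_left hG ht w hw hvw)
    · exact (k2 w).1 (k3.closed_right hG ht w hw hvw)

lemma Pth.ham_path {L : List V} {x y v w : V} (h : Pth G L x y) (hyx : G.Adj y x) {q : ℕ}
    (hl : L.length = 2 * q) (hv : v ∈ L) (hw : w ∈ L) (hvw : v ≠ w) :
    ∃ E, Pth G E v w ∧ (∀ u ∈ E, u ∈ L) ∧ q + 1 ≤ E.length := by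
  have key : ∀ {v w l₁ l₂}, L = l₁ ++ v :: l₂ → w ∈ l₂ →
      ∃ E, Pth G E v w ∧ (∀ u ∈ E, u ∈ L) ∧ q + 1 ≤ E.length := by
    rintro v w l₁ l₂ rfl hw
    obtain ⟨l₃, l₄, rfl⟩ := List.append_of_mem hw
    have h1 := h.split
    have h2 : Pth G (v :: l₃ ++ [w]) v w ∧ Pth G (w :: l₄) w y := Pth.split (l₁ := v :: l₃) h1.2
    have hnd : (l₁ ++ [v] ++ (l₃ ++ w :: l₄)).Nodup := by simpa using h.2.1
    have h3 := h1.1.reverse.append h2.2.reverse hyx.symm (by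
      intro u hu hu'
      rw [List.mem_reverse] at hu hu'
      exact (List.nodup_append.1 hnd).2.2 u hu u (List.mem_append_right _ hu') rfl)
    by_cases hlen : q + 1 ≤ (v :: l₃ ++ [w]).length
    · exact ⟨_, h2.1, by intro u; simp; tauto, hlen⟩
    · refine ⟨_, h3, by intro u; simp; tauto, ?_⟩
      simp at hl hlen ⊢
      omega
  obtain ⟨l₁, l₂, hL⟩ := List.append_of_mem hv
  have hw' := hw
  rw [hL] at hw'
  rcases List.mem_append.1 hw' with h1 | h1
  · obtain ⟨l₃, l₄, rfl⟩ := List.append_of_mem h1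
    obtain ⟨E, e1, e2, e3⟩ := key (v := w) (w := v) (l₁ := l₃) (l₂ := l₄ ++ v :: l₂) (by simpa using hL)
      (by simp)
    exact ⟨E.reverse, e1.reverse, by simpa using e2, by simpa using e3⟩
  · exact key hL ((List.mem_cons.1 h1).resolve_left hvw.symm)

lemma Cfg.not_ham [Fintype V] {L : List V} {x y : V} (hB : Bad G col c t H) (h : Cfg G col H L x y)
    (ht : Top G col H L.length) (hyx : G.Adj y x) : False := by
  have hG := hB.cyc
  obtain ⟨q, hq, hl⟩ := h.even hG
  have hqt := h.le_t hB hl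
  have hcl : ∀ v ∈ L, ∀ w ∈ H, G.Adj v w → w ∈ L := fun v hv => h.ham_closed hG ht hyx hv
  have hsub : L.toFinset ⊆ H := fun v hv => h.sub v (List.mem_toFinset.1 hv)
  have hLne : L.toFinset.Nonempty := ⟨x, List.mem_toFinset.2 h.pth.head_mem⟩
  have hnC : ∀ v ∈ L, nC G c t v ≤ t - q := by
    intro v hv
    by_cases h0 : nC G c t v = 0
    · omega
    obtain ⟨i, hi⟩ := (nC_ne_zero hG).1 h0
    have key : ∃ z ∈ L, z ≠ v ∧ ∃ τ k, G.Adj z (c τ) ∧ G.Adj v (c k) ∧ ¬ (2 * t : ℤ) ∣ k - τ := by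
      obtain ⟨z, hz, z', k1, k2, k3, k4⟩ := hB.escape L.toFinset hsub hLne (c i)
      rw [List.mem_toFinset] at hz k1
      obtain ⟨j, rfl⟩ := k3.resolve_left (fun hc => k1 (hcl z hz _ hc k4))
      rw [Ne, hG.inj] at k2
      by_cases hzv : z = v
      · subst hzv
        have hne : (L.toFinset.erase z).Nonempty := by
          have : 1 < #L.toFinset := by rw [List.toFinset_card_of_nodup h.pth.2.1]; omega
          obtain ⟨w, hw, hwz⟩ := Finset.exists_mem_ne this z
          exact ⟨w, Finset.mem_erase.2 ⟨hwz, hw⟩⟩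
        obtain ⟨z₂, hz₂, z', m1, m2, m3, m4⟩ := hB.escape (L.toFinset.erase z)
          ((Finset.erase_subset _ _).trans hsub) hne z
        simp only [Finset.mem_erase, List.mem_toFinset] at hz₂ m1
        obtain ⟨τ, rfl⟩ := m3.resolve_left (fun hc => m1 ⟨m2, hcl z₂ hz₂.2 _ hc m4⟩)
        refine ⟨z₂, hz₂.2, hz₂.1, ?_⟩
        by_cases hd : (2 * t : ℤ) ∣ i - τ
        · refine ⟨τ, j, m4, k4, fun hd' => k2 ?_⟩
          have := dvd_sub hd hd'
          simpa using this
        · exact ⟨τ, i, m4, hi, hd⟩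
      · exact ⟨z, hz, hzv, j, i, k4, hi, k2⟩
    obtain ⟨z, hz, hzv, τ, k, hτ, hk, hne⟩ := key
    obtain ⟨E, e1, e2, e3⟩ := h.pth.ham_path hyx hl hv hz hzv.symm
    have := hG.nC_add_length_le e1 (fun w hw => hB.out w (h.sub w (e2 w hw))) hτ hk hne
    omega
  have hsum : (L.map (nC G c t)).sum ≤ q * (t - q) := by
    refine sum_pairs_le q hl ?_
    intro l₁ a b l₂ hL _
    have ha := hnC a (by rw [hL]; simp)
    have hb := hnC b (by rw [hL]; simp)
    obtain ⟨K, k1, k2, k3⟩ := h.cut hG hyx hL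
    have ht' := ht
    rw [← k1] at ht'
    by_cases ha0 : nC G c t a = 0
    · omega
    by_cases hb0 : nC G c t b = 0
    · omega
    rcases k3 with k3 | k3
    · exact (k3.not_nz_nz hB ht' ha0 hb0).elim
    · exact (k3.not_nz_nz hB ht' hb0 ha0).elim
  have h1 := h.card_col hG hl true
  have h2 := h.card_col hG hl false
  have := hB.chunk L.toFinset hsub hLne (h1.trans h2.symm) (by
    intro z hz z' hz' hzz
    rw [List.mem_toFinset] at hz ⊢
    exact hcl z hz z' hz' hzz)
  rw [h1, List.sum_toFinset _ h.pth.2.1] at this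
  obtain ⟨s, rfl⟩ := Nat.exists_eq_add_of_le hqt
  rw [Nat.add_sub_cancel_left] at hsum
  nlinarith

lemma Cfg.dH_add_le [Fintype V] {L : List V} {x y : V} (hB : Bad G col c t H)
    (h : Cfg G col H L x y) (ht : Top G col H L.length) {q : ℕ} (hl : L.length = 2 * q) :
    dH G H x + dH G H y ≤ q := by
  have hG := hB.cyc
  have aux : ∀ z, (∀ w ∈ H, G.Adj z w → w ∈ L) →
      dH G H z ≤ (L.map fun v => if G.Adj z v then 1 else 0).sum := by
    intro z hz
    rw [← List.sum_toFinset _ h.pth.2.1, ← Finset.card_filter]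
    apply Finset.card_le_card
    intro w hw
    simp only [Finset.mem_filter, List.mem_toFinset] at hw ⊢
    exact ⟨hz w hw.1 hw.2, hw.2⟩
  have h1 := aux x (h.closed_left hG ht)
  have h2 := aux y (h.closed_right hG ht)
  have h3 := sum_pairs_le (M := 1)
    (φ := fun v => (if G.Adj x v then 1 else 0) + (if G.Adj y v then 1 else 0)) q hl (by
    rintro l₁ a b l₂ hL hev
    have ca : col a = true := (h.col_split hG hL).2 hev
    have cb : col b = false := by
      have := (h.col_split hG (l₁ := l₁ ++ [a]) (a := b) (l₂ := l₂) (by simpa using hL)).not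
      rw [← Bool.not_eq_true]
      rw [this]
      simp [Nat.even_add_one, hev]
    have n1 : ¬ G.Adj x a := fun hc => hG.proper hc (by rw [h.hx, ca])
    have n2 : ¬ G.Adj y b := fun hc => hG.proper hc (by rw [h.hy, cb])
    have n3 : ¬ (G.Adj x b ∧ G.Adj y a) := by
      rintro ⟨hxb, hya⟩
      have h' := h
      rw [hL] at h'
      have hr := h'.rotate hG hya
      refine hr.not_ham hB ?_ hxb.symm
      have e : (l₁ ++ a :: (b :: l₂).reverse).length = L.length := by
        rw [hL]; simp
      rwa [e]
    simp only [n1, n2, if_false]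
    split_ifs <;> simp_all)
  rw [List.sum_map_add] at h3
  omega

lemma Cfg.not_zero_zero [Fintype V] {L : List V} {x y : V} (hB : Bad G col c t H)
    (h : Cfg G col H L x y) (ht : Top G col H L.length) (hx : nC G c t x = 0)
    (hy : nC G c t y = 0) : False := by
  obtain ⟨q, hq, hl⟩ := h.even hB.cyc
  have h1 := h.dH_add_le hB ht hl
  have h2 := h.le_t hB hl
  have h4 := hB.pair x (h.sub _ h.pth.head_mem) y (h.sub _ h.pth.last_mem) h.hx h.hy
  unfold dg at h4
  omega

lemma Cfg.not_zero_nz [Fintype V] {L : List V} {x y : V} (hB : Bad G col c t H)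
    (h : Cfg G col H L x y) (ht : Top G col H L.length) (hx : nC G c t x = 0)
    (hy : nC G c t y ≠ 0) : False := by
  have hG := hB.cyc
  obtain ⟨q, hq, hl⟩ := h.even hG
  have h1 := h.dH_add_le hB ht hl
  have h2 := h.le_t hB hl
  have hxH := h.sub _ h.pth.head_mem
  have h4 := hB.pair x hxH y (h.sub _ h.pth.last_mem) h.hx h.hy
  have hxy : x ≠ y := by
    rintro rfl
    have := h.hx.symm.trans h.hy
    simp at this
  have hnxy : ¬ G.Adj x y := fun hc => h.not_ham hB ht hc.symm
  have ho : ∀ {E : List V}, (∀ v ∈ E, v ∈ H) → Out c E := fun hE v hv => hB.out v (hE v hv)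
  have far : ∀ τ : ℤ, ∃ i, G.Adj y (c i) ∧ ¬ (2 * t : ℤ) ∣ i - τ := by
    intro τ
    by_contra! hcon
    have := hG.nC_le_one hcon
    unfold dg at h4
    omega
  rcases Nat.lt_or_ge (dH G H x) (dH G H y) with hlt | hge
  · obtain ⟨l₁, w, l₂, e1, e2, e3, e4, -⟩ := hG.exists_farthest h.pth.reverse (H := H)
      (by simpa using h.closed_right hG ht) (by omega)
    have hL : L = l₂.reverse ++ w :: l₁.reverse := by
      have := congrArg List.reverse e1
      simpa using this
    cases hr : l₁.reverse with
    | nil =>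
      obtain rfl : l₁ = [] := by simpa using hr
      simp at hL
      have := h.pth.2.2.2
      rw [hL] at this
      simp at this
      subst this
      exact e2.ne rfl
    | cons b r =>
      rw [hr] at hL
      have h' := h
      rw [hL] at h'
      have hrot := h'.rotate hG e2
      have ht' : Top G col H (l₂.reverse ++ w :: (b :: r).reverse).length := by
        have e : (l₂.reverse ++ w :: (b :: r).reverse).length = L.length := by
          rw [hL]; simp
        rwa [e]
      by_cases hb0 : nC G c t b = 0
      · exact hrot.not_zero_zero hB ht' hx hb0
      · obtain ⟨τ, hτ⟩ := (nC_ne_zero hG).1 hb0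
        obtain ⟨i, hi, hne⟩ := far τ
        have hp : Pth G (b :: r) b y :=
          (Pth.split (l₁ := l₂.reverse ++ [w]) (l₂ := r) (v := b) (by simpa using h'.pth)).2
        have := hG.nC_add_length_le hp.reverse
          (ho fun v hv => h'.sub v (by simp at hv ⊢; tauto)) hτ hi hne
        have hlen := congrArg List.length hr
        simp at this hlen
        unfold dg at h4
        omega
  · obtain ⟨E, v, i, k1, k2, k3, k4⟩ := hB.exists_path_to_cycle h.pth.reverse hxy.symm
      (by simpa using h.sub) (by simpa using h.closed_left hG ht) hnxy
    obtain ⟨j, hj, hne⟩ := far i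
    have := hG.nC_add_length_le k1 (ho k2) k3 hj hne
    unfold dg at h4
    omega

lemma Cfg.false [Fintype V] {L : List V} {x y : V} (hB : Bad G col c t H)
    (h : Cfg G col H L x y) (ht : Top G col H L.length) : False := by
  by_cases hx : nC G c t x = 0 <;> by_cases hy : nC G c t y = 0
  · exact h.not_zero_zero hB ht hx hy
  · exact h.not_zero_nz hB ht hx hy
  · refine h.swap.not_zero_nz hB.swap (by simpa using ht.swap) ?_ ?_
    · rwa [hB.cyc.nC_swap]
    · rwa [hB.cyc.nC_swap]
  · exact h.not_nz_nz hB ht hx hy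

lemma Bad.false_of_matching [Fintype V] (hB : Bad G col c t H) {f : V → V}
    (hf : Set.InjOn f ({v ∈ H | col v = true} : Finset V))
    (hf' : ∀ x ∈ ({v ∈ H | col v = true} : Finset V), f x ∈ H ∧ G.Adj x (f x)) : False := by
  have hG := hB.cyc
  have hcf : ∀ x ∈ ({v ∈ H | col v = true} : Finset V), col (f x) = false := by
    intro x hx
    have := hG.proper (hf' x hx).2
    rw [(Finset.mem_filter.1 hx).2] at this
    simpa using this.symm
  have himg : ({v ∈ H | col v = true} : Finset V).image f = ({v ∈ H | col v = false} : Finset V) := by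
    apply Finset.eq_of_subset_of_card_le
    · intro y hy
      obtain ⟨x, hx, rfl⟩ := Finset.mem_image.1 hy
      exact Finset.mem_filter.2 ⟨(hf' x hx).1, hcf x hx⟩
    · rw [Finset.card_image_of_injOn hf, hB.bal]
  have hex : ∀ y, ∃ x, y ∈ H → col y = false → x ∈ ({v ∈ H | col v = true} : Finset V) ∧ f x = y := by
    intro y
    by_cases hy : y ∈ H ∧ col y = false
    · have : y ∈ ({v ∈ H | col v = true} : Finset V).image f := by
        rw [himg]; exact Finset.mem_filter.2 hy
      obtain ⟨x, h1, h2⟩ := Finset.mem_image.1 this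
      exact ⟨x, fun _ _ => ⟨h1, h2⟩⟩
    · exact ⟨y, fun h1 h2 => absurd ⟨h1, h2⟩ hy⟩
  choose k hk using hex
  set g : V → V := fun v => if col v = true then f v else k v with hg
  have hg1 : ∀ v ∈ H, g v ∈ H ∧ G.Adj v (g v) ∧ g (g v) = v := by
    intro v hv
    by_cases hc : col v = true
    · have hv' : v ∈ ({v ∈ H | col v = true} : Finset V) := Finset.mem_filter.2 ⟨hv, hc⟩
      have e : g v = f v := by simp [hg, hc]
      obtain ⟨h1, h2⟩ := hf' v hv'
      obtain ⟨h3, h4⟩ := hk (f v) h1 (hcf v hv')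
      rw [e]
      refine ⟨h1, h2, ?_⟩
      have e' : g (f v) = k (f v) := by simp [hg, hcf v hv']
      rw [e']
      exact hf h3 hv' h4
    · have hc' : col v = false := by simpa using hc
      have e : g v = k v := by simp [hg, hc']
      obtain ⟨h3, h4⟩ := hk v hv hc'
      obtain ⟨h1, h2⟩ := hf' _ h3
      rw [h4] at h2
      have h5 := Finset.mem_filter.1 h3
      rw [e]
      refine ⟨h5.1, h2.symm, ?_⟩
      simp [hg, h5.2, h4]
  have hstart : ∃ L x y, Cfg G col H L x y := by
    have : ({v ∈ H | col v = true} : Finset V).Nonempty := by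
      rw [← Finset.card_pos]
      have h1 := Finset.card_filter_add_card_filter_not (s := H) (fun v => col v = true)
      simp only [Bool.not_eq_true] at h1
      have h2 := hB.bal
      have h3 := Finset.card_pos.2 hB.ne
      omega
    obtain ⟨x, hx⟩ := this
    obtain ⟨h1, h2⟩ := hf' x hx
    obtain ⟨hxH, hxc⟩ := Finset.mem_filter.1 hx
    refine ⟨[x, f x], x, f x, (Pth.singleton (f x)).cons h2 (by simpa using h2.ne),
      by simp [hxH, h1], hxc, hcf x hx, g, ?_⟩
    intro v hv hvL
    obtain ⟨g1, g2, g3⟩ := hg1 v hv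
    refine ⟨g1, ?_, g2, g3⟩
    have e : g x = f x := by simp [hg, hxc]
    have e2 := (hg1 x hxH).2.2
    simp only [List.mem_cons, List.not_mem_nil, or_false, not_or] at hvL ⊢
    constructor
    · intro hc; rw [hc] at g3; exact hvL.2 (g3.symm.trans e)
    · intro hc; rw [hc, ← e, e2] at g3; exact hvL.1 g3.symm
  have hbound : ∀ L x y, Cfg G col H L x y → L.length ≤ #H := by
    intro L x y h
    rw [← List.toFinset_card_of_nodup h.pth.2.1]
    exact Finset.card_le_card fun v hv => h.sub v (List.mem_toFinset.1 hv)
  obtain ⟨L₀, x₀, y₀, h₀⟩ := hstart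
  obtain ⟨L, x, y, h1, h2⟩ := Nat.findGreatest_spec (P := fun n => ∃ L x y, Cfg G col H L x y ∧ L.length = n)
    (hbound _ _ _ h₀) ⟨L₀, x₀, y₀, h₀, rfl⟩
  refine h1.false hB ?_
  intro L' x' y' h'
  rw [h2]
  exact Nat.le_findGreatest (hbound _ _ _ h') ⟨L', x', y', h', rfl⟩

end BipCyc

namespace BipCyc
open Finset
open scoped Classical

variable {V : Type*} [Fintype V] {G : SimpleGraph V} {col : V → Bool} {c : ℤ → V} {t : ℕ}
  {H : Finset V}

/-- A vertex whose degree is bounded through an ear of the cycle. -/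
def Weak (G : SimpleGraph V) (c : ℤ → V) (t : ℕ) (H : Finset V) (x : V) : Prop :=
  ∃ E a b i j, Pth G E a b ∧ (∀ w ∈ E, w ∈ H) ∧ G.Adj a (c i) ∧ G.Adj b (c j) ∧
    ¬ (2 * t : ℤ) ∣ j - i ∧ 2 * dg G c t H x ≤ E.length + 2 ∧ 2 * dg G c t H x ≤ t + 1

/-- A closed path through `R` and its neighbourhood whose ends both see the cycle. -/
def Strong (G : SimpleGraph V) (c : ℤ → V) (t : ℕ) (H R : Finset V) (x : V) : Prop :=
  ∃ P p x' u v, Pth G P x x' ∧ P.length = 2 * p + 1 ∧ (∀ w ∈ P, w ∈ R ∨ w ∈ nb G H R) ∧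
    x' ∈ R ∧ (∀ w ∈ H, G.Adj x w → w ∈ P) ∧ (∀ w ∈ H, G.Adj x' w → w ∈ P) ∧
    G.Adj x (c u) ∧ G.Adj x' (c v) ∧ ¬ (2 * t : ℤ) ∣ v - u

omit [Fintype V] in
lemma Crit.mem_of {b : Bool} {R : Finset V} (h : Crit G col H b R) {w : V}
    (hw : w ∈ R ∨ w ∈ nb G H R) : w ∈ H :=
  hw.elim (fun hw => h.sub hw) (fun hw => (mem_nb.1 hw).1)

lemma Crit.witness_of_adj {b : Bool} {R : Finset V} (h : Crit G col H b R) (hB : Bad G col c t H)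
    {x₁ : V} (hx₁ : x₁ ∈ R) {τ : ℤ} (hτ : G.Adj x₁ (c τ)) :
    ∃ x ∈ R, Weak G c t H x ∨ Strong G c t H R x := by
  have hG := hB.cyc
  obtain ⟨g, hg⟩ := h.exists_mat hx₁
  obtain ⟨M, x₂, m1, m2, m3, m4, m5, m6⟩ := h.extend hG (.singleton x₁) hx₁ hg
  have hM : ∀ w ∈ M ++ [x₁], w ∈ R ∨ w ∈ nb G H R := by
    intro w hw
    rw [List.mem_append, List.mem_singleton] at hw
    rcases hw with hw | rfl
    · exact m4 w hw
    · exact Or.inl hx₁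
  by_cases h2 : ∀ i, G.Adj x₂ (c i) → (2 * t : ℤ) ∣ i - τ
  · exact ⟨x₂, m2, Or.inl (hB.exists_weak_ear m1.reverse
      (fun w hw => h.mem_of (hM w (List.mem_reverse.1 hw))) hτ
      (fun w hw ha => List.mem_reverse.2 (m3 w hw ha)) h2)⟩
  push Not at h2
  obtain ⟨u, hu, -⟩ := h2
  obtain ⟨M', x₃, n1, n2, n3, n4, n5, n6⟩ := h.extend hG m1.reverse hx₁ m5.reverse
  have hM' : ∀ w ∈ M' ++ (M ++ [x₁]).reverse, w ∈ R ∨ w ∈ nb G H R := by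
    intro w hw
    rcases List.mem_append.1 hw with hw | hw
    · exact n4 w hw
    · exact hM w (List.mem_reverse.1 hw)
  by_cases h3 : ∀ i, G.Adj x₃ (c i) → (2 * t : ℤ) ∣ i - u
  · exact ⟨x₃, n2, Or.inl (hB.exists_weak_ear n1.reverse
      (fun w hw => h.mem_of (hM' w (List.mem_reverse.1 hw))) hu
      (fun w hw ha => List.mem_reverse.2 (n3 w hw ha)) h3)⟩
  push Not at h3
  obtain ⟨v, hv, hvu⟩ := h3
  obtain ⟨k, hk⟩ := m6
  obtain ⟨k', hk'⟩ := n6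
  refine ⟨x₃, n2, Or.inr ⟨_, k + k', x₂, v, u, n1, ?_, hM', m2, n3, ?_, hv, hu, ?_⟩⟩
  · simp only [List.length_append, List.length_reverse, List.length_singleton]
    omega
  · intro w hw ha
    exact List.mem_append_right _ (List.mem_reverse.2 (m3 w hw ha))
  · intro hc
    exact hvu (by have := dvd_neg.2 hc; rwa [neg_sub] at this)

lemma Crit.witness_of_not_adj {b : Bool} {R : Finset V} (h : Crit G col H b R)
    (hB : Bad G col c t H) (hz : ∀ x ∈ R, ∀ i, ¬ G.Adj x (c i)) : ∃ x ∈ R, Weak G c t H x := by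
  have hG := hB.cyc
  obtain ⟨x₀, hx₀⟩ := h.nonempty
  obtain ⟨Q, i, q1, -, q3⟩ := hB.reach (h.sub hx₀) (q := c 0) (hB.out _ (h.sub hx₀) 0).symm
  obtain ⟨E, v, rfl, e1, e2, e3⟩ := q1.drop_last (hB.out _ (h.sub hx₀) i)
  have hEH : ∀ w ∈ E, w ∈ H := by
    intro w hw
    rcases q3 w (List.mem_append_left _ hw) with h1 | rfl
    · exact h1
    · exact absurd hw e3
  obtain ⟨L, v', y, l1, rfl, l3, l4, -, l6⟩ := e1.reverse.trim (S := fun w => w = v)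
    (T := fun w => w ∈ R ∨ w ∈ nb G H R) rfl (Or.inl hx₀)
  have hLH : ∀ w ∈ L, w ∈ H := fun w hw => hEH w (List.mem_reverse.1 (l4 w hw))
  have hyR : y ∉ R := by
    intro hy
    by_cases hvy : v' = y
    · subst hvy
      exact hz _ hy _ e2
    · obtain ⟨L', y', rfl, k1, k2, k3⟩ := l1.drop_last hvy
      have hy' : y' ∈ L' := k1.last_mem
      have := l6 y' (List.mem_append_left _ hy')
        (Or.inr (mem_nb.2 ⟨hLH _ (List.mem_append_left _ hy'), y, hy, k2.symm⟩))
      subst this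
      exact k3 hy'
  have hy : y ∈ nb G H R := l3.resolve_left hyR
  have hLR : ∀ w ∈ L, w ∉ R := by
    intro w hw hwR
    have := l6 w hw (Or.inl hwR)
    subst this
    exact hyR hwR
  obtain ⟨g, hg1, hg2⟩ := h.root hx₀
  obtain ⟨g1, -, g3⟩ := hg2 y hy
  have hL' : Pth G (g y :: L.reverse) (g y) v' :=
    l1.reverse.cons g3.symm (fun hc => hLR _ (List.mem_reverse.1 hc) g1)
  have hm : Mat G H R g (g y :: L.reverse) := by
    refine ⟨fun a ha a' ha' _ _ e => hg1 ha ha' e, fun a ha haL => ?_⟩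
    obtain ⟨a1, -, a3⟩ := hg2 a ha
    refine ⟨a1, ?_, a3⟩
    rw [List.mem_cons, not_or]
    refine ⟨fun e => ?_, fun hc => hLR _ (List.mem_reverse.1 hc) a1⟩
    have := hg1 ha hy e
    subst this
    exact haL (List.mem_cons_of_mem _ (List.mem_reverse.2 l1.last_mem))
  obtain ⟨M, x, m1, m2, m3, m4, -, -⟩ := h.extend hG hL' g1 hm
  refine ⟨x, m2, hB.exists_weak_ear m1.reverse ?_ e2
    (fun w hw ha => List.mem_reverse.2 (m3 w hw ha)) (fun i hi => absurd hi (hz x m2 i))⟩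
  intro w hw
  rcases List.mem_append.1 (List.mem_reverse.1 hw) with hw | hw
  · exact h.mem_of (m4 w hw)
  · rcases List.mem_cons.1 hw with rfl | hw
    · exact h.sub g1
    · exact hLH w (List.mem_reverse.1 hw)

lemma Crit.witness {b : Bool} {R : Finset V} (h : Crit G col H b R) (hB : Bad G col c t H) :
    ∃ x ∈ R, Weak G c t H x ∨ Strong G c t H R x := by
  by_cases hz : ∀ x ∈ R, ∀ i, ¬ G.Adj x (c i)
  · obtain ⟨x, hx, hw⟩ := h.witness_of_not_adj hB hz
    exact ⟨x, hx, Or.inl hw⟩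
  · push Not at hz
    obtain ⟨x, hx, i, hi⟩ := hz
    exact h.witness_of_adj hB hx hi

omit [Fintype V] in
lemma Crit.card_inter_lt {b : Bool} {R B : Finset V} (hR : Crit G col H b R)
    (hne : (R ∩ nb G H B).Nonempty) : #(B ∩ nb G H R) + 1 ≤ #(R ∩ nb G H B) := by
  have hss : R \ nb G H B ⊂ R := by
    rw [Finset.ssubset_iff_of_subset Finset.sdiff_subset]
    obtain ⟨x, hx⟩ := hne
    rw [Finset.mem_inter] at hx
    exact ⟨x, hx.1, fun hc => (Finset.mem_sdiff.1 hc).2 hx.2⟩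
  have h1 := hR.min _ hss
  have h2 : nb G H (R \ nb G H B) ⊆ nb G H R \ (B ∩ nb G H R) := by
    intro w hw
    refine Finset.mem_sdiff.2 ⟨nb_mono Finset.sdiff_subset hw, fun hc => ?_⟩
    obtain ⟨-, x, hx, hxw⟩ := mem_nb.1 hw
    obtain ⟨hx1, hx2⟩ := Finset.mem_sdiff.1 hx
    exact hx2 (mem_nb.2 ⟨hR.sub hx1, w, (Finset.mem_inter.1 hc).1, hxw.symm⟩)
  have h3 := Finset.card_le_card h2
  rw [Finset.card_sdiff_of_subset Finset.inter_subset_right] at h3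
  have h4 := Finset.card_le_card (Finset.inter_subset_right : B ∩ nb G H R ⊆ nb G H R)
  have h5 := hR.card
  have h6 := Finset.card_sdiff_add_card_inter R (nb G H B)
  omega

omit [Fintype V] in
lemma Crit.not_adj {b b' : Bool} {R B : Finset V} (hR : Crit G col H b R) (hB : Crit G col H b' B)
    {x y : V} (hx : x ∈ R) (hy : y ∈ B) : ¬ G.Adj x y := by
  intro ha
  have h1 := hR.card_inter_lt
    ⟨x, Finset.mem_inter.2 ⟨hx, mem_nb.2 ⟨hR.sub hx, y, hy, ha.symm⟩⟩⟩
  have h2 := hB.card_inter_lt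
    ⟨y, Finset.mem_inter.2 ⟨hy, mem_nb.2 ⟨hB.sub hy, x, hx, ha⟩⟩⟩
  omega

lemma Crit.weak_strong {b : Bool} {R : Finset V} (h : Crit G col H b R) (hB : Bad G col c t H)
    {w z : V} (hw : Weak G c t H w) (hwH : w ∈ H) (hzR : z ∈ R) (hz : Strong G c t H R z) :
    ∃ z' ∈ R, dg G c t H w + dg G c t H z' ≤ t + 1 := by
  have hG := hB.cyc
  obtain ⟨P, p, x', u, v, p1, p2, p3, p4, p5, p6, p7, p8, p9⟩ := hz
  obtain ⟨E, a, b', i, j, e1, e2, e3, e4, e5, e6, e7⟩ := hw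
  have ho : Out c P := fun q hq => hB.out _ (h.mem_of (p3 q hq))
  have d1 := hG.two_dH_le p1 p5
  have d2 := hG.two_dH_le p1.reverse (fun q hq ha => List.mem_reverse.2 (p6 q hq ha))
  rw [List.length_reverse] at d2
  by_contra! hcon
  have c1 := hcon z hzR
  have c2 := hcon x' p4
  rcases Nat.eq_zero_or_pos p with rfl | hp
  · have hPz : P = [z] := by
      obtain ⟨q, rfl⟩ := List.length_eq_one_iff.1 p2
      have := p1.2.2.1
      simp at this
      rw [this]
    subst hPz
    have hiso : ∀ q ∈ H, ¬ G.Adj z q := by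
      intro q hq ha
      have := p5 q hq ha
      rw [List.mem_singleton] at this
      exact ha.ne this.symm
    have hd := hB.two_le_dg hwH
    have hzE : z ∉ E := by
      intro hc
      obtain ⟨l₁, l₂, rfl⟩ := List.append_of_mem hc
      rcases l₂ with _ | ⟨q, l₂⟩
      · rcases List.eq_nil_or_concat l₁ with rfl | ⟨l, q, rfl⟩
        · simp at e6; omega
        · have := e1.1
          simp at this
          exact hiso q (e2 q (by simp)) this.2.symm
      · have h1 := (List.isChain_append.1 e1.1).2.1
        rw [List.isChain_cons_cons] at h1
        exact hiso q (e2 q (by simp)) h1.1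
    have := hG.ear_vertex_le e1 (fun q hq => hB.out _ (e2 q hq)) hzE (hB.out _ (h.sub hzR)) e3 e4 e5
    unfold dg at c1 e6 e7
    omega
  · have := hG.odd_path_le p1 ho hp p2 ((h.col_eq _ hzR).trans (h.col_eq _ p4).symm) p7 p8 p9
    unfold dg at c1 c2 e7
    omega

lemma Bad.false_of_crit (hB : Bad G col c t H) {R B : Finset V} (hR : Crit G col H true R)
    (hS : Crit G col H false B) : False := by
  have hG := hB.cyc
  have hpair : ∀ x ∈ R, ∀ y ∈ B, t + 2 ≤ dg G c t H x + dg G c t H y := fun x hx y hy =>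
    (Nat.le_add_right _ _).trans
      (hB.pair _ (hR.sub hx) _ (hS.sub hy) (hR.col_eq _ hx) (hS.col_eq _ hy))
  obtain ⟨x, hx, hwx⟩ := hR.witness hB
  obtain ⟨y, hy, hwy⟩ := hS.witness hB
  rcases hwx with hwx | hwx
  · rcases hwy with hwy | hwy
    · obtain ⟨E, a, b', i, j, e1, e2, e3, e4, e5, e6, e7⟩ := hwx
      obtain ⟨E', a', b'', i', j', e1', e2', e3', e4', e5', e6', e7'⟩ := hwy
      have := hpair x hx y hy
      omega
    · obtain ⟨z, hz, h1⟩ := hS.weak_strong hB hwx (hR.sub hx) hy hwy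
      have := hpair x hx z hz
      omega
  · rcases hwy with hwy | hwy
    · obtain ⟨z, hz, h1⟩ := hR.weak_strong hB hwy (hS.sub hy) hx hwx
      have := hpair z hz y hy
      omega
    · obtain ⟨P, p, x', u, v, p1, p2, p3, p4, p5, p6, p7, p8, p9⟩ := hwx
      obtain ⟨Q, q, y', u', v', q1, q2, q3, q4, q5, q6, q7, q8, q9⟩ := hwy
      have hdis : ∀ w ∈ P, w ∉ Q := by
        intro w hw hw'
        rcases p3 w hw with h1 | h1 <;> rcases q3 w hw' with h2 | h2
        · have := (hR.col_eq _ h1).symm.trans (hS.col_eq _ h2)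
          simp at this
        · obtain ⟨-, z, hz, ha⟩ := mem_nb.1 h2
          exact hR.not_adj hS h1 hz ha.symm
        · obtain ⟨-, z, hz, ha⟩ := mem_nb.1 h1
          exact hR.not_adj hS hz h2 ha
        · have := (hR.nb_col hG h1).symm.trans (hS.nb_col hG h2)
          simp at this
      have h1 := hG.two_odd_paths_le p1 q1 (fun w hw => hB.out _ (hR.mem_of (p3 w hw)))
        (fun w hw => hB.out _ (hS.mem_of (q3 w hw))) hdis p2 q2 (hR.col_eq _ hx) (hR.col_eq _ p4)
        (hS.col_eq _ hy) (hS.col_eq _ q4) p7 p8 p9 q7 q8 q9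
      have d1 := hG.two_dH_le p1 p5
      have d2 := hG.two_dH_le q1 q5
      have := hpair x hx y hy
      unfold dg at this
      omega

lemma Bad.elim (hB : Bad G col c t H) : False := by
  rcases exists_matching_or_crit (G := G) (H := H) (col := col) (S := {v ∈ H | col v = true}) true
    (Finset.filter_subset _ _) (fun x hx => (Finset.mem_filter.1 hx).2) with ⟨f, hf, hf'⟩ | ⟨R, -, hR⟩
  · exact hB.false_of_matching hf hf'
  rcases exists_matching_or_crit (G := G) (H := H) (col := col) (S := {v ∈ H | col v = false}) false
    (Finset.filter_subset _ _) (fun x hx => (Finset.mem_filter.1 hx).2) with ⟨f, hf, hf'⟩ | ⟨B, -, hS⟩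
  · have e : ({v ∈ H | (!col v) = true} : Finset V) = {v ∈ H | col v = false} := by
      ext v; simp
    exact hB.swap.false_of_matching (f := f) (by rw [e]; exact hf) (by rw [e]; exact hf')
  exact hB.false_of_crit hR hS

end BipCyc

namespace BipCyc
open Finset
open scoped Classical

variable {V : Type*} [Fintype V] {G : SimpleGraph V} {col : V → Bool} {c : ℤ → V} {t : ℕ}
  {H : Finset V}

omit [Fintype V] in
lemma card_sdiff_col {x : V} (hx : x ∈ H) (b : Bool) :
    #{v ∈ H \ {x} | col v = b} + (if col x = b then 1 else 0) = #{v ∈ H | col v = b} := by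
  have e : ({v ∈ H \ {x} | col v = b} : Finset V) = ({v ∈ H | col v = b} : Finset V).erase x := by
    ext v
    simp only [Finset.mem_filter, Finset.mem_sdiff, Finset.mem_singleton, Finset.mem_erase]
    tauto
  rw [e]
  split_ifs with hb
  · exact Finset.card_erase_add_one (Finset.mem_filter.2 ⟨hx, hb⟩)
  · rw [Finset.erase_eq_of_notMem (s := {v ∈ H | col v = b}) (fun hc => hb (Finset.mem_filter.1 hc).2),
      add_zero]

lemma card_Ep_le_sdiff (h : BipCycle G col c t) {x : V} (hd : dg G c t H x ≤ t) :
    #(Ep G col c H) ≤ #(Ep G col c (H \ {x})) + t :=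
  (card_Ep_le H {x}).trans (Nat.add_le_add_left ((card_Touch_singleton_le h x).trans hd) _)

lemma card_Ep_le_of_lt (h : BipCycle G col c t) (out : ∀ v ∈ H, ∀ i, v ≠ c i)
    (hlt : #{v ∈ H | col v = false} < #{v ∈ H | col v = true})
    (hs : #{v ∈ H | col v = false} ≤ t)
    (ih : ∀ x ∈ H, #{v ∈ H \ {x} | col v = false} ≤ t → #(Ep G col c (H \ {x})) ≤
      t * max #{v ∈ H \ {x} | col v = true} #{v ∈ H \ {x} | col v = false} +
        min #{v ∈ H \ {x} | col v = true} #{v ∈ H \ {x} | col v = false}) :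
    #(Ep G col c H) ≤ t * #{v ∈ H | col v = true} + #{v ∈ H | col v = false} := by
  obtain ⟨x, hx, hc, hd⟩ := exists_dg_le_of_lt h out hlt hs
  have h1 := card_Ep_le_sdiff h hd
  have h2 := card_sdiff_col (col := col) hx true
  have h3 := card_sdiff_col (col := col) hx false
  rw [hc] at h2 h3
  simp only [if_true, Bool.true_eq_false, if_false, add_zero] at h2 h3
  have h4 := ih x hx (by omega)
  rw [max_eq_left (by omega), min_eq_right (by omega), h3] at h4
  rw [← h2]
  linarith

/-- The sharp bound when one side of `H` has at most `t` vertices. -/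
lemma card_Ep_le_of_min (h : BipCycle G col c t) (out : ∀ v ∈ H, ∀ i, v ≠ c i)
    (hmin : min #{v ∈ H | col v = true} #{v ∈ H | col v = false} ≤ t) :
    #(Ep G col c H) ≤ t * max #{v ∈ H | col v = true} #{v ∈ H | col v = false} +
      min #{v ∈ H | col v = true} #{v ∈ H | col v = false} := by
  induction hn : #H using Nat.strong_induction_on generalizing H col c with
  | _ n ih =>
  have hcard : ∀ W ⊆ H, W.Nonempty → #(H \ W) < n := by
    intro W hW hne
    rw [← hn]
    exact Finset.card_lt_card (Finset.sdiff_ssubset hW hne)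
  have hout : ∀ W, ∀ v ∈ H \ W, ∀ i, v ≠ c i := fun W v hv => out v (Finset.mem_sdiff.1 hv).1
  rcases lt_trichotomy #{v ∈ H | col v = false} #{v ∈ H | col v = true} with hlt | heq | hgt
  · rw [max_eq_left hlt.le, min_eq_right hlt.le]
    rw [min_eq_right hlt.le] at hmin
    exact card_Ep_le_of_lt h out hlt hmin fun x hx hs =>
      ih _ (hcard {x} (by simpa using hx) ⟨x, by simp⟩) h (hout _) (min_le_of_right_le hs) rfl
  · rw [heq] at hmin ⊢
    rw [max_self, min_self]
    rw [min_self] at hmin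
    rcases H.eq_empty_or_nonempty with rfl | hne
    · have : Ep G col c ∅ = ∅ := by
        rw [Finset.eq_empty_iff_forall_notMem]
        intro p hp
        have := (mem_Ep.1 hp).2.2.2.2
        simp at this
      simp [this]
    by_contra! hcon
    refine (bad_of_lt h out hne heq.symm hmin ?_ hcon).elim
    intro W hW hWne
    refine ih _ (hcard W hW hWne) h (hout _) (min_le_of_left_le (le_trans ?_ hmin)) rfl
    exact Finset.card_le_card (Finset.filter_subset_filter _ Finset.sdiff_subset)
  · rw [max_eq_right hgt.le, min_eq_left hgt.le]
    rw [min_eq_left hgt.le] at hmin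
    have e : ∀ W : Finset V, ({v ∈ W | (!col v) = true} : Finset V) = {v ∈ W | col v = false} := by
      intro W; ext v; simp
    have e' : ∀ W : Finset V, ({v ∈ W | (!col v) = false} : Finset V) = {v ∈ W | col v = true} := by
      intro W; ext v; simp
    rw [← card_Ep_swap h]
    have := card_Ep_le_of_lt h.swap (H := H) (fun v hv i => out v hv (i + 1))
      (by rw [e, e']; exact hgt) (by rw [e']; exact hmin) fun x hx hs =>
        ih _ (hcard {x} (by simpa using hx) ⟨x, by simp⟩) h.swap
          (fun v hv i => hout _ v hv (i + 1)) (min_le_of_right_le hs) rfl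
    rwa [e, e'] at this

/-- The bound when both sides of `H` have at least `t` vertices. -/
lemma card_Ep_add_le (h : BipCycle G col c t) (out : ∀ v ∈ H, ∀ i, v ≠ c i)
    (h₁ : t ≤ #{v ∈ H | col v = true}) (h₂ : t ≤ #{v ∈ H | col v = false}) :
    #(Ep G col c H) + t * t ≤ t * (#{v ∈ H | col v = true} + #{v ∈ H | col v = false}) + t := by
  induction hn : #H using Nat.strong_induction_on generalizing H with
  | _ n ih =>
  by_cases hmin : min #{v ∈ H | col v = true} #{v ∈ H | col v = false} ≤ t
  · have h3 := card_Ep_le_of_min h out hmin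
    have h4 := max_add_min #{v ∈ H | col v = true} #{v ∈ H | col v = false}
    have h5 : min #{v ∈ H | col v = true} #{v ∈ H | col v = false} = t :=
      le_antisymm hmin (le_min h₁ h₂)
    rw [h5] at h3 h4
    rw [← h4]
    linarith
  rw [not_le, lt_min_iff] at hmin
  obtain ⟨x, hx, hd⟩ := exists_dg_le h out
    ((Finset.card_pos.1 (by omega : 0 < #{v ∈ H | col v = true})).mono (Finset.filter_subset _ _))
  have h1 := card_Ep_le_sdiff h hd
  have h2 := card_sdiff_col (col := col) hx true
  have h3 := card_sdiff_col (col := col) hx false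
  have h4 : #{v ∈ H \ {x} | col v = true} + #{v ∈ H \ {x} | col v = false} + 1 =
      #{v ∈ H | col v = true} + #{v ∈ H | col v = false} := by
    rcases hc : col x <;> rw [hc] at h2 h3 <;> simp at h2 h3 <;> omega
  have h5 := ih #(H \ {x}) (by
    rw [← hn]; exact Finset.card_lt_card (Finset.sdiff_ssubset (by simpa using hx) ⟨x, by simp⟩))
    (H := H \ {x}) (fun v hv => out v (Finset.mem_sdiff.1 hv).1)
    (by split_ifs at h2 <;> omega) (by split_ifs at h3 <;> omega) rfl
  rw [← h4]
  linarith

end BipCyc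

namespace BipCyc
open Finset
open scoped Classical

variable {V : Type*} {G : SimpleGraph V} {col : V → Bool} {c : ℤ → V} {t : ℕ} {H : Finset V}

lemma Pth.exists_walk {l : List V} {a b : V} (h : Pth G l a b) :
    ∃ p : G.Walk a b, p.support = l := by
  induction l generalizing a with
  | nil => exact absurd rfl h.ne_nil
  | cons x l ih =>
    have hx := h.2.2.1
    simp only [List.head?_cons, Option.some.injEq] at hx
    subst hx
    rcases l with _ | ⟨y, l⟩
    · have := h.2.2.2
      simp only [List.getLast?_singleton, Option.some.injEq] at this
      subst this
      exact ⟨.nil, rfl⟩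
    · have h1 := h.1
      rw [List.isChain_cons_cons] at h1
      obtain ⟨p, hp⟩ := ih (Pth.split (l₁ := [x]) h).2
      exact ⟨.cons h1.1 p, by rw [SimpleGraph.Walk.support_cons, hp]⟩

lemma not_mem_edges {a b : V} {p : G.Walk a b} (hp : p.IsPath) (hl : 2 ≤ p.length) :
    s(b, a) ∉ p.edges := by
  cases p with
  | nil => simp at hl
  | cons h q =>
    rw [SimpleGraph.Walk.cons_isPath_iff] at hp
    rw [SimpleGraph.Walk.edges_cons, List.mem_cons, not_or]
    refine ⟨fun he => ?_, fun he => hp.2 (q.snd_mem_support_of_mem_edges he)⟩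
    rw [Sym2.eq_swap, Sym2.congr_right] at he
    subst he
    have := SimpleGraph.Walk.length_eq_zero_iff.2 (SimpleGraph.Walk.isPath_iff_nil.1 hp.1)
    rw [SimpleGraph.Walk.length_cons] at hl
    omega

lemma Pth.length_le_of_longest {l : List V} {a b : V} {N : ℕ} (h : Pth G l a b)
    (hl : 3 ≤ l.length) (hab : G.Adj b a)
    (hN : ∀ (u : V) (w : G.Walk u u), w.IsCycle → w.length ≤ N) : l.length ≤ N := by
  obtain ⟨p, rfl⟩ := h.exists_walk
  have hp : p.IsPath := p.isPath_def.2 h.2.1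
  rw [SimpleGraph.Walk.length_support] at hl ⊢
  have := hN b (.cons hab p) ((SimpleGraph.Walk.cons_isCycle_iff _ _).2
    ⟨hp, not_mem_edges hp (by omega)⟩)
  simpa using this

/-- The vertices of a closed walk of length `2 * t`, indexed periodically. -/
def cyc {v₀ : V} (C : G.Walk v₀ v₀) (t : ℕ) (i : ℤ) : V := C.getVert (i % (2 * t)).toNat

lemma cyc_adj {v₀ : V} {C : G.Walk v₀ v₀} (hlen : C.length = 2 * t) (ht : 1 ≤ t) (i : ℤ) :
    G.Adj (cyc C t i) (cyc C t (i + 1)) := by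
  have h0 : 0 ≤ i % (2 * t) := Int.emod_nonneg _ (by omega)
  have h1 : i % (2 * t) < 2 * t := Int.emod_lt_of_pos _ (by omega)
  have h2 := C.adj_getVert_succ (i := (i % (2 * t)).toNat) (by omega)
  have h3 : (i + 1) % (2 * t) = (i % (2 * t) + 1) % (2 * t) := by simp
  unfold cyc
  by_cases h4 : i % (2 * t) + 1 < 2 * t
  · rw [h3, Int.emod_eq_of_lt (by omega) h4, Int.toNat_add h0 (by omega)]
    exact h2
  · have h5 : i % (2 * t) + 1 = 2 * t := by omega
    rw [h3, h5, Int.emod_self, Int.toNat_zero, C.getVert_zero]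
    have h6 : (i % (2 * t)).toNat + 1 = C.length := by omega
    rw [h6, C.getVert_length] at h2
    exact h2

lemma cyc_eq_iff {v₀ : V} {C : G.Walk v₀ v₀} (hC : C.IsCycle) (hlen : C.length = 2 * t)
    (ht : 1 ≤ t) {i j : ℤ} : cyc C t i = cyc C t j ↔ (2 * t : ℤ) ∣ j - i := by
  have h0 : ∀ i : ℤ, 0 ≤ i % (2 * t) := fun i => Int.emod_nonneg _ (by omega)
  have h1 : ∀ i : ℤ, i % (2 * t) < 2 * t := fun i => Int.emod_lt_of_pos _ (by omega)
  rw [← Int.modEq_iff_dvd]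
  constructor
  · intro h
    have h2 := hC.getVert_injOn' (by simp; have := h1 i; have := h0 i; omega)
      (by simp; have := h1 j; have := h0 j; omega) h
    have := h0 i
    have := h0 j
    show i % (2 * t) = j % (2 * t)
    omega
  · intro h
    unfold cyc
    rw [h.eq]

lemma exists_cyc {v₀ : V} {C : G.Walk v₀ v₀} (hlen : C.length = 2 * t) {v : V} :
    v ∈ C.support ↔ ∃ i, v = cyc C t i := by
  constructor
  · intro h
    obtain ⟨k, rfl, hk⟩ := SimpleGraph.Walk.mem_support_iff_exists_getVert.1 h
    rcases Nat.lt_or_ge k (2 * t) with h1 | h1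
    · refine ⟨k, ?_⟩
      unfold cyc
      rw [Int.emod_eq_of_lt (by omega) (by omega), Int.toNat_natCast]
    · refine ⟨0, ?_⟩
      have : k = C.length := by omega
      subst this
      simp [cyc]
  · rintro ⟨i, rfl⟩
    exact C.getVert_mem_support _

lemma bipCycle_cyc {v₀ : V} {C : G.Walk v₀ v₀} (hC : C.IsCycle) (hlen : C.length = 2 * t)
    (hlongest : ∀ (u : V) (w : G.Walk u u), w.IsCycle → w.length ≤ C.length)
    (hcol : ∀ u v, G.Adj u v → col u ≠ col v) (h₀ : col v₀ = true) :
    BipCycle G col (cyc C t) t := by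
  have h3 := hC.three_le_length
  refine ⟨by omega, hcol _ _, cyc_adj hlen (by omega), cyc_eq_iff hC hlen (by omega), ?_, ?_⟩
  · have hstep : ∀ i, col (cyc C t (i + 1)) = !col (cyc C t i) := fun i => by
      have := hcol _ _ (cyc_adj (C := C) hlen (by omega) i)
      revert this
      cases col (cyc C t i) <;> cases col (cyc C t (i + 1)) <;> simp
    intro i
    induction i with
    | zero => simp [cyc, h₀]
    | succ k ih => rw [hstep, Int.even_add_one, ← ih]; simp
    | pred k ih =>
      have h1 := hstep (-(k : ℤ) - 1)
      rw [sub_add_cancel] at h1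
      have h2 := Int.even_add_one (n := -(k : ℤ) - 1)
      rw [sub_add_cancel, ← ih, h1] at h2
      simpa using not_congr h2
  · intro l a b hl h hab
    have := hl.length_le_of_longest h hab hlongest
    omega

lemma BipCycle.card_col (h : BipCycle G col c t) {S : Finset V} (hS : ∀ v, v ∈ S ↔ ∃ i, v = c i)
    (b : Bool) : #{v ∈ S | col v = b} = t := by
  have ht := h.two_le
  set e : ℤ := if b then 0 else 1 with he
  have hcol : ∀ i, col (c i) = b ↔ Even (i + e) := by
    intro i
    rw [he]
    cases b
    · rw [← Bool.not_eq_true, h.even]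
      simp
    · simpa using h.even
  have himg : ({v ∈ S | col v = b} : Finset V) = (range t).image fun k : ℕ => c (2 * k + e) := by
    ext v
    simp only [Finset.mem_filter, hS, Finset.mem_image, Finset.mem_range]
    constructor
    · rintro ⟨⟨i, rfl⟩, hi⟩
      rw [hcol] at hi
      obtain ⟨k, hk⟩ := hi
      have h0 : 0 ≤ (k - e) % t := Int.emod_nonneg _ (by omega)
      have h1 : (k - e) % t < t := Int.emod_lt_of_pos _ (by omega)
      refine ⟨((k - e) % t).toNat, by omega, ?_⟩
      rw [h.inj, Int.toNat_of_nonneg h0]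
      refine ⟨(k - e) / t, ?_⟩
      have := Int.emod_add_mul_ediv (k - e) t
      linear_combination hk - 2 * this
    · rintro ⟨k, -, rfl⟩
      exact ⟨⟨_, rfl⟩, (hcol _).2 ⟨k + e, by ring⟩⟩
  rw [himg, Finset.card_image_of_injOn, Finset.card_range]
  intro k hk k' hk' hkk
  simp only [Finset.coe_range, Set.mem_Iio] at hk hk'
  have h1 := (h.inj).1 hkk
  have h2 : (2 * t : ℤ) ∣ 2 * ((k' : ℤ) - k) := by convert h1 using 1; ring
  have h3 := Int.dvd_of_mul_dvd_mul_left two_ne_zero h2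
  have := Int.eq_zero_of_abs_lt_dvd h3 (by rw [abs_lt]; omega)
  omega

lemma ncard_le_card_Ep [Fintype V] (hcol : ∀ u v, G.Adj u v → col u ≠ col v)
    (hH : ∀ v, v ∈ H ∨ ∃ i, v = c i) :
    {e ∈ G.edgeSet | ∃ x, x ∈ e ∧ x ∈ H}.ncard ≤ #(Ep G col c H) := by
  have hsub : {e ∈ G.edgeSet | ∃ x, x ∈ e ∧ x ∈ H} ⊆
      (((Ep G col c H).image fun p => s(p.1, p.2) : Finset (Sym2 V)) : Set (Sym2 V)) := by
    intro e
    induction e using Sym2.ind with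
    | _ u v =>
    rintro ⟨hadj, x, hx, hxH⟩
    rw [SimpleGraph.mem_edgeSet] at hadj
    rw [Sym2.mem_iff] at hx
    have hor : u ∈ H ∨ v ∈ H := by
      rcases hx with rfl | rfl
      · exact Or.inl hxH
      · exact Or.inr hxH
    rw [Finset.mem_coe, Finset.mem_image]
    by_cases hu : col u = true
    · exact ⟨(u, v), mem_Ep.2 ⟨hu, hadj, hH u, hH v, hor⟩, rfl⟩
    · have hv : col v = true := by
        have := hcol u v hadj
        revert this hu
        cases col u <;> cases col v <;> simp
      exact ⟨(v, u), mem_Ep.2 ⟨hv, hadj.symm, hH v, hH u, hor.symm⟩, Sym2.eq_swap⟩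
  refine (Set.ncard_le_ncard hsub (Finset.finite_toSet _)).trans ?_
  rw [Set.ncard_coe_finset]
  exact Finset.card_image_le

lemma ncard_le_of_col [Fintype V] {v₀ : V} {C : G.Walk v₀ v₀} (hC : C.IsCycle)
    (hlen : C.length = 2 * t)
    (hlongest : ∀ (u : V) (w : G.Walk u u), w.IsCycle → w.length ≤ C.length)
    (hcol : ∀ u v, G.Adj u v → col u ≠ col v) (h₀ : col v₀ = true) {n m : ℕ}
    (hn : #{v | col v = true} = n) (hm : #{v | col v = false} = m) (hn' : 2 * t ≤ n)
    (hm' : 2 * t ≤ m) :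
    ({e ∈ G.edgeSet | ∃ x, x ∈ e ∧ x ∉ C.support}.ncard : ℤ) ≤ t * (m + n + 1 - 3 * t) := by
  have h := bipCycle_cyc hC hlen hlongest hcol h₀
  have ht := h.two_le
  set S : Finset V := C.support.toFinset
  have hS : ∀ v, v ∈ S ↔ ∃ i, v = cyc C t i := fun v => by
    rw [List.mem_toFinset, exists_cyc hlen]
  have hcard : ∀ b, #{v ∈ univ \ S | col v = b} + t = #{v | col v = b} := by
    intro b
    have h1 : ({v ∈ univ \ S | col v = b} : Finset V) =
        ({v | col v = b} : Finset V) \ {v ∈ S | col v = b} := by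
      ext v; simp; tauto
    have h2 : ({v ∈ S | col v = b} : Finset V) ⊆ ({v | col v = b} : Finset V) :=
      Finset.filter_subset_filter _ (Finset.subset_univ _)
    rw [h1, ← h.card_col hS b]
    exact Finset.card_sdiff_add_card_eq_card h2
  have h1 := hcard true
  have h2 := hcard false
  have h3 := card_Ep_add_le h (H := univ \ S)
    (fun v hv i hi => (Finset.mem_sdiff.1 hv).2 ((hS v).2 ⟨i, hi⟩)) (by omega) (by omega)
  have h4 := ncard_le_card_Ep (G := G) (col := col) (c := cyc C t) (H := univ \ S) hcol (fun v => by
    by_cases hv : v ∈ S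
    · exact Or.inr ((hS v).1 hv)
    · exact Or.inl (by simpa using hv))
  have e : {e ∈ G.edgeSet | ∃ x, x ∈ e ∧ x ∈ univ \ S} =
      {e ∈ G.edgeSet | ∃ x, x ∈ e ∧ x ∉ C.support} := by simp [S]
  rw [e] at h4
  have h5 : #{v ∈ univ \ S | col v = true} + #{v ∈ univ \ S | col v = false} + 2 * t = n + m := by
    omega
  zify at h3 h4 h5
  nlinarith

end BipCyc

/-- **Theorem (Li–Ning, bipartite Bondy-type bound, case (2)).** Let `G = (X,Y;E)` be a
bipartite graph with `|X| = n`, `|Y| = m`, and let `C` be a longest cycle of `G` with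
`|V(C)| = 2t`, where `n ≥ m ≥ t`. If `m ≥ 2t`, then the number of edges of `G` with at
least one endpoint outside `V(C)` is at most `t(m + n + 1 - 3t)`. -/
theorem stmt_7 {V : Type} [Fintype V] [DecidableEq V]
    (G : SimpleGraph V) (X Y : Finset V) (n m t : ℕ)
    (hpart : ∀ v : V, v ∈ X ∨ v ∈ Y) (hdisj : Disjoint X Y)
    (hbip : ∀ u v : V, G.Adj u v → (u ∈ X ∧ v ∈ Y) ∨ (u ∈ Y ∧ v ∈ X))
    (hX : X.card = n) (hY : Y.card = m)
    (v₀ : V) (C : G.Walk v₀ v₀) (hC : C.IsCycle)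
    (hlongest : ∀ (u : V) (w : G.Walk u u), w.IsCycle → w.length ≤ C.length)
    (hlen : C.length = 2 * t)
    (hmn : m ≤ n) (htm : t ≤ m) (hm2t : 2 * t ≤ m) :
    ({e ∈ G.edgeSet | ∃ x, x ∈ e ∧ x ∉ C.support}.ncard : ℤ) ≤
      (t : ℤ) * ((m : ℤ) + (n : ℤ) + 1 - 3 * (t : ℤ)) := by
  have hXY : ∀ v, v ∈ Y ↔ v ∉ X := fun v =>
    ⟨fun hy hx => Finset.disjoint_left.1 hdisj hx hy, fun hx => (hpart v).resolve_left hx⟩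
  have hne : ∀ u v, G.Adj u v → (u ∈ X ↔ v ∉ X) := by
    intro u v ha
    have := hbip u v ha
    rw [hXY, hXY] at this
    tauto
  by_cases hv₀ : v₀ ∈ X
  · refine BipCyc.ncard_le_of_col (col := fun v => decide (v ∈ X)) hC hlen hlongest
      (fun u v ha => by simp [hne u v ha]) (by simpa using hv₀) ?_ ?_ (by omega) hm2t
    · rw [← hX]; congr 1; ext v; simp
    · rw [← hY]; congr 1; ext v; simp [hXY]
  · rw [add_comm (m : ℤ)]
    refine BipCyc.ncard_le_of_col (col := fun v => decide (v ∉ X)) hC hlen hlongest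
      (fun u v ha => by simp [hne u v ha]) (by simpa using hv₀) ?_ ?_ hm2t (by omega)
    · rw [← hY]; congr 1; ext v; simp [hXY]
    · rw [← hX]; congr 1; ext v; simp
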